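/- Harnack principle in a bounded cylinder: Let Ω ⊂ ℝⁿ be a bounded domain with diam(Ω) ≤ R₀, let T > 0, Q_Ω := Ω × (0,T), and let δ > 0 be a constant such that Ω^δ := {x ∈ Ω : dist(x, ∂Ω) > δ} is a connected nonempty set. Let u ∈ C^{2,1}(Q_Ω) satisfy u ≥ 0 and −u_t + Lu = 0 at every point of Q_Ω. Then for all X = (x,t) and Y = (y,s) in Q_Ω^δ := Ω^δ × (δ², T) with s − t ≥ δ², one has u(X) ≤ N · u(Y), where N is a positive constant depending only on n, ν, S, R₀, T and δ. -/

import Mathlib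

open MeasureTheory ENNReal Metric Set RealInnerProductSpace

noncomputable section

/-- `n`-dimensional Euclidean space. -/
abbrev En (n : ℕ) : Type := EuclideanSpace ℝ (Fin n)

variable {n : ℕ}

/-- Time derivative `u_t`. -/
def Dt (u : En n × ℝ → ℝ) (X : En n × ℝ) : ℝ :=
  deriv (fun t => u (X.1, t)) X.2

/-- First spatial derivative `D_i u`. -/
def Dx (u : En n × ℝ → ℝ) (i : Fin n) (X : En n × ℝ) : ℝ :=
  fderiv ℝ (fun x => u (x, X.2)) X.1 (EuclideanSpace.single i 1)

/-- Second spatial derivative `D_{ij} u`. -/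
def Dxx (u : En n × ℝ → ℝ) (i j : Fin n) (X : En n × ℝ) : ℝ :=
  Dx (Dx u j) i X

/-- `u` is of class `C^{2,1}` on `Q`: `u`, `D_i u`, `D_{ij} u`, `u_t` exist and are
continuous on `Q`. -/
structure IsC21 (u : En n × ℝ → ℝ) (Q : Set (En n × ℝ)) : Prop where
  cont : ContinuousOn u Q
  diff_t : ∀ X ∈ Q, DifferentiableAt ℝ (fun t => u (X.1, t)) X.2
  diff_x : ∀ X ∈ Q, DifferentiableAt ℝ (fun x => u (x, X.2)) X.1
  diff_xx : ∀ j : Fin n, ∀ X ∈ Q, DifferentiableAt ℝ (fun x => Dx u j (x, X.2)) X.1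
  cont_t : ContinuousOn (Dt u) Q
  cont_x : ∀ i, ContinuousOn (Dx u i) Q
  cont_xx : ∀ i j, ContinuousOn (Dxx u i j) Q

/-- Uniform parabolicity with constant `ν` on `Q`:
`ν⁻¹|ξ|² ≤ Σ a_ij ξ_i ξ_j` and `Σ a_ij² ≤ ν²`. -/
def UnifParabolic (ν : ℝ) (a : En n × ℝ → Matrix (Fin n) (Fin n) ℝ)
    (Q : Set (En n × ℝ)) : Prop :=
  ∀ X ∈ Q, (∀ ξ : Fin n → ℝ, ν⁻¹ * (∑ i, ξ i ^ 2) ≤ ∑ i, ∑ j, a X i j * ξ i * ξ j) ∧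
    (∑ i, ∑ j, (a X i j) ^ 2) ≤ ν ^ 2

/-- `Lu = Σ_{ij} a_ij D_ij u + Σ_i b_i D_i u`. -/
def Lop (a : En n × ℝ → Matrix (Fin n) (Fin n) ℝ) (b : En n × ℝ → En n)
    (u : En n × ℝ → ℝ) (X : En n × ℝ) : ℝ :=
  (∑ i, ∑ j, a X i j * Dxx u i j X) + ∑ i, b X i * Dx u i X

/-- `∫ (ess sup_t |f(x,t)|)ⁿ dx`, the `n`-th power of the `L^n_x L^∞_t` norm of `f`
over the set `Q ⊆ ℝⁿ × ℝ`. -/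
def LxnLtinfPow {E : Type*} [NNNorm E] (f : En n × ℝ → E) (Q : Set (En n × ℝ)) : ℝ≥0∞ :=
  ∫⁻ x, (essSup (fun t => (‖f (x, t)‖₊ : ℝ≥0∞)) (volume.restrict {t | (x, t) ∈ Q})) ^ n

/-- The `L^n_x L^∞_t` norm of `f` over `Q`. -/
def LxnLtinf {E : Type*} [NNNorm E] (f : En n × ℝ → E) (Q : Set (En n × ℝ)) : ℝ≥0∞ :=
  (LxnLtinfPow f Q) ^ (1 / (n : ℝ))

/-- The box `B_ρ(y) × (t₁, t₂)`. -/
def box (y : En n) (ρ t₁ t₂ : ℝ) : Set (En n × ℝ) := ball y ρ ×ˢ Ioo t₁ t₂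

/-- The standard parabolic cylinder `Q_r(Y) = B_r(y) × (s - r², s)`. -/
def pcyl (Y : En n × ℝ) (r : ℝ) : Set (En n × ℝ) := box Y.1 r (Y.2 - r ^ 2) Y.2

/-- The slanted cylinder `V_r(Y) = {(x,t) : |x - (t/s)y| < r, 0 < t < s}`. -/
def slantCyl (Y : En n × ℝ) (r : ℝ) : Set (En n × ℝ) :=
  {X | ‖X.1 - (X.2 / Y.2) • Y.1‖ < r ∧ 0 < X.2 ∧ X.2 < Y.2}

/-- Supremum of the positive part `u₊` over a set `A`. -/
def supPos (u : En n × ℝ → ℝ) (A : Set (En n × ℝ)) : ℝ :=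
  sSup ((fun X => max (u X) 0) '' A)

/-- `Ω` is a Lipschitz domain with character `(rΩ, mΩ)`: at every boundary point `y`
there is a coordinate frame, encoded by the unit "vertical" direction `e`, in which
`Ω ∩ B_{rΩ}(y)` is the region above the graph of an `mΩ`-Lipschitz function `φ`
of the tangential variables. -/
def IsLipschitzDomain (Ω : Set (En n)) (rΩ mΩ : ℝ) : Prop :=
  0 < rΩ ∧ 0 ≤ mΩ ∧
  ∀ y ∈ frontier Ω, ∃ (e : En n) (φ : En n → ℝ),
    ‖e‖ = 1 ∧ LipschitzWith (Real.toNNReal mΩ) φ ∧ φ 0 = 0 ∧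
    (∀ x, x ∈ Ω ∩ ball y rΩ ↔
      dist x y < rΩ ∧ φ ((x - y) - ⟪x - y, e⟫ • e) < ⟪x - y, e⟫) ∧
    (∀ ρ : ℝ, 0 < ρ → ρ ≤ rΩ → y + ρ • e ∈ Ω)


namespace Hk

/-- Spatial coordinate direction in space-time. -/
def ex (i : Fin n) : En n × ℝ := (EuclideanSpace.single i 1, 0)

def Tt (u : En n × ℝ → ℝ) (X : En n × ℝ) : ℝ := fderiv ℝ u X (0, 1)

def Gi (u : En n × ℝ → ℝ) (i : Fin n) (X : En n × ℝ) : ℝ := fderiv ℝ u X (ex i)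

def Gr (u : En n × ℝ → ℝ) (X : En n × ℝ) : En n := WithLp.toLp 2 (fun i => Gi u i X)

def Hh (u : En n × ℝ → ℝ) (i j : Fin n) (X : En n × ℝ) : ℝ := fderiv ℝ (Gi u j) X (ex i)

def Ell (ν : ℝ) (a : Matrix (Fin n) (Fin n) ℝ) : Prop :=
  (∀ ξ : Fin n → ℝ, ν⁻¹ * (∑ i, ξ i ^ 2) ≤ ∑ i, ∑ j, a i j * ξ i * ξ j) ∧
    (∑ i, ∑ j, (a i j) ^ 2) ≤ ν ^ 2

/-- second order part -/
def aH (a : Matrix (Fin n) (Fin n) ℝ) (u : En n × ℝ → ℝ) (X : En n × ℝ) : ℝ :=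
  ∑ i, ∑ j, a i j * Hh u i j X

def SubAt (ν : ℝ) (β : En n → ℝ) (u : En n × ℝ → ℝ) (X : En n × ℝ) : Prop :=
  ∃ a, Ell ν a ∧ Tt u X - aH a u X ≤ β X.1 * ‖Gr u X‖

/-- closed cylinder -/
def cyl (z : En n) (R t₀ t₁ : ℝ) : Set (En n × ℝ) := closedBall z R ×ˢ Icc t₀ t₁

@[simp] lemma Gr_apply (u : En n × ℝ → ℝ) (X : En n × ℝ) (i : Fin n) : Gr u X i = Gi u i X := rfl

lemma mem_cyl {z : En n} {R t₀ t₁ : ℝ} {X : En n × ℝ} :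
    X ∈ cyl z R t₀ t₁ ↔ ‖X.1 - z‖ ≤ R ∧ t₀ ≤ X.2 ∧ X.2 ≤ t₁ := by
  simp [cyl, Set.mem_prod, dist_eq_norm]

lemma isCompact_cyl (z : En n) (R t₀ t₁ : ℝ) : IsCompact (cyl z R t₀ t₁) :=
  (isCompact_closedBall z R).prod isCompact_Icc

section calculus
variable {u v : En n × ℝ → ℝ}

lemma contDiff_dir (hu : ContDiff ℝ 2 u) (d : En n × ℝ) :
    ContDiff ℝ 1 (fun X => fderiv ℝ u X d) :=
  (hu.fderiv_right (m := 1) (by norm_num)).clm_apply contDiff_const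

lemma contDiff_Gi (hu : ContDiff ℝ 2 u) (i : Fin n) : ContDiff ℝ 1 (Gi u i) := contDiff_dir hu _

lemma contDiff_Tt (hu : ContDiff ℝ 2 u) : ContDiff ℝ 1 (Tt u) := contDiff_dir hu _

lemma contDiff_Gr (hu : ContDiff ℝ 2 u) : ContDiff ℝ 1 (Gr u) := by
  rw [contDiff_euclidean]
  exact fun i => contDiff_Gi hu i

lemma continuous_Hh (hu : ContDiff ℝ 2 u) (i j : Fin n) : Continuous (Hh u i j) :=
  ((contDiff_Gi hu j).continuous_fderiv (by norm_num)).clm_apply continuous_const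

lemma sum_single_eq (x : En n) : x = ∑ i, x i • (EuclideanSpace.single i (1 : ℝ)) := by
  ext j
  simp [Pi.single_apply]

lemma fderiv_eq (u : En n × ℝ → ℝ) (X : En n × ℝ) (d : En n × ℝ) :
    fderiv ℝ u X d = ⟪Gr u X, d.1⟫ + Tt u X * d.2 := by
  have : d = (∑ i, d.1 i • ex i) + d.2 • ((0, 1) : En n × ℝ) := by
    apply Prod.ext
    · simp only [Prod.fst_add, Prod.fst_sum, Prod.smul_fst, ex, smul_zero, add_zero]
      exact sum_single_eq d.1
    · simp [Prod.snd_sum, ex]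
  conv_lhs => rw [this]
  rw [map_add, map_sum]
  simp only [map_smul, smul_eq_mul]
  rw [PiLp.inner_apply]
  simp only [Gr_apply, Gi, Tt]
  rw [mul_comm d.2]
  congr 1

lemma hasFDerivAt_Gr (hu : ContDiff ℝ 2 u) (X : En n × ℝ) :
    HasFDerivAt (Gr u) (fderiv ℝ (Gr u) X) X :=
  ((contDiff_Gr hu).differentiable (by norm_num)).differentiableAt.hasFDerivAt

lemma fderiv_Gr_apply (hu : ContDiff ℝ 2 u) (X d : En n × ℝ) (j : Fin n) :
    fderiv ℝ (Gr u) X d j = fderiv ℝ (Gi u j) X d := by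
  have h := (hasFDerivWithinAt_euclidean.1 ((hasFDerivAt_Gr hu X).hasFDerivWithinAt (s := univ))) j
  rw [hasFDerivWithinAt_univ] at h
  have h2 : fderiv ℝ (Gi u j) X = (PiLp.proj 2 (fun _ => ℝ) j).comp (fderiv ℝ (Gr u) X) := h.fderiv
  rw [h2]; rfl

lemma Hh_symm (hu : ContDiff ℝ 2 u) (i j : Fin n) (X) : Hh u i j X = Hh u j i X := by
  have hs : IsSymmSndFDerivAt ℝ u X :=
    hu.contDiffAt.isSymmSndFDerivAt (by simp)
  have key : ∀ d e : En n × ℝ, fderiv ℝ (fun Y => fderiv ℝ u Y d) X e =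
      fderiv ℝ (fderiv ℝ u) X e d := by
    intro d e
    have h1 : DifferentiableAt ℝ (fderiv ℝ u) X :=
      ((hu.fderiv_right (m := 1) (by norm_num)).differentiable (by norm_num)).differentiableAt
    rw [fderiv_clm_apply h1 (differentiableAt_const d)]
    simp
  unfold Hh Gi
  rw [key, key]
  exact hs _ _

lemma Gi_add (hu : ContDiff ℝ 2 u) (hv : ContDiff ℝ 2 v) (i : Fin n) (X) :
    Gi (fun Y => u Y + v Y) i X = Gi u i X + Gi v i X := by
  unfold Gi
  rw [fderiv_fun_add (hu.differentiable (by norm_num)).differentiableAt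
    (hv.differentiable (by norm_num)).differentiableAt]; rfl

lemma Tt_add (hu : ContDiff ℝ 2 u) (hv : ContDiff ℝ 2 v) (X) :
    Tt (fun Y => u Y + v Y) X = Tt u X + Tt v X := by
  unfold Tt
  rw [fderiv_fun_add (hu.differentiable (by norm_num)).differentiableAt
    (hv.differentiable (by norm_num)).differentiableAt]; rfl

lemma Gr_add (hu : ContDiff ℝ 2 u) (hv : ContDiff ℝ 2 v) (X) :
    Gr (fun Y => u Y + v Y) X = Gr u X + Gr v X := by
  ext i; simp [Gi_add hu hv]

lemma Hh_add (hu : ContDiff ℝ 2 u) (hv : ContDiff ℝ 2 v) (i j : Fin n) (X) :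
    Hh (fun Y => u Y + v Y) i j X = Hh u i j X + Hh v i j X := by
  unfold Hh
  have : Gi (fun Y => u Y + v Y) j = fun X => Gi u j X + Gi v j X := by
    funext X; exact Gi_add hu hv j X
  rw [this, fderiv_fun_add ((contDiff_Gi hu j).differentiable (by norm_num)).differentiableAt
    ((contDiff_Gi hv j).differentiable (by norm_num)).differentiableAt]; rfl

lemma aH_add (hu : ContDiff ℝ 2 u) (hv : ContDiff ℝ 2 v) (a) (X) :
    aH a (fun Y => u Y + v Y) X = aH a u X + aH a v X := by
  simp [aH, Hh_add hu hv, mul_add, Finset.sum_add_distrib]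

lemma Gi_const_mul (c : ℝ) (hu : ContDiff ℝ 2 u) (i : Fin n) (X) :
    Gi (fun Y => c * u Y) i X = c * Gi u i X := by
  unfold Gi
  rw [fderiv_const_mul (hu.differentiable (by norm_num)).differentiableAt]; rfl

lemma Tt_const_mul (c : ℝ) (hu : ContDiff ℝ 2 u) (X) :
    Tt (fun Y => c * u Y) X = c * Tt u X := by
  unfold Tt
  rw [fderiv_const_mul (hu.differentiable (by norm_num)).differentiableAt]; rfl

lemma Gr_const_mul (c : ℝ) (hu : ContDiff ℝ 2 u) (X) :
    Gr (fun Y => c * u Y) X = c • Gr u X := by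
  ext i; simp [Gi_const_mul c hu]

lemma Hh_const_mul (c : ℝ) (hu : ContDiff ℝ 2 u) (i j : Fin n) (X) :
    Hh (fun Y => c * u Y) i j X = c * Hh u i j X := by
  unfold Hh
  have : Gi (fun Y => c * u Y) j = fun X => c * Gi u j X := by
    funext X; exact Gi_const_mul c hu j X
  rw [this, fderiv_const_mul ((contDiff_Gi hu j).differentiable (by norm_num)).differentiableAt]
  rfl

lemma aH_const_mul (c : ℝ) (hu : ContDiff ℝ 2 u) (a) (X) :
    aH a (fun Y => c * u Y) X = c * aH a u X := by
  simp only [aH, Hh_const_mul c hu, Finset.mul_sum]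
  refine Finset.sum_congr rfl fun i _ => Finset.sum_congr rfl fun j _ => by ring

lemma SubAt.const_mul {ν : ℝ} {β : En n → ℝ} {X} (hu : ContDiff ℝ 2 u) (h : SubAt ν β u X)
    {c : ℝ} (hc : 0 ≤ c) : SubAt ν β (fun Y => c * u Y) X := by
  obtain ⟨a, ha, h⟩ := h
  refine ⟨a, ha, ?_⟩
  rw [Tt_const_mul c hu, aH_const_mul c hu, Gr_const_mul c hu, norm_smul, Real.norm_of_nonneg hc]
  nlinarith

lemma Gi_const (c : ℝ) (i : Fin n) (X) : Gi (fun _ => c) i X = 0 := by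
  simp [Gi]

lemma Gr_const (c : ℝ) (X : En n × ℝ) : Gr (fun _ => c) X = 0 := by
  ext i; simp [Gi_const]

lemma Tt_const (c : ℝ) (X : En n × ℝ) : Tt (fun _ => c) X = 0 := by simp [Tt]

lemma Hh_const (c : ℝ) (i j : Fin n) (X) : Hh (fun _ => c) i j X = 0 := by
  unfold Hh
  have : Gi (fun _ : En n × ℝ => c) j = fun _ => 0 := by funext X; exact Gi_const c j X
  rw [this]; simp

lemma aH_const (c : ℝ) (a) (X : En n × ℝ) : aH a (fun _ => c) X = 0 := by
  simp [aH, Hh_const]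

lemma SubAt.add_const {ν : ℝ} {β : En n → ℝ} {X} (hu : ContDiff ℝ 2 u) (h : SubAt ν β u X)
    (c : ℝ) : SubAt ν β (fun Y => u Y + c) X := by
  obtain ⟨a, ha, h⟩ := h
  refine ⟨a, ha, ?_⟩
  rw [Tt_add hu contDiff_const, aH_add hu contDiff_const, Gr_add hu contDiff_const,
    Tt_const, aH_const, Gr_const]
  simpa using h

end calculus

section linalg

open Matrix

lemma det_le_trace_pow {A : Matrix (Fin n) (Fin n) ℝ} (hA : A.PosSemidef) :
    0 ≤ A.det ∧ A.det ≤ A.trace ^ n := by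
  refine ⟨hA.det_nonneg, ?_⟩
  have h1 := hA.isHermitian.det_eq_prod_eigenvalues
  have h2 := hA.isHermitian.trace_eq_sum_eigenvalues
  simp only [RCLike.ofReal_real_eq_id, id] at h1 h2
  rw [h1, h2]
  calc ∏ i, hA.isHermitian.eigenvalues i
      ≤ ∏ _i : Fin n, ∑ j, hA.isHermitian.eigenvalues j := by
        apply Finset.prod_le_prod
        · intro i _; exact hA.eigenvalues_nonneg i
        · intro i _
          exact Finset.single_le_sum (f := fun j => hA.isHermitian.eigenvalues j)
            (fun j _ => hA.eigenvalues_nonneg j) (Finset.mem_univ i)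
    _ = _ := by simp

open scoped MatrixOrder Matrix.Norms.L2Operator in
lemma ell_trace {ν : ℝ} {a A : Matrix (Fin n) (Fin n) ℝ} (ha : Ell ν a)
    (hA : A.PosSemidef) : ν⁻¹ * A.trace ≤ ∑ i, ∑ j, a i j * A i j := by
  obtain ⟨B, hB⟩ : ∃ B : Matrix (Fin n) (Fin n) ℝ, A = Bᴴ * B := by
    exact CStarAlgebra.nonneg_iff_eq_star_mul_self.mp hA.nonneg
  have hAij : ∀ i j, A i j = ∑ k, B k i * B k j := by
    intro i j; rw [hB]; simp [Matrix.mul_apply, Matrix.conjTranspose_apply]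
  have h1 : ∑ i, ∑ j, a i j * A i j = ∑ k, ∑ i, ∑ j, a i j * B k i * B k j := by
    calc ∑ i, ∑ j, a i j * A i j = ∑ i, ∑ j, ∑ k, a i j * B k i * B k j := by
          refine Finset.sum_congr rfl fun i _ => Finset.sum_congr rfl fun j _ => ?_
          rw [hAij, Finset.mul_sum]
          exact Finset.sum_congr rfl fun k _ => by ring
      _ = ∑ i, ∑ k, ∑ j, a i j * B k i * B k j := by
          refine Finset.sum_congr rfl fun i _ => ?_
          rw [Finset.sum_comm]
      _ = _ := Finset.sum_comm
  have h2 : A.trace = ∑ k, ∑ i, B k i ^ 2 := by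
    rw [Matrix.trace, Finset.sum_comm]
    refine Finset.sum_congr rfl fun i _ => ?_
    rw [Matrix.diag, hAij]
    exact Finset.sum_congr rfl fun k _ => by ring
  rw [h1, h2, Finset.mul_sum]
  exact Finset.sum_le_sum fun k _ => ha.1 (fun i => B k i)

lemma Ell.entry_le {ν : ℝ} (hν : 0 ≤ ν) {a : Matrix (Fin n) (Fin n) ℝ} (ha : Ell ν a) (i j : Fin n) :
    |a i j| ≤ ν := by
  apply abs_le_of_sq_le_sq _ hν
  refine le_trans ?_ ha.2
  calc a i j ^ 2 ≤ ∑ j, a i j ^ 2 :=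
        Finset.single_le_sum (f := fun j => a i j ^ 2) (fun j _ => sq_nonneg _) (Finset.mem_univ j)
    _ ≤ _ := Finset.single_le_sum (f := fun i => ∑ j, a i j ^ 2)
        (fun i _ => Finset.sum_nonneg fun j _ => sq_nonneg _) (Finset.mem_univ i)

end linalg

end Hk

namespace Hk

section contact
variable {w : En n × ℝ → ℝ} {R T : ℝ}

lemma hasFDerivAt_slice (hw : ContDiff ℝ 2 w) (x : En n) (t : ℝ) :
    HasFDerivAt (fun y => w (y, t)) ((fderiv ℝ w (x, t)).comp (ContinuousLinearMap.inl ℝ (En n) ℝ)) x := by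
  have h1 : HasFDerivAt w (fderiv ℝ w (x, t)) (x, t) :=
    (hw.differentiable (by norm_num)).differentiableAt.hasFDerivAt
  have h2 : HasFDerivAt (fun y : En n => (y, t)) (ContinuousLinearMap.inl ℝ (En n) ℝ) x :=
    hasFDerivAt_prodMk_left x t
  exact h1.comp x h2

lemma hasDerivAt_time (hw : ContDiff ℝ 2 w) (x : En n) (t : ℝ) :
    HasDerivAt (fun s => w (x, s)) (Tt w (x, t)) t := by
  have h1 : HasFDerivAt w (fderiv ℝ w (x, t)) (x, t) :=
    (hw.differentiable (by norm_num)).differentiableAt.hasFDerivAt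
  have h2 : HasDerivAt (fun s : ℝ => (x, s)) ((0, 1) : En n × ℝ) t :=
    (hasDerivAt_const t x).prodMk (hasDerivAt_id t)
  exact h1.comp_hasDerivAt t h2

/-- The contact set. -/
def Gam (w : En n × ℝ → ℝ) (R T : ℝ) : Set (En n × ℝ) :=
  {X | ‖X.1‖ < R ∧ 0 < X.2 ∧ X.2 ≤ T ∧ 0 < w X ∧
    ∀ y : En n, ‖y‖ ≤ R → ∀ s, 0 ≤ s → s ≤ X.2 → w (y, s) ≤ w X + ⟪Gr w X, y - X.1⟫}

def Phi (w : En n × ℝ → ℝ) (X : En n × ℝ) : En n × ℝ := (Gr w X, w X - ⟪X.1, Gr w X⟫)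

lemma contact_exists (hw : ContDiff ℝ 2 w) 
    (hb : ∀ x : En n, ‖x‖ ≤ R → w (x, 0) ≤ 0)
    (hl : ∀ (x : En n) (t : ℝ), ‖x‖ = R → 0 ≤ t → t ≤ T → w (x, t) ≤ 0)
    {X0 : En n × ℝ} (hX0 : X0 ∈ cyl 0 R 0 T) {p : En n} {h : ℝ}
    (hp1 : R * ‖p‖ < h) (hp2 : h + R * ‖p‖ < w X0) :
    (p, h) ∈ Phi w '' Gam w R T := by
  have hwc := hw.continuous
  have hip : ∀ y : En n, ‖y‖ ≤ R → |⟪p, y⟫| ≤ R * ‖p‖ := by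
    intro y hy
    refine (abs_real_inner_le_norm p y).trans ?_
    nlinarith [norm_nonneg p]
  set C : Set (En n × ℝ) := cyl 0 R 0 T ∩ {X | h ≤ w X - ⟪p, X.1⟫} with hC
  have hCc : IsCompact C := (isCompact_cyl 0 R 0 T).inter_right
    (isClosed_le continuous_const (by fun_prop))
  have hX0' := mem_cyl.1 hX0
  simp only [sub_zero] at hX0'
  have hCn : C.Nonempty := ⟨X0, hX0, by
    have := (abs_le.1 (hip X0.1 hX0'.1)).2
    simp only [mem_ofPred_eq]; linarith⟩
  obtain ⟨⟨x, t⟩, hXC, hmin⟩ := hCc.exists_isMinOn hCn continuous_snd.continuousOn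
  have hmin' : ∀ Y ∈ C, t ≤ Y.2 := fun Y hY => hmin hY
  obtain ⟨hX1, hX2⟩ := hXC
  obtain ⟨hxR, ht0, htT⟩ := mem_cyl.1 hX1
  simp only [sub_zero] at hxR
  simp only [mem_ofPred_eq] at hX2 ht0 htT
  have hpos : 0 < w (x, t) := by
    have := (abs_le.1 (hip x hxR)).1
    linarith
  have hxR' : ‖x‖ < R := by
    rcases hxR.lt_or_eq with h1 | h1
    · exact h1
    · exact absurd (hl x t h1 ht0 htT) (not_le.2 hpos)
  have ht0' : 0 < t := by
    rcases ht0.lt_or_eq with h1 | h1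
    · exact h1
    · subst h1; exact absurd (hb x hxR) (not_le.2 hpos)
  have hbelow : ∀ y : En n, ‖y‖ ≤ R → ∀ s, 0 ≤ s → s < t → w (y, s) - ⟪p, y⟫ < h := by
    intro y hy s hs hst
    by_contra hcon
    push Not at hcon
    have := hmin' (y, s) ⟨mem_cyl.2 ⟨by simpa using hy, hs, (hst.le.trans htT)⟩, hcon⟩
    simp at this; linarith
  have hle : ∀ y : En n, ‖y‖ ≤ R → ∀ s, 0 ≤ s → s ≤ t → w (y, s) - ⟪p, y⟫ ≤ h := by
    intro y hy s hs hst
    rcases hst.lt_or_eq with h1 | h1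
    · exact (hbelow y hy s hs h1).le
    · subst h1
      have hlim : Filter.Tendsto (fun r => w (y, r) - ⟪p, y⟫) (nhdsWithin s (Iio s))
          (nhds (w (y, s) - ⟪p, y⟫)) := by
        have : Continuous (fun r => w (y, r) - ⟪p, y⟫) := by fun_prop
        exact (this.tendsto s).mono_left nhdsWithin_le_nhds
      refine le_of_tendsto hlim ?_
      filter_upwards [Ioo_mem_nhdsLT ht0'] with r hr
      exact (hbelow y hy r hr.1.le hr.2).le
  have heq : w (x, t) - ⟪p, x⟫ = h := le_antisymm (hle x hxR t ht0 le_rfl) hX2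
  have hgr : Gr w (x, t) = p := by
    have hlm : IsLocalMax (fun y => w (y, t) - ⟪p, y⟫) x := by
      have : ball (0 : En n) R ∈ nhds x := isOpen_ball.mem_nhds (by simpa using hxR')
      filter_upwards [this] with y hy
      rw [heq]
      exact hle y (by simpa using (mem_ball_zero_iff.1 hy).le) t ht0 le_rfl
    have hd := (hasFDerivAt_slice hw x t).sub ((innerSL ℝ p).hasFDerivAt (x := x))
    have h0 := hlm.hasFDerivAt_eq_zero hd
    have h1 : ∀ d : En n, ⟪Gr w (x, t) - p, d⟫ = 0 := by
      intro d
      have := congrArg (fun L => L d) h0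
      simp [fderiv_eq] at this
      rw [inner_sub_left]; linarith
    have := h1 (Gr w (x, t) - p)
    rw [inner_self_eq_zero] at this
    exact sub_eq_zero.1 this
  refine ⟨(x, t), ⟨hxR', ht0', htT, hpos, ?_⟩, ?_⟩
  · intro y hy s hs hst
    have := hle y hy s hs hst
    rw [hgr, inner_sub_right]
    simp only; linarith
  · simp only [Phi, hgr]
    rw [real_inner_comm, heq]

lemma Gam_Tt_nonneg (hw : ContDiff ℝ 2 w) {X : En n × ℝ} (hX : X ∈ Gam w R T) : 0 ≤ Tt w X := by
  obtain ⟨x, t⟩ := X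
  obtain ⟨h1, h2, h3, h4, h5⟩ := hX
  simp only at h1 h2 h3
  have hd := hasDerivAt_time hw x t
  have hslope := hd.hasDerivWithinAt (s := Iio t)
  rw [hasDerivWithinAt_iff_tendsto_slope' (by simp)] at hslope
  refine ge_of_tendsto hslope ?_
  filter_upwards [Ioo_mem_nhdsLT h2] with s hs
  rw [slope_def_field]
  have := h5 x h1.le s hs.1.le hs.2.le
  simp only [sub_self, inner_zero_right, add_zero] at this
  apply div_nonneg_of_nonpos <;> linarith [hs.2]

/-- second-order necessary condition for a one-variable max -/
lemma deriv2_nonpos {f f' : ℝ → ℝ} {f'' : ℝ} (hf : ∀ s, HasDerivAt f (f' s) s)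
    (hf' : HasDerivAt f' f'' 0) (hmax : IsLocalMax f 0) : f'' ≤ 0 := by
  by_contra hcon
  push Not at hcon
  have hde : deriv f = f' := funext fun s => (hf s).deriv
  have h0 : f' 0 = 0 := hmax.hasDerivAt_eq_zero (hf 0)
  -- f' > 0 to the right of 0
  have hslope := hf'.hasDerivWithinAt (s := Ioi 0)
  rw [hasDerivWithinAt_iff_tendsto_slope' (by simp)] at hslope
  have hev : ∀ᶠ s in nhdsWithin 0 (Ioi (0:ℝ)), 0 < f' s := by
    filter_upwards [hslope.eventually (lt_mem_nhds hcon), self_mem_nhdsWithin] with s hs hs0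
    rw [slope_def_field, h0, sub_zero, sub_zero] at hs
    have hs0' : (0:ℝ) < s := hs0
    by_contra hc
    push Not at hc
    have := div_nonpos_of_nonpos_of_nonneg hc hs0'.le
    linarith
  have hev2 : ∀ᶠ s in nhdsWithin 0 (Ioi (0:ℝ)), f s ≤ f 0 := hmax.filter_mono nhdsWithin_le_nhds
  obtain ⟨ε, hε, hsub⟩ := (mem_nhdsGT_iff_exists_Ioo_subset).1 (hev.and hev2)
  have hε' : (0:ℝ) < ε := hε
  have hsm : StrictMonoOn f (Icc 0 (ε / 2)) := by
    apply strictMonoOn_of_deriv_pos (convex_Icc _ _)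
    · exact fun s _ => (hf s).continuousAt.continuousWithinAt
    · intro s hs
      rw [interior_Icc] at hs
      rw [hde]
      exact (hsub ⟨hs.1, by linarith [hs.2]⟩).1
  have h3 := hsm (left_mem_Icc.2 (by positivity)) (right_mem_Icc.2 (by positivity)) (by positivity)
  have h4 := (hsub (show ε / 2 ∈ Ioo 0 ε from ⟨by positivity, by linarith⟩)).2
  linarith

def mH (w : En n × ℝ → ℝ) (X : En n × ℝ) : Matrix (Fin n) (Fin n) ℝ :=
  Matrix.of fun i j => - Hh w i j X

lemma hess_dir (hw : ContDiff ℝ 2 w) (X : En n × ℝ) (d : En n) :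
    ∑ i, ∑ j, d i * d j * Hh w i j X = ⟪fderiv ℝ (Gr w) X (d, 0), d⟫ := by
  have hd : ((d, 0) : En n × ℝ) = ∑ i, d i • ex i := by
    apply Prod.ext
    · simp only [Prod.fst_sum, Prod.smul_fst, ex]
      exact sum_single_eq d
    · simp [Prod.snd_sum, ex]
  rw [PiLp.inner_apply, Finset.sum_comm]
  refine Finset.sum_congr rfl fun j _ => ?_
  rw [fderiv_Gr_apply hw, hd, map_sum]
  simp only [map_smul, smul_eq_mul]
  rw [RCLike.inner_apply, conj_trivial]
  rw [Finset.mul_sum]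
  refine Finset.sum_congr rfl fun i _ => ?_
  unfold Hh
  ring

lemma Gam_posSemidef (hw : ContDiff ℝ 2 w) {X : En n × ℝ} (hX : X ∈ Gam w R T) :
    (mH w X).PosSemidef := by
  refine Matrix.PosSemidef.of_dotProduct_mulVec_nonneg ?_ ?_
  · ext i j
    simp [mH, Hh_symm hw i j]
  · intro v
    set d : En n := WithLp.toLp 2 v with hd
    have key : star v ⬝ᵥ (mH w X).mulVec v = - ⟪fderiv ℝ (Gr w) X (d, 0), d⟫ := by
      rw [← hess_dir hw]
      simp only [dotProduct, Matrix.mulVec, mH, Matrix.of_apply, ← Finset.sum_neg_distrib,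
        Finset.mul_sum, star_trivial]
      refine Finset.sum_congr rfl fun i _ => Finset.sum_congr rfl fun j _ => ?_
      simp [hd]; ring
    rw [key, neg_nonneg]
    obtain ⟨x, t⟩ := X
    obtain ⟨h1, h2, h3, h4, h5⟩ := hX
    simp only at h1 h2 h3
    have hline : ∀ s : ℝ, HasDerivAt (fun s : ℝ => ((x + s • d, t) : En n × ℝ)) (d, 0) s := by
      intro s
      have : HasDerivAt (fun s : ℝ => x + s • d) d s := by
        simpa using ((hasDerivAt_id s).smul_const d).const_add x
      exact this.prodMk (hasDerivAt_const s t)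
    have hf : ∀ s : ℝ, HasDerivAt (fun s : ℝ => w (x + s • d, t) - ⟪Gr w (x, t), s • d⟫)
        (⟪Gr w (x + s • d, t), d⟫ - ⟪Gr w (x, t), d⟫) s := by
      intro s
      have e1 : HasFDerivAt w (fderiv ℝ w (x + s • d, t)) (x + s • d, t) :=
        (hw.differentiable (by norm_num)).differentiableAt.hasFDerivAt
      have e2 := e1.comp_hasDerivAt s (hline s)
      rw [fderiv_eq] at e2
      simp only [mul_zero, add_zero] at e2
      have e3 : HasDerivAt (fun s : ℝ => ⟪Gr w (x, t), s • d⟫) (⟪Gr w (x, t), d⟫) s := by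
        simp only [inner_smul_right]
        simpa using (hasDerivAt_id s).mul_const (⟪Gr w (x, t), d⟫)
      exact e2.sub e3
    have hf' : HasDerivAt (fun s : ℝ => ⟪Gr w (x + s • d, t), d⟫ - ⟪Gr w (x, t), d⟫)
        (⟪fderiv ℝ (Gr w) (x, t) (d, 0), d⟫) 0 := by
      have e1 : HasFDerivAt (Gr w) (fderiv ℝ (Gr w) (x, t)) (x + (0:ℝ) • d, t) := by
        simpa using hasFDerivAt_Gr hw (x, t)
      have e2 := e1.comp_hasDerivAt 0 (hline 0)
      have e3 := e2.inner ℝ (hasDerivAt_const (0:ℝ) d)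
      simpa using e3.sub_const (⟪Gr w (x, t), d⟫)
    refine deriv2_nonpos hf hf' ?_
    have hc : ContinuousAt (fun s : ℝ => x + s • d) 0 := by fun_prop
    have : ball (0 : En n) R ∈ nhds (x + (0:ℝ) • d) := isOpen_ball.mem_nhds (by simpa using h1)
    filter_upwards [hc this] with s hs
    have := h5 (x + s • d) (by simpa using (mem_ball_zero_iff.1 hs).le) t h2.le le_rfl
    simp only [add_sub_cancel_left] at this
    simp only [zero_smul, add_zero, inner_zero_right, sub_zero]
    linarith

end contact

end Hk

namespace Hk

section detPhi
variable {w : En n × ℝ → ℝ}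

def LPhi (w : En n × ℝ → ℝ) (X : En n × ℝ) : En n × ℝ →L[ℝ] En n × ℝ :=
  (fderiv ℝ (Gr w) X).prod
    (Tt w X • ContinuousLinearMap.snd ℝ (En n) ℝ - (innerSL ℝ X.1).comp (fderiv ℝ (Gr w) X))

lemma hasFDerivAt_Phi (hw : ContDiff ℝ 2 w) (X : En n × ℝ) :
    HasFDerivAt (Phi w) (LPhi w X) X := by
  refine (hasFDerivAt_Gr hw X).prodMk ?_
  have h1 : HasFDerivAt w (fderiv ℝ w X) X :=
    (hw.differentiable (by norm_num)).differentiableAt.hasFDerivAt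
  have h2 := (hasFDerivAt_fst (𝕜 := ℝ) (p := X)).inner ℝ (hasFDerivAt_Gr hw X)
  refine (h1.sub h2).congr_fderiv ?_
  ext d
  all_goals
    simp [fderiv_eq, fderivInnerCLM_apply, real_inner_comm]

def bas (n : ℕ) : Module.Basis (Fin n ⊕ Unit) ℝ (En n × ℝ) :=
  (EuclideanSpace.basisFun (Fin n) ℝ).toBasis.prod (Module.Basis.singleton Unit ℝ)

lemma bas_inl (i : Fin n) : bas n (Sum.inl i) = ex i := by
  simp [bas, ex, Module.Basis.prod_apply]

lemma bas_inr (i : Unit) : bas n (Sum.inr i) = (0, 1) := by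
  simp [bas, Module.Basis.prod_apply]

lemma bas_repr_inl (X : En n × ℝ) (i : Fin n) : (bas n).repr X (Sum.inl i) = X.1 i := by
  simp [bas]

lemma bas_repr_inr (X : En n × ℝ) (i : Unit) : (bas n).repr X (Sum.inr i) = X.2 := by
  simp [bas]

lemma det_LPhi (hw : ContDiff ℝ 2 w) (X : En n × ℝ) :
    |(LPhi w X).det| = |Tt w X| * |(mH w X).det| := by
  set A := fderiv ℝ (Gr w) X with hA
  let Sh : En n × ℝ →L[ℝ] En n × ℝ := (ContinuousLinearMap.fst ℝ (En n) ℝ).prod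
    (ContinuousLinearMap.snd ℝ (En n) ℝ -
      (innerSL ℝ X.1).comp (ContinuousLinearMap.fst ℝ (En n) ℝ))
  let B : En n × ℝ →L[ℝ] En n × ℝ := A.prod (Tt w X • ContinuousLinearMap.snd ℝ (En n) ℝ)
  have hcomp : (LPhi w X : En n × ℝ →ₗ[ℝ] En n × ℝ) =
      (Sh : En n × ℝ →ₗ[ℝ] En n × ℝ) ∘ₗ (B : En n × ℝ →ₗ[ℝ] En n × ℝ) := by
    apply LinearMap.ext
    intro d
    rfl
  have hSh : LinearMap.det (Sh : En n × ℝ →ₗ[ℝ] En n × ℝ) = 1 := by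
    rw [← LinearMap.det_toMatrix (bas n)]
    have : LinearMap.toMatrix (bas n) (bas n) (Sh : En n × ℝ →ₗ[ℝ] En n × ℝ) =
        Matrix.fromBlocks 1 0 (Matrix.of fun _ i => - X.1 i) 1 := by
      ext i j
      rw [LinearMap.toMatrix_apply]
      rcases i with i | i <;> rcases j with j | j
      · rw [bas_repr_inl, bas_inl]
        simp [Sh, ex, Matrix.one_apply]
      · rw [bas_repr_inl, bas_inr]
        simp [Sh]
      · rw [bas_repr_inr, bas_inl]
        simp [Sh, ex, PiLp.inner_apply]
      · rw [bas_repr_inr, bas_inr]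
        simp [Sh]
    rw [this, Matrix.det_fromBlocks_zero₁₂]; simp
  have hB : LinearMap.det (B : En n × ℝ →ₗ[ℝ] En n × ℝ) =
      (-(mH w X)).transpose.det * Tt w X := by
    rw [← LinearMap.det_toMatrix (bas n)]
    have : LinearMap.toMatrix (bas n) (bas n) (B : En n × ℝ →ₗ[ℝ] En n × ℝ) =
        Matrix.fromBlocks (-(mH w X)).transpose (Matrix.of fun i _ => A (0, 1) i) 0
          (Matrix.of fun (_ _ : Unit) => Tt w X) := by
      ext i j
      rw [LinearMap.toMatrix_apply]
      rcases i with i | i <;> rcases j with j | j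
      · rw [bas_repr_inl, bas_inl]
        simp only [ContinuousLinearMap.coe_coe, ContinuousLinearMap.prod_apply, B,
          Matrix.fromBlocks_apply₁₁, Matrix.transpose_apply, Matrix.neg_apply, mH, Matrix.of_apply,
          neg_neg]
        rw [hA, fderiv_Gr_apply hw]; rfl
      · rw [bas_repr_inl, bas_inr]
        simp [B]
      · rw [bas_repr_inr, bas_inl]
        simp [B, ex]
      · rw [bas_repr_inr, bas_inr]
        simp [B]
    rw [this, Matrix.det_fromBlocks_zero₂₁]; simp
  have : (LPhi w X).det = (-(mH w X)).transpose.det * Tt w X := by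
    change LinearMap.det (LPhi w X : En n × ℝ →ₗ[ℝ] En n × ℝ) = _
    rw [hcomp, LinearMap.det_comp, hSh, hB, one_mul]
  rw [this, Matrix.det_transpose, Matrix.det_neg, abs_mul, abs_mul]
  simp [mul_comm]

/-- pointwise bound of the Jacobian -/
lemma det_LPhi_le (hw : ContDiff ℝ 2 w) {ν R T g f b : ℝ} (hν : 0 < ν) (hb : 0 ≤ b) (hg : 0 ≤ g)
    (hf : 0 ≤ f) {X : En n × ℝ} (hX : X ∈ Gam w R T)
    {a : Matrix (Fin n) (Fin n) ℝ} (ha : Ell ν a)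
    (h : Tt w X - aH a w X ≤ b * (‖Gr w X‖ + g) + f) :
    |(LPhi w X).det| ≤ ν ^ n * 2 ^ (n + 1) *
      (Tt w X * (b * (‖Gr w X‖ + g)) ^ n + f ^ (n + 1)) := by
  have hT := Gam_Tt_nonneg hw hX
  have hP := Gam_posSemidef hw hX
  obtain ⟨hd0, hd1⟩ := det_le_trace_pow hP
  have htr := ell_trace ha hP
  have haH : ∑ i, ∑ j, a i j * mH w X i j = - aH a w X := by
    simp [aH, mH, Finset.sum_neg_distrib]
  rw [haH] at htr
  have htr0 : 0 ≤ (mH w X).trace := hP.trace_nonneg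
  have hp0 : 0 ≤ b * (‖Gr w X‖ + g) := mul_nonneg hb (by positivity)
  generalize b * (‖Gr w X‖ + g) = P at *
  generalize (mH w X).trace = τ at *
  rw [det_LPhi hw, abs_of_nonneg hT, abs_of_nonneg hd0]
  generalize Tt w X = t at *
  have hτ : τ ≤ ν * (P + f) := by
    have : ν⁻¹ * τ ≤ P + f := by linarith
    rwa [inv_mul_le_iff₀ hν] at this
  have ht : t ≤ P + f := by
    have : 0 ≤ ν⁻¹ * τ := by positivity
    linarith
  have h1 : t * (mH w X).det ≤ t * (ν * (P + f)) ^ n := by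
    apply mul_le_mul_of_nonneg_left _ hT
    exact hd1.trans (pow_le_pow_left₀ htr0 hτ n)
  refine h1.trans ?_
  rcases le_total f P with hfP | hfP
  · have : (ν * (P + f)) ^ n ≤ ν ^ n * 2 ^ n * P ^ n := by
      rw [← mul_pow, ← mul_pow]
      apply pow_le_pow_left₀ (by positivity)
      nlinarith
    calc t * (ν * (P + f)) ^ n ≤ t * (ν ^ n * 2 ^ n * P ^ n) := by gcongr
      _ = ν ^ n * 2 ^ n * (t * P ^ n) := by ring
      _ ≤ ν ^ n * 2 ^ (n + 1) * (t * P ^ n + f ^ (n + 1)) := by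
        gcongr
        · norm_num
        · omega
        · have : 0 ≤ f ^ (n + 1) := by positivity
          linarith
  · have : (ν * (P + f)) ^ n ≤ ν ^ n * (2 * f) ^ n := by
      rw [← mul_pow]
      apply pow_le_pow_left₀ (by positivity)
      nlinarith
    calc t * (ν * (P + f)) ^ n ≤ (2 * f) * (ν ^ n * (2 * f) ^ n) := by
          gcongr; linarith
      _ = ν ^ n * 2 ^ (n + 1) * f ^ (n + 1) := by ring
      _ ≤ _ := by
        gcongr
        have : 0 ≤ t * P ^ n := by positivity
        linarith

lemma measurableSet_Gam (hw : ContDiff ℝ 2 w) (R T : ℝ) : MeasurableSet (Gam w R T) := by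
  have hwc := hw.continuous
  have hgc := (contDiff_Gr hw).continuous
  have e : Gam w R T = ({X : En n × ℝ | ‖X.1‖ < R} ∩ {X | 0 < X.2} ∩ {X | X.2 ≤ T} ∩ {X | 0 < w X}) ∩
      ⋂ (y : En n) (_ : ‖y‖ ≤ R) (σ : ℝ) (_ : σ ∈ Icc (0:ℝ) 1),
        {X | w (y, σ * X.2) ≤ w X + ⟪Gr w X, y - X.1⟫} := by
    ext ⟨x, t⟩
    simp only [Gam, mem_inter_iff, mem_iInter, mem_ofPred_eq]
    constructor
    · rintro ⟨h1, h2, h3, h4, h5⟩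
      refine ⟨⟨⟨⟨h1, h2⟩, h3⟩, h4⟩, fun y hy σ hσ => h5 y hy _ ?_ ?_⟩
      · exact mul_nonneg hσ.1 h2.le
      · exact mul_le_of_le_one_left h2.le hσ.2
    · rintro ⟨⟨⟨⟨h1, h2⟩, h3⟩, h4⟩, h5⟩
      refine ⟨h1, h2, h3, h4, fun y hy s hs hst => ?_⟩
      have := h5 y hy (s / t) ⟨by positivity, by rw [div_le_one h2]; exact hst⟩
      rwa [div_mul_cancel₀ _ h2.ne'] at this
  rw [e]
  refine MeasurableSet.inter ?_ (IsClosed.measurableSet ?_)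
  · refine (((IsOpen.measurableSet ?_).inter (IsOpen.measurableSet ?_)).inter
      (IsClosed.measurableSet ?_)).inter (IsOpen.measurableSet ?_)
    · exact isOpen_lt (by fun_prop) continuous_const
    · exact isOpen_lt continuous_const continuous_snd
    · exact isClosed_le continuous_snd continuous_const
    · exact isOpen_lt continuous_const hwc
  · refine isClosed_iInter fun y => isClosed_iInter fun _ => isClosed_iInter fun σ =>
      isClosed_iInter fun _ => isClosed_le ?_ ?_
    · fun_prop
    · fun_prop

lemma fiber_bound (hw : ContDiff ℝ 2 w) {R T M : ℝ}
    (hM : ∀ X ∈ cyl 0 R 0 T, w X ≤ M) (x : En n) :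
    ∫⁻ t in {t | (x, t) ∈ Gam w R T}, ENNReal.ofReal (Tt w (x, t)) ≤ ENNReal.ofReal M := by
  have hmeas : MeasurableSet {t | (x, t) ∈ Gam w R T} :=
    measurable_prodMk_left (measurableSet_Gam hw R T)
  rw [lintegral_deriv_eq_volume_image_of_monotoneOn hmeas
    (fun t _ => (hasDerivAt_time hw x t).hasDerivWithinAt)]
  · calc volume ((fun s => w (x, s)) '' {t | (x, t) ∈ Gam w R T}) ≤ volume (Icc 0 M) := by
          apply measure_mono
          rintro _ ⟨t, ht, rfl⟩
          exact ⟨ht.2.2.2.1.le, hM _ (mem_cyl.2 ⟨by simpa using ht.1.le, ht.2.1.le, ht.2.2.1⟩)⟩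
      _ = _ := by simp
  · intro t ht t' ht' htt'
    have := ht'.2.2.2.2 x ht.1.le t ht.2.1.le htt'
    simpa using this

end detPhi

end Hk

namespace Hk

/-- drift mass in a ball -/
def Dr (β : En n → ℝ) (z : En n) (R : ℝ) : ℝ≥0∞ := ∫⁻ x in closedBall z R, ENNReal.ofReal (β x) ^ n

/-- volume of unit ball -/
def om (n : ℕ) : ℝ := (volume (ball (0 : En n) 1)).toReal

lemma om_pos (n : ℕ) : 0 < om n :=
  ENNReal.toReal_pos (measure_ball_pos _ _ one_pos).ne' measure_ball_lt_top.ne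

lemma vol_ball (z : En n) {r : ℝ} (hr : 0 < r) :
    volume (ball z r) = ENNReal.ofReal (r ^ n * om n) := by
  rw [Measure.addHaar_ball_of_pos _ _ hr, finrank_euclideanSpace_fin, ENNReal.ofReal_mul (by positivity),
    om, ENNReal.ofReal_toReal measure_ball_lt_top.ne]

lemma vol_annulus (hn : 0 < n) {a : ℝ} (ha : 0 < a) :
    ENNReal.ofReal (a ^ n * om n) ≤ volume (ball (0 : En n) (2 * a) \ ball 0 a) := by
  refine le_trans ?_ le_measure_sdiff
  apply ENNReal.le_sub_of_add_le_right measure_ball_lt_top.ne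
  rw [vol_ball _ ha, vol_ball _ (by positivity), ← ENNReal.ofReal_add (by have := om_pos n; positivity)
    (by have := om_pos n; positivity)]
  apply ENNReal.ofReal_le_ofReal
  rw [mul_pow]
  have h2 : (2:ℝ) ≤ 2 ^ n := by
    calc (2:ℝ) = 2 ^ 1 := by norm_num
      _ ≤ 2 ^ n := pow_le_pow_right₀ (by norm_num) hn
  have h3 : 0 ≤ a ^ n * om n := by have := om_pos n; positivity
  nlinarith

def C0 (n : ℕ) (ν : ℝ) : ℝ := ν ^ n * 2 ^ (n + 2) / om n

lemma C0_pos {ν : ℝ} (hν : 0 < ν) : 0 < C0 n ν := by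
  have := om_pos n
  unfold C0; positivity

lemma lint_Gam {w : En n × ℝ → ℝ} (hw : ContDiff ℝ 2 w) {R T M : ℝ}
    (hM : ∀ X ∈ cyl 0 R 0 T, w X ≤ M) (β : En n → ℝ) :
    ∫⁻ X in Gam w R T, ENNReal.ofReal (β X.1) ^ n * ENNReal.ofReal (Tt w X) ≤
      Dr β 0 R * ENNReal.ofReal M := by
  have hG := measurableSet_Gam hw R T
  rw [← lintegral_indicator hG, Measure.volume_eq_prod]
  refine (lintegral_prod_le _).trans ?_
  unfold Dr
  rw [← lintegral_mul_const' _ _ ENNReal.ofReal_ne_top, ← lintegral_indicator measurableSet_closedBall]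
  refine lintegral_mono fun x => ?_
  by_cases hx : x ∈ closedBall (0 : En n) R
  · rw [indicator_of_mem hx]
    have hmeas : MeasurableSet {t | (x, t) ∈ Gam w R T} := measurable_prodMk_left hG
    have : ∀ t, (Gam w R T).indicator
        (fun X => ENNReal.ofReal (β X.1) ^ n * ENNReal.ofReal (Tt w X)) (x, t) =
        {t | (x, t) ∈ Gam w R T}.indicator
          (fun t => ENNReal.ofReal (β x) ^ n * ENNReal.ofReal (Tt w (x, t))) t := by
      intro t
      simp only [indicator, mem_ofPred_eq]
    simp_rw [this]
    rw [lintegral_indicator hmeas, lintegral_const_mul' _ _ (by finiteness)]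
    gcongr
    exact fiber_bound hw hM x
  · have : ∀ t, (Gam w R T).indicator
        (fun X => ENNReal.ofReal (β X.1) ^ n * ENNReal.ofReal (Tt w X)) (x, t) = 0 := by
      intro t
      apply indicator_of_notMem
      intro h
      exact hx (by simpa using h.1.le)
    simp_rw [this]
    simp

theorem abp (hn : 0 < n) {ν : ℝ} (hν : 0 < ν) {w : En n × ℝ → ℝ} (hw : ContDiff ℝ 2 w)
    {R T M g f μ S V : ℝ} {β : En n → ℝ} {J : ℕ}
    (hR : 0 < R) (hg : 0 ≤ g) (hf : 0 ≤ f) (hμ : 0 < μ) (hβ : ∀ x, 0 ≤ β x)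
    (hβc : Continuous β)
    (hb : ∀ x : En n, ‖x‖ ≤ R → w (x, 0) ≤ 0)
    (hl : ∀ (x : En n) (t : ℝ), ‖x‖ = R → 0 ≤ t → t ≤ T → w (x, t) ≤ 0)
    (hsub : ∀ X ∈ cyl 0 R 0 T, 0 < w X →
      ∃ a, Ell ν a ∧ Tt w X - aH a w X ≤ β X.1 * (‖Gr w X‖ + g) + f)
    (hM : ∀ X ∈ cyl 0 R 0 T, w X ≤ M)
    {X0 : En n × ℝ} (hX0 : X0 ∈ cyl 0 R 0 T) (hX0M : w X0 = M) (hM0 : 0 < M)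
    (hJ : 2 ^ J * μ ≤ M / (4 * R)) (hS0 : 0 ≤ S) (hS : Dr β 0 R ≤ ENNReal.ofReal S)
    (hV0 : 0 ≤ V) (hV : volume {X ∈ cyl 0 R 0 T | 0 < w X} ≤ ENNReal.ofReal V) :
    J * M ≤ C0 n ν * ((2 + g / μ) ^ n * M * S + (μ⁻¹) ^ n * f ^ (n + 1) * V) := by
  have hom := om_pos n
  have hG := measurableSet_Gam hw R T
  have hgc := (contDiff_Gr hw).continuous
  set K : ℝ := ν ^ n * 2 ^ (n + 1) with hK
  have hK0 : 0 < K := by positivity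
  set c1 : ℝ := K * (2 + g / μ) ^ n with hc1
  set c2 : ℝ := K * ((μ⁻¹) ^ n * f ^ (n + 1)) with hc2
  have hc10 : 0 ≤ c1 := by positivity
  have hc20 : 0 ≤ c2 := by positivity
  let Ψ : En n × ℝ → ℝ≥0∞ := fun X => ENNReal.ofReal c1 *
    (ENNReal.ofReal (β X.1) ^ n * ENNReal.ofReal (Tt w X)) + ENNReal.ofReal c2
  let An : ℕ → Set (En n) := fun j => ball (0 : En n) (2 * (2 ^ j * μ)) \ ball 0 (2 ^ j * μ)
  let Gj : ℕ → Set (En n × ℝ) := fun j => Gam w R T ∩ Gr w ⁻¹' (An j)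
  have hGj : ∀ j, MeasurableSet (Gj j) := fun j =>
    hG.inter (hgc.measurable (measurableSet_ball.diff measurableSet_ball))
  have hstep : ∀ j < J, ENNReal.ofReal (om n * (M / 2)) ≤ ∫⁻ X in Gj j, Ψ X := by
    intro j hj
    set a : ℝ := 2 ^ j * μ with ha
    have ha0 : 0 < a := by positivity
    have hμa : μ ≤ a := by
      rw [ha]; nlinarith [one_le_pow₀ (M₀ := ℝ) (a := 2) (n := j) (by norm_num)]
    have ha1 : 2 * a ≤ M / (4 * R) := by
      refine le_trans ?_ hJ
      rw [ha, ← mul_assoc, ← pow_succ']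
      gcongr
      · norm_num
      · omega
    have hcov : An j ×ˢ Ioo (M / 4) (3 * M / 4) ⊆ Phi w '' (Gj j) := by
      rintro ⟨p, h⟩ ⟨hp, hh⟩
      have hpn : ‖p‖ < M / (4 * R) := by
        have := mem_ball_zero_iff.1 hp.1
        linarith
      have hpR : R * ‖p‖ < M / 4 := by
        rw [lt_div_iff₀ (by positivity)] at hpn
        linarith
      have hh' : M / 4 < h ∧ h < 3 * M / 4 := hh
      obtain ⟨X, hX, hXe⟩ := contact_exists hw hb hl hX0 (p := p) (h := h)
        (by linarith) (by rw [hX0M]; linarith)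
      refine ⟨X, ⟨hX, ?_⟩, hXe⟩
      have : Gr w X = p := congrArg Prod.fst hXe
      simpa [this] using hp
    have h1 : ENNReal.ofReal (a ^ n) * ENNReal.ofReal (om n * (M / 2)) ≤
        ENNReal.ofReal (a ^ n) * ∫⁻ X in Gj j, Ψ X := by
      calc ENNReal.ofReal (a ^ n) * ENNReal.ofReal (om n * (M / 2))
          = ENNReal.ofReal (a ^ n * om n) * ENNReal.ofReal (3 * M / 4 - M / 4) := by
            rw [← ENNReal.ofReal_mul (by positivity), ← ENNReal.ofReal_mul (by positivity)]
            congr 1; ring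
        _ ≤ volume (An j) * volume (Ioo (M / 4) (3 * M / 4)) := by
            rw [Real.volume_Ioo]
            gcongr
            exact vol_annulus hn ha0
        _ = volume (An j ×ˢ Ioo (M / 4) (3 * M / 4)) := by
            rw [Measure.volume_eq_prod, Measure.prod_prod]
        _ ≤ volume (Phi w '' (Gj j)) := measure_mono hcov
        _ ≤ ∫⁻ X in Gj j, ENNReal.ofReal |(LPhi w X).det| := by
            have : (volume : Measure (En n × ℝ)).IsAddHaarMeasure := by
              rw [Measure.volume_eq_prod]; infer_instance
            exact addHaar_image_le_lintegral_abs_det_fderiv _ (hGj j)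
              (fun X _ => (hasFDerivAt_Phi hw X).hasFDerivWithinAt)
        _ ≤ ∫⁻ X in Gj j, ENNReal.ofReal (a ^ n) * Ψ X := by
            refine setLIntegral_mono_ae' (hGj j) (Filter.Eventually.of_forall fun X hX => ?_)
            have hXG := hX.1
            obtain ⟨A, hA, hAs⟩ := hsub X (mem_cyl.2 ⟨by simpa using hXG.1.le, hXG.2.1.le,
              hXG.2.2.1⟩) hXG.2.2.2.1
            have hd := det_LPhi_le hw hν (hβ X.1) hg hf hXG hA hAs
            have hT := Gam_Tt_nonneg hw hXG
            have hp : ‖Gr w X‖ < 2 * a := mem_ball_zero_iff.1 hX.2.1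
            have hq : ‖Gr w X‖ + g ≤ a * (2 + g / μ) := by
              have : g ≤ a * (g / μ) := by
                rw [mul_div_assoc', le_div_iff₀ hμ]; nlinarith
              nlinarith
            have hreal : |(LPhi w X).det| ≤ a ^ n * (c1 * (β X.1 ^ n * Tt w X) + c2) := by
              refine hd.trans ?_
              have e1 : (β X.1 * (‖Gr w X‖ + g)) ^ n ≤ β X.1 ^ n * (a ^ n * (2 + g / μ) ^ n) := by
                rw [mul_pow, ← mul_pow a]
                have := hβ X.1
                gcongr
              have e2 : f ^ (n + 1) ≤ a ^ n * ((μ⁻¹) ^ n * f ^ (n + 1)) := by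
                rw [← mul_assoc, ← mul_pow]
                apply le_mul_of_one_le_left (by positivity)
                apply one_le_pow₀
                rw [← div_eq_mul_inv, one_le_div hμ]; exact hμa
              calc K * (Tt w X * (β X.1 * (‖Gr w X‖ + g)) ^ n + f ^ (n + 1))
                  ≤ K * (Tt w X * (β X.1 ^ n * (a ^ n * (2 + g / μ) ^ n)) +
                    a ^ n * ((μ⁻¹) ^ n * f ^ (n + 1))) := by gcongr
                _ = _ := by rw [hc1, hc2]; ring
            refine (ENNReal.ofReal_le_ofReal hreal).trans (le_of_eq ?_)
            have hb0 := hβ X.1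
            rw [ENNReal.ofReal_mul (by positivity), ENNReal.ofReal_add (by positivity) hc20,
              ENNReal.ofReal_mul hc10, ENNReal.ofReal_mul (pow_nonneg hb0 n), ENNReal.ofReal_pow hb0]
        _ = _ := lintegral_const_mul' _ _ ENNReal.ofReal_ne_top
    rwa [ENNReal.mul_le_mul_iff_right (by simpa using pow_pos ha0 n) ENNReal.ofReal_ne_top] at h1
  have hdisj : Set.PairwiseDisjoint (↑(Finset.range J)) Gj := by
    have key : ∀ i j : ℕ, i < j → Disjoint (Gj i) (Gj j) := by
      intro i j hij
      rw [Set.disjoint_left]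
      rintro X ⟨-, h1⟩ ⟨-, h2⟩
      have h3 := mem_ball_zero_iff.1 h1.1
      have h4 := h2.2
      rw [mem_ball_zero_iff, not_lt] at h4
      have : (2:ℝ) * (2 ^ i * μ) ≤ 2 ^ j * μ := by
        rw [← mul_assoc, ← pow_succ']
        gcongr
        · norm_num
        · omega
      linarith
    intro i _ j _ hij
    rcases lt_or_gt_of_ne hij with h | h
    · exact key i j h
    · exact (key j i h).symm
  have hsum : (J : ℝ≥0∞) * ENNReal.ofReal (om n * (M / 2)) ≤ ∫⁻ X in Gam w R T, Ψ X := by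
    calc (J : ℝ≥0∞) * ENNReal.ofReal (om n * (M / 2))
        = ∑ j ∈ Finset.range J, ENNReal.ofReal (om n * (M / 2)) := by simp
      _ ≤ ∑ j ∈ Finset.range J, ∫⁻ X in Gj j, Ψ X :=
          Finset.sum_le_sum fun j hj => hstep j (Finset.mem_range.1 hj)
      _ = ∫⁻ X in ⋃ j ∈ Finset.range J, Gj j, Ψ X :=
          (lintegral_biUnion_finset hdisj (fun j _ => hGj j) _).symm
      _ ≤ _ := lintegral_mono_set (iUnion₂_subset fun j _ => inter_subset_left)
  have hintg : ∫⁻ X in Gam w R T, Ψ X ≤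
      ENNReal.ofReal (c1 * (S * M)) + ENNReal.ofReal (c2 * V) := by
    have hmeas : Measurable (fun X : En n × ℝ =>
        ENNReal.ofReal c1 * (ENNReal.ofReal (β X.1) ^ n * ENNReal.ofReal (Tt w X))) := by
      have := (contDiff_Tt hw).continuous.measurable
      have := hβc.measurable
      fun_prop
    rw [lintegral_add_left hmeas, lintegral_const_mul' _ _ ENNReal.ofReal_ne_top]
    gcongr
    · rw [ENNReal.ofReal_mul hc10, ENNReal.ofReal_mul hS0]
      gcongr
      refine (lint_Gam hw hM β).trans ?_
      gcongr
    · rw [lintegral_const, Measure.restrict_apply_univ, ENNReal.ofReal_mul hc20]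
      gcongr
      refine (measure_mono ?_).trans hV
      intro X hX
      exact ⟨mem_cyl.2 ⟨by simpa using hX.1.le, hX.2.1.le, hX.2.2.1⟩, hX.2.2.2.1⟩
  have hfin := hsum.trans hintg
  rw [← ENNReal.ofReal_add (by positivity) (by positivity), ← ENNReal.ofReal_natCast,
    ← ENNReal.ofReal_mul (by positivity), ENNReal.ofReal_le_ofReal_iff (by positivity)] at hfin
  have hCK : C0 n ν = 2 * K / om n := by rw [C0, hK]; ring
  rw [hCK, div_mul_eq_mul_div, le_div_iff₀ hom]
  rw [hc1, hc2] at hfin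
  nlinarith

end Hk

namespace Hk

section scaling

def smap (z : En n) (t₀ ρ : ℝ) (X : En n × ℝ) : En n × ℝ := (z + ρ • X.1, t₀ + ρ ^ 2 * X.2)

variable {u : En n × ℝ → ℝ} {z : En n} {t₀ ρ : ℝ}

lemma contDiff_smap : ContDiff ℝ 2 (smap z t₀ ρ) := by
  unfold smap; fun_prop

lemma fderiv_comp_smap {v : En n × ℝ → ℝ} (hv : ContDiff ℝ 1 v) (X d : En n × ℝ) :
    fderiv ℝ (fun Y => v (smap z t₀ ρ Y)) X d =
      fderiv ℝ v (smap z t₀ ρ X) (ρ • d.1, ρ ^ 2 * d.2) := by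
  have h1 : HasFDerivAt v (fderiv ℝ v (smap z t₀ ρ X)) (smap z t₀ ρ X) :=
    (hv.differentiable (by norm_num)).differentiableAt.hasFDerivAt
  have h2 : HasFDerivAt (smap z t₀ ρ) ((ρ • ContinuousLinearMap.fst ℝ (En n) ℝ).prod
      (ρ ^ 2 • ContinuousLinearMap.snd ℝ (En n) ℝ)) X := by
    refine HasFDerivAt.prodMk ?_ ?_
    · exact ((hasFDerivAt_fst (𝕜 := ℝ) (p := X)).const_smul ρ).const_add z
    · exact ((hasFDerivAt_snd (𝕜 := ℝ) (p := X)).const_smul (ρ ^ 2)).const_add t₀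
  have h3 := h1.comp X h2
  change fderiv ℝ (v ∘ smap z t₀ ρ) X d = _
  rw [h3.fderiv]
  simp

lemma contDiff_comp_smap (hu : ContDiff ℝ 2 u) : ContDiff ℝ 2 (fun Y => u (smap z t₀ ρ Y)) :=
  hu.comp contDiff_smap

lemma Tt_smap (hu : ContDiff ℝ 2 u) (X) :
    Tt (fun Y => u (smap z t₀ ρ Y)) X = ρ ^ 2 * Tt u (smap z t₀ ρ X) := by
  unfold Tt
  rw [fderiv_comp_smap (hu.of_le (by norm_num))]
  rw [show ((ρ • ((0 : En n), (1:ℝ)).1, ρ ^ 2 * ((0 : En n), (1:ℝ)).2) : En n × ℝ) =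
    ρ ^ 2 • ((0 : En n), (1:ℝ)) by simp]
  rw [map_smul, smul_eq_mul]

lemma Gi_smap (hu : ContDiff ℝ 1 u) (i : Fin n) (X) :
    Gi (fun Y => u (smap z t₀ ρ Y)) i X = ρ * Gi u i (smap z t₀ ρ X) := by
  unfold Gi
  rw [fderiv_comp_smap hu]
  rw [show ((ρ • (ex i : En n × ℝ).1, ρ ^ 2 * (ex i : En n × ℝ).2) : En n × ℝ) = ρ • ex i by
    simp [ex]]
  simp

lemma Gr_smap (hu : ContDiff ℝ 2 u) (X) :
    Gr (fun Y => u (smap z t₀ ρ Y)) X = ρ • Gr u (smap z t₀ ρ X) := by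
  ext i; simp [Gi_smap (hu.of_le (by norm_num) : ContDiff ℝ 1 u)]

lemma Hh_smap (hu : ContDiff ℝ 2 u) (i j : Fin n) (X) :
    Hh (fun Y => u (smap z t₀ ρ Y)) i j X = ρ ^ 2 * Hh u i j (smap z t₀ ρ X) := by
  have e : Gi (fun Y => u (smap z t₀ ρ Y)) j = fun X => ρ * (fun Y => Gi u j (smap z t₀ ρ Y)) X :=
    funext fun X => Gi_smap (hu.of_le (by norm_num)) j X
  unfold Hh
  rw [e, fderiv_const_mul]
  · have := Gi_smap (z := z) (t₀ := t₀) (ρ := ρ) (contDiff_Gi hu j) i X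
    unfold Gi at this
    simp only [_root_.smul_apply, smul_eq_mul]
    change ρ * fderiv ℝ (fun Y => Gi u j (smap z t₀ ρ Y)) X (ex i) = _
    unfold Gi
    rw [this]; ring
  · exact (((contDiff_Gi hu j).comp (contDiff_smap.of_le (by norm_num))).differentiable
      (by norm_num)).differentiableAt

lemma aH_smap (hu : ContDiff ℝ 2 u) (a) (X) :
    aH a (fun Y => u (smap z t₀ ρ Y)) X = ρ ^ 2 * aH a u (smap z t₀ ρ X) := by
  simp only [aH, Hh_smap hu, Finset.mul_sum]
  exact Finset.sum_congr rfl fun i _ => Finset.sum_congr rfl fun j _ => by ring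

def bsc (β : En n → ℝ) (z : En n) (ρ : ℝ) (x : En n) : ℝ := ρ * β (z + ρ • x)

lemma SubAt.smap {ν : ℝ} {β : En n → ℝ} (hu : ContDiff ℝ 2 u) (hρ : 0 ≤ ρ) {X}
    (h : SubAt ν β u (smap z t₀ ρ X)) :
    SubAt ν (bsc β z ρ) (fun Y => u (Hk.smap z t₀ ρ Y)) X := by
  obtain ⟨a, ha, h⟩ := h
  refine ⟨a, ha, ?_⟩
  rw [Tt_smap hu, aH_smap hu, Gr_smap hu, norm_smul, Real.norm_of_nonneg hρ]
  have : bsc β z ρ X.1 = ρ * β (Hk.smap z t₀ ρ X).1 := rfl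
  rw [this]
  nlinarith [sq_nonneg ρ]

lemma map_affine_volume (z : En n) {ρ : ℝ} (hρ : 0 < ρ) :
    Measure.map (fun x : En n => z + ρ • x) volume = ENNReal.ofReal ((ρ ^ n)⁻¹) • volume := by
  have h1 : (fun x : En n => z + ρ • x) = (fun x => z + x) ∘ (fun x => ρ • x) := rfl
  rw [h1, ← Measure.map_map (by fun_prop) (by fun_prop), Measure.map_addHaar_smul _ hρ.ne',
    finrank_euclideanSpace_fin, Measure.map_smul, map_add_left_eq_self,
    abs_of_nonneg (by positivity)]

lemma lintegral_affine (z : En n) {ρ : ℝ} (hρ : 0 < ρ) (f : En n → ℝ≥0∞) :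
    ∫⁻ x, f (z + ρ • x) = ENNReal.ofReal ((ρ ^ n)⁻¹) * ∫⁻ x, f x := by
  have hemb : MeasurableEmbedding (fun x : En n => z + ρ • x) :=
    ((Homeomorph.smulOfNeZero ρ hρ.ne').trans (Homeomorph.addLeft z)).measurableEmbedding
  rw [← hemb.lintegral_map, map_affine_volume z hρ, lintegral_smul_measure, smul_eq_mul]

lemma Dr_bsc {β : En n → ℝ} (z : En n) {ρ : ℝ} (hρ : 0 < ρ) (y : En n) (R : ℝ) :
    Dr (bsc β z ρ) y R = Dr β (z + ρ • y) (ρ * R) := by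
  unfold Dr
  rw [← lintegral_indicator measurableSet_closedBall, ← lintegral_indicator measurableSet_closedBall]
  have : ∀ x : En n, (closedBall y R).indicator (fun x => ENNReal.ofReal (bsc β z ρ x) ^ n) x =
      ENNReal.ofReal (ρ ^ n) * (closedBall (z + ρ • y) (ρ * R)).indicator
        (fun x => ENNReal.ofReal (β x) ^ n) (z + ρ • x) := by
    intro x
    have hiff : x ∈ closedBall y R ↔ z + ρ • x ∈ closedBall (z + ρ • y) (ρ * R) := by
      rw [mem_closedBall, mem_closedBall, dist_add_left, dist_smul₀, Real.norm_of_nonneg hρ.le,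
        mul_le_mul_iff_right₀ hρ]
    by_cases hx : x ∈ closedBall y R
    · rw [indicator_of_mem hx, indicator_of_mem (hiff.1 hx), bsc, ENNReal.ofReal_mul hρ.le, mul_pow,
        ENNReal.ofReal_pow hρ.le]
    · rw [indicator_of_notMem hx, indicator_of_notMem (fun h => hx (hiff.2 h)), mul_zero]
  simp_rw [this]
  rw [lintegral_const_mul' _ _ ENNReal.ofReal_ne_top, lintegral_affine z hρ, ← mul_assoc,
    ← ENNReal.ofReal_mul (by positivity), mul_inv_cancel₀ (by positivity), ENNReal.ofReal_one, one_mul]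

lemma volume_smap_preimage (z : En n) (t₀ : ℝ) {ρ : ℝ} (hρ : 0 < ρ) (A : Set (En n × ℝ)) :
    volume (smap z t₀ ρ ⁻¹' A) = ENNReal.ofReal ((ρ ^ (n + 2))⁻¹) * volume A := by
  have h1 : Measure.map (fun t : ℝ => t₀ + ρ ^ 2 * t) volume = ENNReal.ofReal ((ρ ^ 2)⁻¹) • volume := by
    have h1 : (fun x : ℝ => t₀ + ρ ^ 2 * x) = (fun x => t₀ + x) ∘ (fun x => ρ ^ 2 • x) := rfl
    rw [h1, ← Measure.map_map (by fun_prop) (by fun_prop), Measure.map_addHaar_smul _ (by positivity),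
      Module.finrank_self, Measure.map_smul, map_add_left_eq_self, abs_of_nonneg (by positivity)]
    simp
  let e : En n × ℝ ≃ₜ En n × ℝ :=
    ((Homeomorph.smulOfNeZero ρ hρ.ne').trans (Homeomorph.addLeft z)).prodCongr
      ((Homeomorph.smulOfNeZero (ρ ^ 2) (by positivity)).trans (Homeomorph.addLeft t₀))
  have he : (e : En n × ℝ → En n × ℝ) = smap z t₀ ρ := rfl
  have hemb : MeasurableEmbedding (smap z t₀ ρ) := he ▸ e.measurableEmbedding
  rw [← hemb.map_apply]
  have h2 : Measure.map (smap z t₀ ρ) volume = ENNReal.ofReal ((ρ ^ (n + 2))⁻¹) • volume := by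
    have : smap z t₀ ρ = Prod.map (fun x : En n => z + ρ • x) (fun t : ℝ => t₀ + ρ ^ 2 * t) := rfl
    rw [this, Measure.volume_eq_prod, ← Measure.map_prod_map _ _ (by fun_prop) (by fun_prop),
      map_affine_volume z hρ, h1, Measure.prod_smul_left, Measure.prod_smul_right, smul_smul,
      ← ENNReal.ofReal_mul (by positivity), pow_add, mul_inv]
  rw [h2]; rfl

lemma smap_mem_cyl (hρ : 0 < ρ) {y : En n} {R s₀ s₁ : ℝ} {X : En n × ℝ} :
    smap z t₀ ρ X ∈ cyl (z + ρ • y) (ρ * R) (t₀ + ρ ^ 2 * s₀) (t₀ + ρ ^ 2 * s₁) ↔ X ∈ cyl y R s₀ s₁ := by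
  rw [mem_cyl, mem_cyl]
  simp only [smap]
  rw [add_sub_add_left_eq_sub, ← smul_sub, norm_smul, Real.norm_of_nonneg hρ.le,
    mul_le_mul_iff_right₀ hρ, add_le_add_iff_left, add_le_add_iff_left,
    mul_le_mul_iff_right₀ (by positivity), mul_le_mul_iff_right₀ (by positivity)]

lemma continuous_bsc {β : En n → ℝ} (hβ : Continuous β) (z : En n) (ρ : ℝ) : Continuous (bsc β z ρ) := by
  unfold bsc; fun_prop

lemma bsc_nonneg {β : En n → ℝ} (hβ : ∀ x, 0 ≤ β x) (z : En n) {ρ : ℝ} (hρ : 0 ≤ ρ) (x) :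
    0 ≤ bsc β z ρ x := mul_nonneg hρ (hβ _)

lemma Dr_mono {β : En n → ℝ} {z z' : En n} {R R' : ℝ} (h : closedBall z R ⊆ closedBall z' R') :
    Dr β z R ≤ Dr β z' R' := lintegral_mono_set h

end scaling

section special

lemma contDiff_time {h : ℝ → ℝ} (hh : ContDiff ℝ 2 h) : ContDiff ℝ 2 (fun X : En n × ℝ => h X.2) :=
  hh.comp contDiff_snd

lemma fderiv_time {h : ℝ → ℝ} {h' : ℝ} {X : En n × ℝ} (hh : HasDerivAt h h' X.2) (d) :
    fderiv ℝ (fun X : En n × ℝ => h X.2) X d = h' * d.2 := by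
  have := hh.comp_hasFDerivAt X (hasFDerivAt_snd (𝕜 := ℝ) (p := X))
  have e : fderiv ℝ (fun X : En n × ℝ => h X.2) X = _ := this.fderiv
  rw [e]; simp

/-- product with a function of time -/
lemma fderiv_time_mul {h : ℝ → ℝ} {h' : ℝ} {v : En n × ℝ → ℝ} {X : En n × ℝ}
    (hh : HasDerivAt h h' X.2) (hv : DifferentiableAt ℝ v X) (d) :
    fderiv ℝ (fun X : En n × ℝ => h X.2 * v X) X d = h X.2 * fderiv ℝ v X d + h' * d.2 * v X := by
  have h1 : HasFDerivAt (fun X : En n × ℝ => h X.2) _ X :=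
    hh.comp_hasFDerivAt X (hasFDerivAt_snd (𝕜 := ℝ) (p := X))
  have e : fderiv ℝ (fun X : En n × ℝ => h X.2 * v X) X = _ := (h1.mul hv.hasFDerivAt).fderiv
  rw [e]
  simp; ring

lemma Gi_time_mul {h : ℝ → ℝ} {v : En n × ℝ → ℝ} {X : En n × ℝ}
    (hh : Differentiable ℝ h) (hv : DifferentiableAt ℝ v X) (i) :
    Gi (fun X : En n × ℝ => h X.2 * v X) i X = h X.2 * Gi v i X := by
  unfold Gi
  rw [fderiv_time_mul (hh _).hasDerivAt hv]; simp [ex]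

lemma Gr_time_mul {h : ℝ → ℝ} {v : En n × ℝ → ℝ} {X : En n × ℝ}
    (hh : Differentiable ℝ h) (hv : DifferentiableAt ℝ v X) :
    Gr (fun X : En n × ℝ => h X.2 * v X) X = h X.2 • Gr v X := by
  ext i; simp [Gi_time_mul hh hv]

lemma Tt_time_mul {h : ℝ → ℝ} {h' : ℝ} {v : En n × ℝ → ℝ} {X : En n × ℝ}
    (hh : HasDerivAt h h' X.2) (hv : DifferentiableAt ℝ v X) :
    Tt (fun X : En n × ℝ => h X.2 * v X) X = h X.2 * Tt v X + h' * v X := by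
  unfold Tt
  rw [fderiv_time_mul hh hv]; simp

lemma Hh_time_mul {h : ℝ → ℝ} {v : En n × ℝ → ℝ} (hh : Differentiable ℝ h)
    (hv : ContDiff ℝ 2 v) (i j X) :
    Hh (fun X : En n × ℝ => h X.2 * v X) i j X = h X.2 * Hh v i j X := by
  have e : Gi (fun X : En n × ℝ => h X.2 * v X) j = fun X => h X.2 * Gi v j X :=
    funext fun X => Gi_time_mul hh (hv.differentiable (by norm_num)).differentiableAt j
  unfold Hh
  rw [e]
  exact Gi_time_mul hh ((contDiff_Gi hv j).differentiable (by norm_num)).differentiableAt i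

lemma fderiv_comp1 {F : ℝ → ℝ} {F' : ℝ} {s : En n × ℝ → ℝ} {X : En n × ℝ}
    (hF : HasDerivAt F F' (s X)) (hs : DifferentiableAt ℝ s X) (d) :
    fderiv ℝ (fun X => F (s X)) X d = F' * fderiv ℝ s X d := by
  have := hF.comp_hasFDerivAt X hs.hasFDerivAt
  have e : fderiv ℝ (fun X => F (s X)) X = _ := this.fderiv
  rw [e]; simp

lemma Hh_comp1 {F F1 F2 : ℝ → ℝ} {s : En n × ℝ → ℝ} (hF : ∀ r, HasDerivAt F (F1 r) r)
    (hF1 : ∀ r, HasDerivAt F1 (F2 r) r) (hs : ContDiff ℝ 2 s) (i j X) :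
    Hh (fun X => F (s X)) i j X = F2 (s X) * Gi s i X * Gi s j X + F1 (s X) * Hh s i j X := by
  have hsd : Differentiable ℝ s := hs.differentiable (by norm_num)
  have e : Gi (fun X => F (s X)) j = fun X => F1 (s X) * Gi s j X :=
    funext fun X => fderiv_comp1 (hF _) (hsd _) _
  unfold Hh
  rw [e]
  have h1 : HasFDerivAt (fun X => F1 (s X)) (F2 (s X) • fderiv ℝ s X) X :=
    (hF1 (s X)).comp_hasFDerivAt X (hsd X).hasFDerivAt
  have h2 : HasFDerivAt (Gi s j) (fderiv ℝ (Gi s j) X) X :=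
    ((contDiff_Gi hs j).differentiable (by norm_num)).differentiableAt.hasFDerivAt
  have e2 : fderiv ℝ (fun X => F1 (s X) * Gi s j X) X = _ := (h1.mul h2).fderiv
  rw [e2]
  simp [Gi]; ring

/-- positive-part cube -/
def pc (s : ℝ) : ℝ := max s 0 ^ 3

lemma hasDerivAt_maxpow (k : ℕ) (s : ℝ) :
    HasDerivAt (fun s : ℝ => max s 0 ^ (k + 2)) ((k + 2 : ℕ) * max s 0 ^ (k + 1)) s := by
  rcases lt_trichotomy s 0 with h | h | h
  · rw [max_eq_right h.le]
    have : (fun s : ℝ => max s 0 ^ (k + 2)) =ᶠ[nhds s] fun _ => 0 := by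
      filter_upwards [Iio_mem_nhds h] with r hr
      rw [max_eq_right (le_of_lt hr)]; simp
    simpa using (hasDerivAt_const s (0:ℝ)).congr_of_eventuallyEq this
  · subst h
    simp only [max_self]
    have : (fun s : ℝ => max s 0 ^ (k + 2)) =O[nhds 0] fun s => s ^ (k + 2) := by
      apply Asymptotics.IsBigO.of_bound 1
      filter_upwards with r
      rw [one_mul, norm_pow, norm_pow]
      gcongr
      rw [Real.norm_of_nonneg (le_max_right _ _), Real.norm_eq_abs]
      exact max_le (le_abs_self _) (abs_nonneg _)
    have h2 : (fun s : ℝ => s ^ (k + 2)) =o[nhds 0] fun s => s := by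
      have := Asymptotics.isLittleO_pow_pow (𝕜 := ℝ) (m := 1) (n := k + 2) (by omega)
      simpa using this
    rw [hasDerivAt_iff_isLittleO]
    simpa using this.trans_isLittleO h2
  · rw [max_eq_left h.le]
    have : (fun s : ℝ => max s 0 ^ (k + 2)) =ᶠ[nhds s] fun s => s ^ (k + 2) := by
      filter_upwards [Ioi_mem_nhds h] with r hr
      rw [max_eq_left (le_of_lt hr)]
    have h3 := (hasDerivAt_pow (k + 2) s).congr_of_eventuallyEq this
    simpa using h3

lemma hasDerivAt_pc (s : ℝ) : HasDerivAt pc (3 * max s 0 ^ 2) s := by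
  have h := hasDerivAt_maxpow 1 s
  norm_num at h
  exact h

lemma hasDerivAt_pc1 (s : ℝ) : HasDerivAt (fun s => 3 * max s 0 ^ 2) (6 * max s 0) s := by
  have := (hasDerivAt_maxpow 0 s).const_mul 3
  norm_num at this
  have e : (6:ℝ) * max s 0 = 3 * (2 * max s 0) := by ring
  rw [e]
  exact this

lemma contDiff_pc : ContDiff ℝ 2 pc := by
  have h1 : ContDiff ℝ 1 (fun s : ℝ => 3 * max s 0 ^ 2) := by
    rw [contDiff_one_iff_deriv]
    refine ⟨fun s => (hasDerivAt_pc1 s).differentiableAt, ?_⟩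
    have : deriv (fun s : ℝ => 3 * max s 0 ^ 2) = fun s => 6 * max s 0 :=
      funext fun s => (hasDerivAt_pc1 s).deriv
    rw [this]; fun_prop
  have : (2 : WithTop ℕ∞) = 1 + 1 := by norm_num
  rw [this, contDiff_succ_iff_deriv]
  refine ⟨fun s => (hasDerivAt_pc s).differentiableAt, by simp, ?_⟩
  have : deriv pc = fun s => 3 * max s 0 ^ 2 := funext fun s => (hasDerivAt_pc s).deriv
  rw [this]; exact h1

/-- functions of space only -/
lemma fderiv_space {Y : En n → ℝ} {X : En n × ℝ} (hY : DifferentiableAt ℝ Y X.1) (d) :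
    fderiv ℝ (fun X : En n × ℝ => Y X.1) X d = fderiv ℝ Y X.1 d.1 := by
  have := hY.hasFDerivAt.comp X (hasFDerivAt_fst (𝕜 := ℝ) (p := X))
  have e : fderiv ℝ (fun X : En n × ℝ => Y X.1) X = _ := this.fderiv
  rw [e]; simp

lemma contDiff_nsq : ContDiff ℝ 2 (fun X : En n × ℝ => ‖X.1‖ ^ 2) :=
  (contDiff_norm_sq ℝ).comp contDiff_fst

lemma Gi_nsq (i : Fin n) (X : En n × ℝ) : Gi (fun X : En n × ℝ => ‖X.1‖ ^ 2) i X = 2 * X.1 i := by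
  unfold Gi
  rw [fderiv_space (Y := fun x => ‖x‖ ^ 2)
    ((contDiff_norm_sq ℝ (n := 1)).differentiable (by norm_num)).differentiableAt]
  have := (hasStrictFDerivAt_norm_sq X.1).hasFDerivAt.fderiv
  rw [this]
  simp [ex, PiLp.inner_apply, EuclideanSpace.single]

lemma Tt_nsq (X : En n × ℝ) : Tt (fun X : En n × ℝ => ‖X.1‖ ^ 2) X = 0 := by
  unfold Tt
  rw [fderiv_space (Y := fun x => ‖x‖ ^ 2)
    ((contDiff_norm_sq ℝ (n := 1)).differentiable (by norm_num)).differentiableAt]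
  simp

lemma Gr_nsq (X : En n × ℝ) : Gr (fun X : En n × ℝ => ‖X.1‖ ^ 2) X = (2:ℝ) • X.1 := by
  ext i; simp [Gi_nsq]

lemma Hh_nsq (i j : Fin n) (X : En n × ℝ) :
    Hh (fun X : En n × ℝ => ‖X.1‖ ^ 2) i j X = if i = j then 2 else 0 := by
  have e : Gi (fun X : En n × ℝ => ‖X.1‖ ^ 2) j = fun X : En n × ℝ => 2 * X.1 j :=
    funext fun X => Gi_nsq j X
  unfold Hh
  rw [e]
  let L : En n × ℝ →L[ℝ] ℝ := (2:ℝ) • ((PiLp.proj 2 (fun _ : Fin n => ℝ) j : En n →L[ℝ] ℝ).comp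
      (ContinuousLinearMap.fst ℝ (En n) ℝ))
  have : fderiv ℝ (fun X : En n × ℝ => 2 * X.1 j) X = L := L.hasFDerivAt.fderiv
  rw [this]
  simp [L, ex, eq_comm]

lemma aH_nsq (a) (X : En n × ℝ) :
    aH a (fun X : En n × ℝ => ‖X.1‖ ^ 2) X = 2 * ∑ i, a i i := by
  simp [aH, Hh_nsq, Finset.mul_sum, mul_comm]

lemma Ell.trace_le {ν : ℝ} (hν : 0 ≤ ν) {a : Matrix (Fin n) (Fin n) ℝ} (ha : Ell ν a) :
    ∑ i, a i i ≤ n * ν := by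
  calc ∑ i, a i i ≤ ∑ _i : Fin n, ν :=
        Finset.sum_le_sum fun i _ => (le_abs_self _).trans (ha.entry_le hν i i)
    _ = _ := by simp

end special

end Hk

namespace Hk

def SupAt (ν : ℝ) (β : En n → ℝ) (u : En n × ℝ → ℝ) (X : En n × ℝ) : Prop :=
  SubAt ν β (fun Y => - u Y) X

def Drift (β : En n → ℝ) : Prop := Continuous β ∧ ∀ x, 0 ≤ β x

lemma Drift.bsc {β : En n → ℝ} (h : Drift β) (z : En n) {ρ : ℝ} (hρ : 0 ≤ ρ) : Drift (bsc β z ρ) :=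
  ⟨continuous_bsc h.1 z ρ, bsc_nonneg h.2 z hρ⟩

section neg
variable {u : En n × ℝ → ℝ}

lemma neg_eq : (fun Y => - u Y) = fun Y => (-1) * u Y := by funext Y; ring

lemma Tt_neg (hu : ContDiff ℝ 2 u) (X) : Tt (fun Y => - u Y) X = - Tt u X := by
  rw [neg_eq, Tt_const_mul _ hu]; ring

lemma aH_neg (hu : ContDiff ℝ 2 u) (a) (X) : aH a (fun Y => - u Y) X = - aH a u X := by
  rw [neg_eq, aH_const_mul _ hu]; ring

lemma Gr_neg (hu : ContDiff ℝ 2 u) (X) : Gr (fun Y => - u Y) X = - Gr u X := by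
  rw [neg_eq, Gr_const_mul _ hu]; simp

lemma supAt_iff {ν : ℝ} {β : En n → ℝ} (hu : ContDiff ℝ 2 u) {X} :
    SupAt ν β u X ↔ ∃ a, Ell ν a ∧ -(β X.1 * ‖Gr u X‖) ≤ Tt u X - aH a u X := by
  unfold SupAt SubAt
  simp only [Tt_neg hu, aH_neg hu, Gr_neg hu, norm_neg]
  constructor
  · rintro ⟨a, ha, h⟩; exact ⟨a, ha, by linarith⟩
  · rintro ⟨a, ha, h⟩; exact ⟨a, ha, by linarith⟩

lemma SupAt.const_mul {ν : ℝ} {β : En n → ℝ} {X} (hu : ContDiff ℝ 2 u) (h : SupAt ν β u X)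
    {c : ℝ} (hc : 0 ≤ c) : SupAt ν β (fun Y => c * u Y) X := by
  have := SubAt.const_mul hu.neg h hc
  unfold SupAt
  convert this using 2
  ring

lemma SupAt.smap {ν : ℝ} {β : En n → ℝ} {z : En n} {t₀ ρ : ℝ} (hu : ContDiff ℝ 2 u) (hρ : 0 ≤ ρ) {X}
    (h : SupAt ν β u (smap z t₀ ρ X)) :
    SupAt ν (Hk.bsc β z ρ) (fun Y => u (Hk.smap z t₀ ρ Y)) X :=
  SubAt.smap (u := fun Y => - u Y) hu.neg hρ h

end neg

lemma smap_mem {z : En n} {t₀ ρ R s₀ s₁ : ℝ} (hρ : 0 < ρ) {X : En n × ℝ} (hX : X ∈ cyl 0 R s₀ s₁) :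
    smap z t₀ ρ X ∈ cyl z (ρ * R) (t₀ + ρ ^ 2 * s₀) (t₀ + ρ ^ 2 * s₁) := by
  have := (smap_mem_cyl (z := z) (t₀ := t₀) hρ (y := 0)).2 hX
  simpa using this

lemma smap_inv {z : En n} {t₀ ρ : ℝ} (hρ : 0 < ρ) (X : En n × ℝ) :
    smap z t₀ ρ (ρ⁻¹ • (X.1 - z), (X.2 - t₀) / ρ ^ 2) = X := by
  apply Prod.ext
  · simp only [smap]
    rw [smul_smul, mul_inv_cancel₀ hρ.ne']; simp
  · simp only [smap]; field_simp; ring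

lemma exists_max_cyl {w : En n × ℝ → ℝ} (hw : Continuous w) {R T : ℝ} {X1 : En n × ℝ}
    (hX1 : X1 ∈ cyl 0 R 0 T) :
    ∃ X0 ∈ cyl 0 R 0 T, ∀ X ∈ cyl 0 R 0 T, w X ≤ w X0 := by
  obtain ⟨X0, h, h2⟩ := (isCompact_cyl (0 : En n) R 0 T).exists_isMaxOn ⟨X1, hX1⟩ hw.continuousOn
  exact ⟨X0, h, fun X hX => h2 hX⟩

lemma vol_cyl_le (z : En n) {R t₀ t₁ : ℝ} (hR : 0 < R) (ht : t₀ ≤ t₁) :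
    volume (cyl z R t₀ t₁) = ENNReal.ofReal (R ^ n * om n * (t₁ - t₀)) := by
  have h1 : volume (closedBall z R) = ENNReal.ofReal (R ^ n * om n) := by
    rw [← vol_ball z hR]
    rw [Measure.addHaar_closedBall _ _ hR.le, Measure.addHaar_ball_of_pos _ _ hR]
  have := om_pos n
  rw [cyl, Measure.volume_eq_prod, Measure.prod_prod, h1, Real.volume_Icc,
    ← ENNReal.ofReal_mul (by positivity)]

lemma fill_unit (hn : 0 < n) {ν : ℝ} (hν : 0 < ν) (S : ℝ) (hS0 : 0 ≤ S) :
    ∃ K : ℝ, 1 ≤ K ∧ ∀ (v : En n × ℝ → ℝ) (β : En n → ℝ) (T : ℝ), ContDiff ℝ 2 v → Drift β →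
      K ≤ T → Dr β 0 1 ≤ ENNReal.ofReal S →
      (∀ X ∈ cyl 0 1 0 T, SubAt ν β v X) → (∀ X ∈ cyl 0 1 0 T, v X ≤ 1) →
      (∀ (x : En n) (t : ℝ), ‖x‖ = 1 → 0 ≤ t → t ≤ T → v (x, t) ≤ 1 / 2) →
      ∀ x : En n, ‖x‖ ≤ 1 → v (x, T) ≤ 3 / 4 := by
  have hC := C0_pos (n := n) hν
  have hom := om_pos n
  obtain ⟨J, hJ⟩ := exists_nat_gt (C0 n ν * 2 ^ n * S + 1)
  set E : ℝ := C0 n ν * ((16 * 2 ^ J) ^ n * om n) * 4 with hE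
  have hE0 : 0 < E := by positivity
  refine ⟨max 1 E, le_max_left _ _, ?_⟩
  intro v β T hv hβ hT hS hsub hv1 hlat x hx
  have hT1 : 1 ≤ T := (le_max_left _ _).trans hT
  have hTE : E ≤ T := (le_max_right _ _).trans hT
  have hT0 : 0 < T := by linarith
  by_contra hcon
  push Not at hcon
  let h : ℝ → ℝ := fun t => t / (2 * T) - 1
  have hh : ContDiff ℝ 2 h := by unfold h; fun_prop
  have hhd : ∀ t, HasDerivAt h (1 / (2 * T)) t := by
    intro t
    simpa [h] using ((hasDerivAt_id t).div_const (2 * T)).sub_const 1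
  let w : En n × ℝ → ℝ := fun X => v X + h X.2
  have hw : ContDiff ℝ 2 w := hv.add (contDiff_time hh)
  have hG0 : ∀ i X, Gi (fun X : En n × ℝ => h X.2) i X = 0 := by
    intro i X; unfold Gi; rw [fderiv_time (hhd _)]; simp [ex]
  have hGr : ∀ X, Gr w X = Gr v X := by
    intro X
    rw [Gr_add hv (contDiff_time hh)]
    ext i; simp [hG0]
  have hH0 : ∀ i j X, Hh (fun X : En n × ℝ => h X.2) i j X = 0 := by
    intro i j X
    have : Gi (fun X : En n × ℝ => h X.2) j = fun _ => 0 := funext fun X => hG0 j X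
    unfold Hh; rw [this]; simp
  have haH : ∀ a X, aH a w X = aH a v X := by
    intro a X
    rw [aH_add hv (contDiff_time hh)]
    simp [aH, hH0]
  have hTt : ∀ X, Tt w X = Tt v X + 1 / (2 * T) := by
    intro X
    rw [Tt_add hv (contDiff_time hh)]
    congr 1
    unfold Tt; rw [fderiv_time (hhd _)]; simp
  have hxT : ((x, T) : En n × ℝ) ∈ cyl 0 1 0 T := mem_cyl.2 ⟨by simpa using hx, hT0.le, le_rfl⟩
  obtain ⟨X0, hX0, hmax⟩ := exists_max_cyl hw.continuous hxT
  have hM4 : 1 / 4 < w X0 := by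
    have := hmax _ hxT
    have e : w (x, T) = v (x, T) - 1 / 2 := by
      simp only [w, h]; field_simp; ring
    linarith
  set M := w X0 with hM
  have hM0 : 0 < M := by linarith
  have hM1 : M ≤ 1 := by
    have h1 := hv1 X0 hX0
    have h2 : h X0.2 ≤ 0 := by
      simp only [h]
      rw [sub_nonpos, div_le_one (by positivity)]
      have := (mem_cyl.1 hX0).2.2; linarith
    simp only [hM, w]; linarith
  have key := abp hn hν hw (R := 1) (T := T) (M := M) (g := 0) (f := 1 / (2 * T))
    (μ := M / (4 * 2 ^ J)) (S := S) (V := om n * T) (β := β) (J := J) one_pos le_rfl (by positivity)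
    (by positivity) hβ.2 hβ.1 ?_ ?_ ?_ hmax hX0 hM.symm hM0 ?_ hS0 hS (by positivity) ?_
  · have hm : (1:ℝ) / 4 ≤ M := hM4.le
    have e1 : ((M / (4 * 2 ^ J))⁻¹) ^ n * (1 / (2 * T)) ^ (n + 1) * (om n * T) ≤
        (16 * 2 ^ J) ^ n * om n * (1 / T) := by
      have a1 : (M / (4 * 2 ^ J))⁻¹ ≤ 16 * 2 ^ J := by
        rw [inv_div, div_le_iff₀ hM0]
        have : (0:ℝ) < 2 ^ J := by positivity
        nlinarith
      have a2 : (1 / (2 * T)) ^ (n + 1) ≤ (1 / T) ^ 2 := by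
        have b1 : 1 / (2 * T) ≤ 1 / T := by
          apply one_div_le_one_div_of_le hT0; linarith
        calc (1 / (2 * T)) ^ (n + 1) ≤ (1 / T) ^ (n + 1) := by gcongr
          _ ≤ (1 / T) ^ 2 := by
            apply pow_le_pow_of_le_one (by positivity)
            · rw [div_le_one hT0]; exact hT1
            · omega
      calc ((M / (4 * 2 ^ J))⁻¹) ^ n * (1 / (2 * T)) ^ (n + 1) * (om n * T)
          ≤ (16 * 2 ^ J) ^ n * (1 / T) ^ 2 * (om n * T) := by gcongr
        _ = _ := by field_simp
    have e2 : C0 n ν * ((16 * 2 ^ J) ^ n * om n * (1 / T)) ≤ 1 / 4 := by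
      have : E * (1 / T) ≤ 1 := by rw [mul_one_div, div_le_one hT0]; exact hTE
      rw [hE] at this
      linarith
    have e3 : C0 n ν * (((M / (4 * 2 ^ J))⁻¹) ^ n * (1 / (2 * T)) ^ (n + 1) * (om n * T)) ≤ 1 / 4 :=
      (mul_le_mul_of_nonneg_left e1 hC.le).trans e2
    have e4 : (2 + 0 / (M / (4 * 2 ^ J)) : ℝ) = 2 := by simp
    rw [e4] at key
    nlinarith
  · intro y hy
    have := hv1 (y, 0) (mem_cyl.2 ⟨by simpa using hy, le_rfl, hT0.le⟩)
    simp only [w, h]; simp; exact this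
  · intro y t hy ht0 htT
    have h1 := hlat y t hy ht0 htT
    have : t / (2 * T) ≤ 1 / 2 := by
      rw [div_le_div_iff₀ (by positivity) (by norm_num)]; linarith
    simp only [w, h]; linarith
  · intro X hX _
    obtain ⟨a, ha, h⟩ := hsub X hX
    refine ⟨a, ha, ?_⟩
    rw [hTt, haH, hGr]; linarith
  · rw [div_eq_mul_inv, div_eq_mul_inv]
    apply le_of_eq; field_simp
  · refine (measure_mono (sep_subset _ _)).trans (le_of_eq ?_)
    rw [vol_cyl_le _ one_pos hT0.le]; simp

lemma fill (hn : 0 < n) {ν : ℝ} (hν : 0 < ν) (S : ℝ) (hS0 : 0 ≤ S) :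
    ∃ K : ℝ, 1 ≤ K ∧ ∀ (v : En n × ℝ → ℝ) (β : En n → ℝ) (z : En n) (R t₀ t₁ : ℝ),
      ContDiff ℝ 2 v → Drift β → 0 < R →
      K * R ^ 2 ≤ t₁ - t₀ → Dr β z R ≤ ENNReal.ofReal S →
      (∀ X ∈ cyl z R t₀ t₁, SubAt ν β v X) → (∀ X ∈ cyl z R t₀ t₁, v X ≤ 1) →
      (∀ (x : En n) (t : ℝ), ‖x - z‖ = R → t₀ ≤ t → t ≤ t₁ → v (x, t) ≤ 1 / 2) →
      ∀ x : En n, ‖x - z‖ ≤ R → v (x, t₁) ≤ 3 / 4 := by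
  obtain ⟨K, hK1, hK⟩ := fill_unit hn hν S hS0
  refine ⟨K, hK1, ?_⟩
  intro v β z R t₀ t₁ hv hβ hR hT hS hsub hv1 hlat x hx
  set T := (t₁ - t₀) / R ^ 2 with hTd
  have hT' : t₀ + R ^ 2 * T = t₁ := by rw [hTd]; field_simp; ring
  have hKT : K ≤ T := by rw [hTd, le_div_iff₀ (by positivity)]; exact hT
  have hmem : ∀ X ∈ cyl (0 : En n) 1 0 T, smap z t₀ R X ∈ cyl z R t₀ t₁ := by
    intro X hX
    have := smap_mem (z := z) (t₀ := t₀) hR hX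
    simpa [hT'] using this
  have := hK (fun Y => v (smap z t₀ R Y)) (bsc β z R) T (contDiff_comp_smap hv) (hβ.bsc z hR.le) hKT
    (by rw [Dr_bsc z hR]; simpa using hS)
    (fun X hX => SubAt.smap hv hR.le (hsub _ (hmem X hX))) (fun X hX => hv1 _ (hmem X hX))
    ?_ (R⁻¹ • (x - z)) ?_
  · have e := smap_inv (z := z) (t₀ := t₀) hR (x, t₁)
    rw [← hTd] at e
    simp only at e
    rwa [e] at this
  · intro y t hy ht0 htT
    refine hlat _ _ ?_ ?_ ?_
    · simp [norm_smul, hy, abs_of_pos hR]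
    · have : 0 ≤ R ^ 2 * t := by positivity
      linarith
    · rw [← hT']; gcongr
  · rw [norm_smul, norm_inv, Real.norm_of_nonneg hR.le, inv_mul_le_iff₀ hR]; simpa using hx

lemma growth_unit (hn : 0 < n) {ν : ℝ} (hν : 0 < ν) :
    ∃ ε μ₀ : ℝ, 0 < ε ∧ 0 < μ₀ ∧ ∀ (v : En n × ℝ → ℝ) (β : En n → ℝ), ContDiff ℝ 2 v → Drift β →
      Dr β 0 1 ≤ ENNReal.ofReal ε →
      (∀ X ∈ cyl 0 1 0 1, SubAt ν β v X) → (∀ X ∈ cyl 0 1 0 1, v X ≤ 1) →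
      volume {X ∈ cyl (0 : En n) 1 0 1 | 0 < v X} ≤ ENNReal.ofReal μ₀ →
      v (0, 1) ≤ 1 / 2 := by
  have hC := C0_pos (n := n) hν
  set f : ℝ := 1 + 2 * (n * ν) with hf
  have hf0 : 0 < f := by positivity
  set B1 : ℝ := C0 n ν * 34 ^ n with hB1
  set B2 : ℝ := C0 n ν * (16 ^ n * f ^ (n + 1)) with hB2
  have hB10 : 0 < B1 := by positivity
  have hB20 : 0 < B2 := by positivity
  refine ⟨1 / (5 * B1), 1 / (5 * B2), by positivity, by positivity, ?_⟩
  intro v β hv hβ hS hsub hv1 hvol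
  by_contra hcon
  push Not at hcon
  let h : ℝ → ℝ := fun t => t - 1
  have hh : ContDiff ℝ 2 h := by unfold h; fun_prop
  have hhd : ∀ t, HasDerivAt h 1 t := fun t => by simpa [h] using (hasDerivAt_id t).sub_const 1
  let p : En n × ℝ → ℝ := fun X => (-1) * ‖X.1‖ ^ 2 + h X.2
  have hq : ContDiff ℝ 2 (fun X : En n × ℝ => (-1) * ‖X.1‖ ^ 2) := contDiff_const.mul contDiff_nsq
  have hp : ContDiff ℝ 2 p := hq.add (contDiff_time hh)
  let w : En n × ℝ → ℝ := fun X => v X + p X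
  have hw : ContDiff ℝ 2 w := hv.add hp
  have hG0 : ∀ i X, Gi (fun X : En n × ℝ => h X.2) i X = 0 := by
    intro i X; unfold Gi; rw [fderiv_time (hhd _)]; simp [ex]
  have hH0 : ∀ i j X, Hh (fun X : En n × ℝ => h X.2) i j X = 0 := by
    intro i j X
    have : Gi (fun X : En n × ℝ => h X.2) j = fun _ => 0 := funext fun X => hG0 j X
    unfold Hh; rw [this]; simp
  have hGr : ∀ X, Gr w X = Gr v X - (2:ℝ) • X.1 := by
    intro X
    rw [Gr_add hv hp, Gr_add hq (contDiff_time hh), Gr_const_mul _ contDiff_nsq, Gr_nsq]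
    ext i; simp [hG0]; ring
  have haH : ∀ a X, aH a w X = aH a v X - 2 * ∑ i, a i i := by
    intro a X
    rw [aH_add hv hp, aH_add hq (contDiff_time hh), aH_const_mul _ contDiff_nsq, aH_nsq]
    have : aH a (fun X : En n × ℝ => h X.2) X = 0 := by simp [aH, hH0]
    rw [this]; ring
  have hTt : ∀ X, Tt w X = Tt v X + 1 := by
    intro X
    rw [Tt_add hv hp, Tt_add hq (contDiff_time hh), Tt_const_mul _ contDiff_nsq, Tt_nsq]
    have : Tt (fun X : En n × ℝ => h X.2) X = 1 := by
      unfold Tt; rw [fderiv_time (hhd _)]; simp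
    rw [this]; ring
  have h01 : ((0, 1) : En n × ℝ) ∈ cyl 0 1 0 1 := mem_cyl.2 ⟨by simp, by simp, le_rfl⟩
  obtain ⟨X0, hX0, hmax⟩ := exists_max_cyl hw.continuous h01
  have hple : ∀ X ∈ cyl (0 : En n) 1 0 1, p X ≤ 0 := by
    intro X hX
    have := (mem_cyl.1 hX).2.2
    simp only [p, h]; nlinarith [sq_nonneg ‖X.1‖]
  have hM2 : 1 / 2 < w X0 := by
    have := hmax _ h01
    have e : w (0, 1) = v (0, 1) := by simp [w, p, h]
    linarith
  set M := w X0 with hM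
  have hM0 : 0 < M := by linarith
  have hM1 : M ≤ 1 := by
    have h1 := hv1 X0 hX0
    have h2 := hple X0 hX0
    simp only [hM, w]; linarith
  have key := abp hn hν hw (R := 1) (T := 1) (M := M) (g := 2) (f := f)
    (μ := M / 8) (S := 1 / (5 * B1)) (V := 1 / (5 * B2)) (β := β) (J := 1) one_pos (by norm_num) hf0.le
    (by positivity) hβ.2 hβ.1 ?_ ?_ ?_ hmax hX0 hM.symm hM0 ?_ (by positivity) hS (by positivity) ?_
  · have e1 : (2 + 2 / (M / 8)) ^ n ≤ (34:ℝ) ^ n := by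
      gcongr
      have : 2 / (M / 8) ≤ 32 := by
        rw [div_le_iff₀ (by positivity)]; linarith
      linarith
    have e2 : ((M / 8)⁻¹) ^ n ≤ (16:ℝ) ^ n := by
      gcongr
      rw [inv_div, div_le_iff₀ hM0]; linarith
    have e3 : C0 n ν * ((2 + 2 / (M / 8)) ^ n * M * (1 / (5 * B1))) ≤ 1 / 5 := by
      calc C0 n ν * ((2 + 2 / (M / 8)) ^ n * M * (1 / (5 * B1)))
          ≤ C0 n ν * (34 ^ n * 1 * (1 / (5 * B1))) := by gcongr
        _ = B1 * (1 / (5 * B1)) := by rw [hB1]; ring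
        _ = 1 / 5 := by field_simp
    have e4 : C0 n ν * (((M / 8)⁻¹) ^ n * f ^ (n + 1) * (1 / (5 * B2))) ≤ 1 / 5 := by
      calc C0 n ν * (((M / 8)⁻¹) ^ n * f ^ (n + 1) * (1 / (5 * B2)))
          ≤ C0 n ν * (16 ^ n * f ^ (n + 1) * (1 / (5 * B2))) := by gcongr
        _ = B2 * (1 / (5 * B2)) := by rw [hB2]; ring
        _ = 1 / 5 := by field_simp
    rw [mul_add] at key
    push_cast at key
    linarith
  · intro y hy
    have := hv1 (y, 0) (mem_cyl.2 ⟨by simpa using hy, le_rfl, zero_le_one⟩)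
    simp only [w, p, h]; nlinarith [sq_nonneg ‖y‖]
  · intro y t hy ht0 htT
    have := hv1 (y, t) (mem_cyl.2 ⟨by simpa using hy.le, ht0, htT⟩)
    simp only [w, p, h, hy]; linarith
  · intro X hX _
    obtain ⟨a, ha, h⟩ := hsub X hX
    refine ⟨a, ha, ?_⟩
    have h1 : ‖Gr v X‖ ≤ ‖Gr w X‖ + 2 := by
      have : Gr v X = Gr w X + (2:ℝ) • X.1 := by rw [hGr]; abel
      rw [this]
      refine (norm_add_le _ _).trans ?_
      rw [norm_smul]
      have := (mem_cyl.1 hX).1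
      simp only [sub_zero] at this
      norm_num; linarith
    have h2 := mul_le_mul_of_nonneg_left h1 (hβ.2 X.1)
    have h3 := ha.trace_le hν.le
    rw [hTt, haH]; linarith
  · linarith
  · refine (measure_mono ?_).trans hvol
    intro X hX
    refine ⟨hX.1, ?_⟩
    have h1 := hple X hX.1
    have h2 : 0 < v X + p X := hX.2
    linarith

lemma growth_small (hn : 0 < n) {ν : ℝ} (hν : 0 < ν) :
    ∃ ε μ₀ : ℝ, 0 < ε ∧ 0 < μ₀ ∧ ∀ (v : En n × ℝ → ℝ) (β : En n → ℝ) (z : En n) (R t₁ : ℝ),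
      ContDiff ℝ 2 v → Drift β → 0 < R →
      Dr β z R ≤ ENNReal.ofReal ε →
      (∀ X ∈ cyl z R (t₁ - R ^ 2) t₁, SubAt ν β v X) → (∀ X ∈ cyl z R (t₁ - R ^ 2) t₁, v X ≤ 1) →
      volume {X ∈ cyl z R (t₁ - R ^ 2) t₁ | 0 < v X} ≤ ENNReal.ofReal (μ₀ * R ^ (n + 2)) →
      v (z, t₁) ≤ 1 / 2 := by
  obtain ⟨ε, μ₀, hε, hμ, H⟩ := growth_unit hn hν
  refine ⟨ε, μ₀, hε, hμ, ?_⟩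
  intro v β z R t₁ hv hβ hR hS hsub hv1 hvol
  have hmem : ∀ X ∈ cyl (0 : En n) 1 0 1, smap z (t₁ - R ^ 2) R X ∈ cyl z R (t₁ - R ^ 2) t₁ := by
    intro X hX
    have := smap_mem (z := z) (t₀ := t₁ - R ^ 2) hR hX
    simpa using this
  have := H (fun Y => v (smap z (t₁ - R ^ 2) R Y)) (bsc β z R) (contDiff_comp_smap hv)
    (hβ.bsc z hR.le) (by rw [Dr_bsc z hR]; simpa using hS)
    (fun X hX => SubAt.smap hv hR.le (hsub _ (hmem X hX))) (fun X hX => hv1 _ (hmem X hX)) ?_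
  · simpa [smap] using this
  · calc volume {X ∈ cyl (0 : En n) 1 0 1 | 0 < v (smap z (t₁ - R ^ 2) R X)}
        ≤ volume (smap z (t₁ - R ^ 2) R ⁻¹' {X ∈ cyl z R (t₁ - R ^ 2) t₁ | 0 < v X}) := by
          apply measure_mono
          intro X hX
          exact ⟨hmem X hX.1, hX.2⟩
      _ ≤ ENNReal.ofReal ((R ^ (n + 2))⁻¹) * ENNReal.ofReal (μ₀ * R ^ (n + 2)) := by
          rw [volume_smap_preimage _ _ hR]; gcongr
      _ = ENNReal.ofReal μ₀ := by
          rw [← ENNReal.ofReal_mul (by positivity)]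
          congr 1; field_simp

end Hk

namespace Hk

section barrier

def sB (a : ℝ) (Y : En n × ℝ → ℝ) (X : En n × ℝ) : ℝ := (1 + a * X.2) + (-1) * Y X

def psiB (q a : ℝ) (Y : En n × ℝ → ℝ) (X : En n × ℝ) : ℝ := Real.exp (-q * X.2) * pc (sB a Y X)

variable {a q : ℝ} {Y : En n × ℝ → ℝ}

lemma lin_facts (a : ℝ) : ContDiff ℝ 2 (fun t : ℝ => 1 + a * t) ∧ ∀ t, HasDerivAt (fun t : ℝ => 1 + a * t) a t := by
  refine ⟨by fun_prop, fun t => ?_⟩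
  simpa using ((hasDerivAt_id t).const_mul a).const_add 1

lemma contDiff_cm (hY : ContDiff ℝ 2 Y) : ContDiff ℝ 2 (fun X => (-1:ℝ) * Y X) := contDiff_const.mul hY

lemma contDiff_sB (hY : ContDiff ℝ 2 Y) : ContDiff ℝ 2 (sB a Y) :=
  (contDiff_time (lin_facts a).1).add (contDiff_const.mul hY)

lemma Gi_time0 {h : ℝ → ℝ} {h' : ℝ} {X : En n × ℝ} (hh : HasDerivAt h h' X.2) (i) :
    Gi (fun X : En n × ℝ => h X.2) i X = 0 := by
  unfold Gi; rw [fderiv_time hh]; simp [ex]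

lemma Gi_sB (hY : ContDiff ℝ 2 Y) (i X) : Gi (sB a Y) i X = - Gi Y i X := by
  have := Gi_add (contDiff_time (n := n) (lin_facts a).1) (contDiff_cm hY) i X
  unfold sB
  rw [this, Gi_time0 ((lin_facts a).2 _), Gi_const_mul _ hY]; ring

lemma Tt_sB (hY : ContDiff ℝ 2 Y) (X) (hT : Tt Y X = 0) : Tt (sB a Y) X = a := by
  have := Tt_add (contDiff_time (n := n) (lin_facts a).1) (contDiff_cm hY) X
  unfold sB
  rw [this, Tt_const_mul _ hY, hT]
  unfold Tt; rw [fderiv_time ((lin_facts a).2 _)]; simp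

lemma Hh_sB (hY : ContDiff ℝ 2 Y) (i j X) : Hh (sB a Y) i j X = - Hh Y i j X := by
  have : Gi (sB a Y) j = fun X => (-1) * Gi Y j X := funext fun X => by rw [Gi_sB hY]; ring
  unfold Hh
  rw [this, fderiv_const_mul ((contDiff_Gi hY j).differentiable (by norm_num)).differentiableAt]
  simp

lemma exp_facts (q : ℝ) : ContDiff ℝ 2 (fun t : ℝ => Real.exp (-q * t)) ∧
    ∀ t, HasDerivAt (fun t : ℝ => Real.exp (-q * t)) (-q * Real.exp (-q * t)) t := by
  refine ⟨by fun_prop, fun t => ?_⟩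
  have := ((hasDerivAt_id t).const_mul (-q)).exp
  simpa [mul_comm] using this

lemma contDiff_psiB (hY : ContDiff ℝ 2 Y) : ContDiff ℝ 2 (psiB q a Y) :=
  (contDiff_time (exp_facts q).1).mul (contDiff_pc.comp (contDiff_sB hY))

lemma Gr_psiB (hY : ContDiff ℝ 2 Y) (X) :
    Gr (psiB q a Y) X = -(Real.exp (-q * X.2) * (3 * max (sB a Y X) 0 ^ 2)) • Gr Y X := by
  have hs := contDiff_sB (a := a) hY
  have hpcd : ContDiff ℝ 2 (fun X => pc (sB a Y X)) := contDiff_pc.comp hs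
  unfold psiB
  rw [Gr_time_mul ((exp_facts q).1.differentiable (by norm_num))
    (hpcd.differentiable (by norm_num)).differentiableAt]
  ext i
  have : Gi (fun X => pc (sB a Y X)) i X = (3 * max (sB a Y X) 0 ^ 2) * Gi (sB a Y) i X :=
    fderiv_comp1 (hasDerivAt_pc _) (hs.differentiable (by norm_num)).differentiableAt _
  simp [this, Gi_sB hY]
  ring

lemma barrier_pt {ν Λ κ γ : ℝ} (hν : 0 < ν) (hY : ContDiff ℝ 2 Y) {X : En n × ℝ}
    (hT : Tt Y X = 0) {A : Matrix (Fin n) (Fin n) ℝ} (hA : Ell ν A) (hκ : 0 < κ) (ha : 0 ≤ a)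
    (ht : 0 ≤ X.2) (hs : 0 < sB a Y X) (h1 : aH A Y X + γ * ‖Gr Y X‖ ≤ Λ)
    (h2 : κ * Y X ≤ ‖Gr Y X‖ ^ 2)
    (hq : (3 * a + 3 * Λ + 6 * ν⁻¹ * κ) ^ 2 ≤ 24 * ν⁻¹ * κ * q) :
    Tt (psiB q a Y) X - aH A (psiB q a Y) X ≤ - (γ * ‖Gr (psiB q a Y) X‖) := by
  have hsc := contDiff_sB (a := a) hY
  have hpcd : ContDiff ℝ 2 (fun X => pc (sB a Y X)) := contDiff_pc.comp hsc
  set σ := sB a Y X with hσ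
  set e := Real.exp (-q * X.2) with he
  have he0 : 0 < e := Real.exp_pos _
  have hmax : max σ 0 = σ := max_eq_left hs.le
  have eT : Tt (psiB q a Y) X = e * (3 * σ ^ 2 * a) - q * e * σ ^ 3 := by
    unfold psiB
    rw [Tt_time_mul ((exp_facts q).2 _) (hpcd.differentiable (by norm_num)).differentiableAt]
    have : Tt (fun X => pc (sB a Y X)) X = (3 * max (sB a Y X) 0 ^ 2) * Tt (sB a Y) X :=
      fderiv_comp1 (hasDerivAt_pc _) (hsc.differentiable (by norm_num)).differentiableAt _
    rw [this, Tt_sB hY X hT, ← hσ, hmax, ← he, pc, hmax]; ring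
  have eG : ‖Gr (psiB q a Y) X‖ = e * (3 * σ ^ 2) * ‖Gr Y X‖ := by
    rw [Gr_psiB hY, ← hσ, hmax, ← he, neg_smul, norm_neg, norm_smul, Real.norm_of_nonneg (by positivity)]
  have eH : aH A (psiB q a Y) X = e * (6 * σ * (∑ i, ∑ j, A i j * Gi Y i X * Gi Y j X)
      - 3 * σ ^ 2 * aH A Y X) := by
    have : ∀ i j, Hh (psiB q a Y) i j X = e * (6 * σ * (Gi Y i X * Gi Y j X) - 3 * σ ^ 2 * Hh Y i j X) := by
      intro i j
      unfold psiB
      rw [Hh_time_mul ((exp_facts q).1.differentiable (by norm_num)) hpcd,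
        Hh_comp1 hasDerivAt_pc hasDerivAt_pc1 hsc, Gi_sB hY, Gi_sB hY, Hh_sB hY, ← hσ, hmax]
      ring
    unfold aH
    simp only [this, Finset.mul_sum, ← Finset.sum_sub_distrib]
    refine Finset.sum_congr rfl fun i _ => Finset.sum_congr rfl fun j _ => ?_
    ring
  have hell := hA.1 (fun i => Gi Y i X)
  have hnorm : ‖Gr Y X‖ ^ 2 = ∑ i, Gi Y i X ^ 2 := by
    rw [EuclideanSpace.norm_sq_eq]; simp
  rw [← hnorm] at hell
  set P := ∑ i, ∑ j, A i j * Gi Y i X * Gi Y j X with hP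
  have hν' : 0 < ν⁻¹ := by positivity
  have hPκ : ν⁻¹ * (κ * (1 - σ)) ≤ P := by
    refine le_trans ?_ hell
    gcongr
    refine le_trans ?_ h2
    gcongr
    have : σ = (1 + a * X.2) + (-1) * Y X := rfl
    have := mul_nonneg ha ht
    linarith
  rw [eT, eH, eG]
  set B := 3 * a + 3 * Λ + 6 * ν⁻¹ * κ with hB
  have hquad : B * σ - q * σ ^ 2 - 6 * ν⁻¹ * κ ≤ 0 := by
    have hk : 0 < 24 * ν⁻¹ * κ := by positivity
    have h3 : B ^ 2 * σ ^ 2 ≤ 24 * ν⁻¹ * κ * q * σ ^ 2 := by gcongr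
    have : 24 * ν⁻¹ * κ * (B * σ - q * σ ^ 2 - 6 * ν⁻¹ * κ) ≤ 0 := by
      nlinarith [sq_nonneg (B * σ - 12 * ν⁻¹ * κ)]
    by_contra hc
    push Not at hc
    have := mul_pos hk hc
    linarith
  have key : 3 * σ * a - q * σ ^ 2 - 6 * P + 3 * σ * (aH A Y X + γ * ‖Gr Y X‖) ≤ 0 := by
    have := mul_le_mul_of_nonneg_left h1 (by positivity : 0 ≤ 3 * σ)
    have e1 : ν⁻¹ * (κ * (1 - σ)) = ν⁻¹ * κ - ν⁻¹ * κ * σ := by ring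
    rw [e1] at hPκ
    rw [hB] at hquad
    nlinarith
  have := mul_nonpos_of_nonneg_of_nonpos (mul_pos he0 hs).le key
  nlinarith

/-- ABP comparison with the barrier. -/
lemma barrier_abp (hn : 0 < n) {ν Λ κ S g : ℝ} (hν : 0 < ν) (hY : ContDiff ℝ 2 Y)
    {u : En n × ℝ → ℝ} {β γ : En n → ℝ} {R T : ℝ} (hu : ContDiff ℝ 2 u) (hβ : Drift β)
    (hR : 0 < R) (ha : 0 ≤ a) (hκ : 0 < κ) (hS0 : 0 ≤ S) (hg : 0 ≤ g) (hT0 : 0 ≤ T)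
    (hq : (3 * a + 3 * Λ + 6 * ν⁻¹ * κ) ^ 2 ≤ 24 * ν⁻¹ * κ * q)
    (hYT : ∀ X, Tt Y X = 0) (hY0 : ∀ X, 0 ≤ Y X)
    (hYH : ∀ X ∈ cyl 0 R 0 T, ∀ A, Ell ν A → aH A Y X + γ X.1 * ‖Gr Y X‖ ≤ Λ)
    (hYG : ∀ X ∈ cyl 0 R 0 T, κ * Y X ≤ ‖Gr Y X‖ ^ 2)
    (hYlat : ∀ (x : En n) (t : ℝ), ‖x‖ = R → 0 ≤ t → t ≤ T → 1 + a * T ≤ Y (x, t))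
    (hY1 : ∀ x : En n, 1 ≤ ‖x‖ → ‖x‖ ≤ R → 1 ≤ Y (x, 0))
    (hγ : ∀ X ∈ cyl 0 R 0 T, β X.1 * ‖Gr (psiB q a Y) X‖ ≤ γ X.1 * ‖Gr (psiB q a Y) X‖ + β X.1 * g)
    (hS : Dr β 0 R ≤ ENNReal.ofReal S)
    (hsup : ∀ X ∈ cyl 0 R 0 T, SupAt ν β u X) (hu0 : ∀ X ∈ cyl 0 R 0 T, 0 ≤ u X)
    (hu1 : ∀ x : En n, ‖x‖ ≤ 1 → ‖x‖ ≤ R → 1 ≤ u (x, 0)) {η : ℝ} (hη : 0 < η) {J : ℕ}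
    (hJ : C0 n ν * (2 + 4 * R * 2 ^ J * g / η) ^ n * S < J) :
    ∀ X ∈ cyl 0 R 0 T, psiB q a Y X - u X ≤ η := by
  intro X1 hX1
  by_contra hcon
  push Not at hcon
  have hψ := contDiff_psiB (q := q) (a := a) hY
  let w : En n × ℝ → ℝ := fun X => psiB q a Y X + (-1) * u X
  have hmu : ContDiff ℝ 2 (fun X => (-1:ℝ) * u X) := contDiff_const.mul hu
  have hw : ContDiff ℝ 2 w := hψ.add hmu
  obtain ⟨X0, hX0, hmax⟩ := exists_max_cyl hw.continuous hX1
  set M := w X0 with hM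
  have hMη : η < M := by
    have := hmax _ hX1
    have e : w X1 = psiB q a Y X1 - u X1 := by simp only [w]; ring
    linarith
  have hM0 : 0 < M := hη.trans hMη
  have hpsi0 : ∀ X, sB a Y X ≤ 0 → psiB q a Y X = 0 := by
    intro X h
    simp [psiB, pc, max_eq_right h]
  have key := abp hn hν hw (R := R) (T := T) (M := M) (g := g) (f := 0)
    (μ := M / (4 * R * 2 ^ J)) (S := S) (V := R ^ n * om n * (T - 0)) (β := β) (J := J) hR hg le_rfl
    (by positivity) hβ.2 hβ.1 ?_ ?_ ?_ hmax hX0 hM.symm hM0 ?_ hS0 hS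
    (by have := om_pos n; have : 0 ≤ T - 0 := by linarith
        positivity) ?_
  · rw [zero_pow (by omega : n + 1 ≠ 0), mul_zero, zero_mul, add_zero] at key
    have e1 : g / (M / (4 * R * 2 ^ J)) ≤ 4 * R * 2 ^ J * g / η := by
      rw [div_div_eq_mul_div, mul_comm g]
      gcongr
    have hC := C0_pos (n := n) hν
    have e2 : C0 n ν * ((2 + g / (M / (4 * R * 2 ^ J))) ^ n * M * S) ≤
        (C0 n ν * (2 + 4 * R * 2 ^ J * g / η) ^ n * S) * M := by
      have : (2 + g / (M / (4 * R * 2 ^ J))) ^ n ≤ (2 + 4 * R * 2 ^ J * g / η) ^ n := by gcongr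
      calc _ ≤ C0 n ν * ((2 + 4 * R * 2 ^ J * g / η) ^ n * M * S) := by gcongr
        _ = _ := by ring
    have e3 := mul_lt_mul_of_pos_right hJ hM0
    linarith
  · intro x hx
    by_cases h1 : ‖x‖ ≤ 1
    · have h2 := hu1 x h1 hx
      have h3 : psiB q a Y (x, 0) ≤ 1 := by
        simp only [psiB, pc, sB]
        have : max (1 + a * 0 + -1 * Y (x, 0)) 0 ≤ 1 := by
          apply max_le _ zero_le_one
          have := hY0 (x, 0); linarith
        have h0 : 0 ≤ max (1 + a * 0 + -1 * Y (x, 0)) 0 := le_max_right _ _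
        simp only [mul_zero, Real.exp_zero, one_mul]
        apply pow_le_one₀
        · simp
        · simpa using this
      simp only [w]; linarith
    · push Not at h1
      have := hY1 x h1.le hx
      have h2 := hpsi0 (x, 0) (by simp only [sB]; linarith)
      have h3 := hu0 (x, 0) (mem_cyl.2 ⟨by simpa using hx, le_rfl, hT0⟩)
      simp only [w, h2]; linarith
  · intro x t hx ht0 htT
    have := hYlat x t hx ht0 htT
    have h2 := hpsi0 (x, t) (by
      simp only [sB]
      have := mul_le_mul_of_nonneg_left htT ha
      linarith)
    have h3 := hu0 (x, t) (mem_cyl.2 ⟨by simpa using hx.le, ht0, htT⟩)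
    simp only [w, h2]; linarith
  · intro X hX hwX
    have hs : 0 < sB a Y X := by
      by_contra hc
      push Not at hc
      have h2 := hpsi0 X hc
      have h3 := hu0 X hX
      simp only [w, h2] at hwX; linarith
    obtain ⟨A, hA, h⟩ := (supAt_iff hu).1 (hsup X hX)
    refine ⟨A, hA, ?_⟩
    have hb := barrier_pt (q := q) hν hY (hYT X) hA hκ ha (mem_cyl.1 hX).2.1 hs (hYH X hX A hA) (hYG X hX) hq
    have eT : Tt w X = Tt (psiB q a Y) X - Tt u X := by
      rw [Tt_add hψ hmu, Tt_const_mul _ hu]; ring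
    have eH : aH A w X = aH A (psiB q a Y) X - aH A u X := by
      rw [aH_add hψ hmu, aH_const_mul _ hu]; ring
    have eG : Gr w X = Gr (psiB q a Y) X - Gr u X := by
      rw [Gr_add hψ hmu, Gr_const_mul _ hu]; simp [sub_eq_add_neg]
    have h4 : ‖Gr u X‖ ≤ ‖Gr w X‖ + ‖Gr (psiB q a Y) X‖ := by
      have : Gr u X = - Gr w X + Gr (psiB q a Y) X := by rw [eG]; abel
      rw [this]
      refine (norm_add_le _ _).trans ?_
      rw [norm_neg]
    have h5 := mul_le_mul_of_nonneg_left h4 (hβ.2 X.1)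
    have h6 := hγ X hX
    rw [eT, eH]; nlinarith
  · apply le_of_eq; field_simp
  · refine (measure_mono (sep_subset _ _)).trans (le_of_eq ?_)
    rw [vol_cyl_le _ hR hT0]

end barrier

def USpread (n : ℕ) (ν ε c R τ T D : ℝ) : Prop :=
  ∀ (u : En n × ℝ → ℝ) (β : En n → ℝ), ContDiff ℝ 2 u → Drift β → Dr β 0 R ≤ ENNReal.ofReal ε →
    (∀ X ∈ cyl 0 R 0 T, SupAt ν β u X) → (∀ X ∈ cyl 0 R 0 T, 0 ≤ u X) →
    (∀ x : En n, ‖x‖ ≤ 1 → 1 ≤ u (x, 0)) →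
    ∀ (x : En n) (t : ℝ), ‖x‖ ≤ D → τ ≤ t → t ≤ T → c ≤ u (x, t)

def Spread (n : ℕ) (ν ε c R τ T D : ℝ) : Prop :=
  ∀ (u : En n × ℝ → ℝ) (β : En n → ℝ) (z : En n) (ρ t₀ m : ℝ), ContDiff ℝ 2 u → Drift β →
    0 < ρ → 0 ≤ m → Dr β z (R * ρ) ≤ ENNReal.ofReal ε →
    (∀ X ∈ cyl z (R * ρ) t₀ (t₀ + T * ρ ^ 2), SupAt ν β u X) →
    (∀ X ∈ cyl z (R * ρ) t₀ (t₀ + T * ρ ^ 2), 0 ≤ u X) →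
    (∀ x : En n, ‖x - z‖ ≤ ρ → m ≤ u (x, t₀)) →
    ∀ (x : En n) (t : ℝ), ‖x - z‖ ≤ D * ρ → t₀ + τ * ρ ^ 2 ≤ t → t ≤ t₀ + T * ρ ^ 2 → c * m ≤ u (x, t)

lemma USpread.scale {ν ε c R τ T D : ℝ} (hτ : 0 ≤ τ) (hDR : D ≤ R) (H : USpread n ν ε c R τ T D) :
    Spread n ν ε c R τ T D := by
  intro u β z ρ t₀ m hu hβ hρ hm hS hsup hu0 hu1 x t hx ht1 ht2
  have hmem : ∀ X ∈ cyl (0 : En n) R 0 T, smap z t₀ ρ X ∈ cyl z (R * ρ) t₀ (t₀ + T * ρ ^ 2) := by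
    intro X hX
    have := smap_mem (z := z) (t₀ := t₀) hρ hX
    simpa [mul_comm] using this
  rcases hm.eq_or_lt with h0 | hm0
  · rw [← h0, mul_zero]
    refine hu0 _ (mem_cyl.2 ⟨hx.trans (by gcongr), ?_, ht2⟩)
    have : 0 ≤ τ * ρ ^ 2 := by positivity
    simp only; linarith
  have hus : ContDiff ℝ 2 (fun Y => u (smap z t₀ ρ Y)) := contDiff_comp_smap hu
  have := H (fun Y => m⁻¹ * u (smap z t₀ ρ Y)) (bsc β z ρ) (contDiff_const.mul hus)
    (hβ.bsc z hρ.le) (by rw [Dr_bsc z hρ]; simpa [mul_comm] using hS)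
    (fun X hX => SupAt.const_mul hus (SupAt.smap hu hρ.le (hsup _ (hmem X hX))) (by positivity))
    (fun X hX => mul_nonneg (by positivity) (hu0 _ (hmem X hX)))
    ?_ (ρ⁻¹ • (x - z)) ((t - t₀) / ρ ^ 2) ?_ ?_ ?_
  · rw [smap_inv (z := z) (t₀ := t₀) hρ (x, t)] at this
    rwa [inv_mul_eq_div, le_div_iff₀ hm0] at this
  · intro y hy
    have h := hu1 (z + ρ • y) (by
      rw [add_sub_cancel_left, norm_smul, Real.norm_of_nonneg hρ.le]
      nlinarith)
    rw [inv_mul_eq_div, le_div_iff₀ hm0, one_mul]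
    simpa [smap] using h
  · rw [norm_smul, norm_inv, Real.norm_of_nonneg hρ.le, inv_mul_le_iff₀ hρ]; linarith
  · rw [le_div_iff₀ (by positivity)]; linarith
  · rw [div_le_iff₀ (by positivity)]; linarith

lemma psiB_lower {a q τ T D : ℝ} {Y : En n × ℝ → ℝ} (hq : 0 ≤ q) {X : En n × ℝ}
    (hs : 1 ≤ sB a Y X) (ht : X.2 ≤ T) : Real.exp (-q * T) ≤ psiB q a Y X := by
  have h1 : 1 ≤ pc (sB a Y X) := by
    unfold pc
    exact one_le_pow₀ (hs.trans (le_max_left _ _))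
  have h2 : Real.exp (-q * T) ≤ Real.exp (-q * X.2) := by
    apply Real.exp_le_exp.2
    nlinarith
  unfold psiB
  calc Real.exp (-q * T) = Real.exp (-q * T) * 1 := by ring
    _ ≤ _ := by gcongr

theorem spread_small (hn : 0 < n) {ν : ℝ} (hν : 0 < ν) {τ T D : ℝ} (hτ : 0 < τ) (hτT : τ ≤ T)
    (hD : 1 ≤ D) : ∃ ε c R : ℝ, 0 < ε ∧ 0 < c ∧ c ≤ 1 ∧ D ≤ R ∧ Spread n ν ε c R τ T D := by
  have hC := C0_pos (n := n) hν
  set a := D ^ 2 / τ with ha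
  have ha0 : 0 ≤ a := by positivity
  have hT0 : 0 < T := by linarith
  have haT : D ^ 2 ≤ a * T := by
    rw [ha, div_mul_eq_mul_div, le_div_iff₀ hτ]; gcongr
  set R := Real.sqrt (1 + a * T) with hRdef
  have hR2 : R ^ 2 = 1 + a * T := Real.sq_sqrt (by positivity)
  have hDR : D ≤ R := by
    apply Real.le_sqrt_of_sq_le; linarith
  have hR0 : 0 < R := by linarith
  set q := (3 * a + 3 * (2 * (n * ν)) + 6 * ν⁻¹ * 4) ^ 2 / (24 * ν⁻¹ * 4) with hq
  have hq0 : 0 ≤ q := by positivity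
  have hqe : (3 * a + 3 * (2 * (n * ν)) + 6 * ν⁻¹ * 4) ^ 2 ≤ 24 * ν⁻¹ * 4 * q := by
    rw [hq]; apply le_of_eq; field_simp
  set η := Real.exp (-q * T) / 2 with hη
  have hη0 : 0 < η := by positivity
  set g := 6 * R ^ 5 with hg
  set B := C0 n ν * (2 + 4 * R * 2 ^ 1 * g / η) ^ n with hB
  have hB0 : 0 < B := by positivity
  refine ⟨1 / (2 * B), η, R, by positivity, hη0, ?_, hDR, USpread.scale hτ.le hDR ?_⟩
  · have : Real.exp (-q * T) ≤ 1 := by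
      apply Real.exp_le_one_iff.2; nlinarith
    linarith
  intro u β hu hβ hS hsup hu0 hu1 x t hx ht1 ht2
  have hY : ContDiff ℝ 2 (fun X : En n × ℝ => ‖X.1‖ ^ 2) := contDiff_nsq
  have hGn : ∀ X : En n × ℝ, ‖Gr (fun X : En n × ℝ => ‖X.1‖ ^ 2) X‖ = 2 * ‖X.1‖ := by
    intro X; rw [Gr_nsq, norm_smul]; norm_num
  have key := barrier_abp (a := a) (q := q) hn hν (Λ := 2 * (n * ν)) (κ := 4) (S := 1 / (2 * B)) (g := g)
    (γ := fun _ => 0) (R := R) (T := T) hY hu hβ hR0 ha0 (by norm_num) (by positivity) (by positivity)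
    hT0.le hqe Tt_nsq (fun X => by positivity) ?_ ?_ ?_ ?_ ?_ hS hsup hu0 (fun x hx _ => hu1 x hx) hη0
    (J := 1) ?_ (x, t) (mem_cyl.2 ⟨by simpa using hx.trans hDR, by simp only; linarith, ht2⟩)
  · have hl := psiB_lower (a := a) (q := q) (τ := τ) (D := D) (T := T) (Y := fun X : En n × ℝ => ‖X.1‖ ^ 2)
      (X := (x, t)) hq0 ?_ ht2
    · linarith
    · simp only [sB]
      have h1 : ‖x‖ ^ 2 ≤ D ^ 2 := by gcongr
      have h2 : D ^ 2 ≤ a * t := by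
        rw [ha, div_mul_eq_mul_div, le_div_iff₀ hτ]; gcongr
      linarith
  · intro X hX A hA
    rw [aH_nsq]
    have := hA.trace_le hν.le
    linarith
  · intro X hX
    rw [hGn]; apply le_of_eq; ring
  · intro x t hx _ _
    simp only [hx, hR2]; exact le_rfl
  · intro x hx _
    exact one_le_pow₀ hx
  · intro X hX
    have hX' := mem_cyl.1 hX
    rw [sub_zero] at hX'
    have : ‖Gr (psiB q a (fun X : En n × ℝ => ‖X.1‖ ^ 2)) X‖ ≤ g := by
      rw [Gr_psiB hY, norm_smul, hGn, norm_neg, Real.norm_of_nonneg (by positivity)]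
      have h1 : Real.exp (-q * X.2) ≤ 1 := by
        apply Real.exp_le_one_iff.2; nlinarith [hX'.2.1]
      have h2 : max (sB a (fun X : En n × ℝ => ‖X.1‖ ^ 2) X) 0 ≤ R ^ 2 := by
        apply max_le _ (by positivity)
        simp only [sB]
        have := mul_le_mul_of_nonneg_left hX'.2.2 ha0
        have := sq_nonneg ‖X.1‖
        linarith
      calc _ ≤ 1 * (3 * (R ^ 2) ^ 2) * (2 * R) := by
            gcongr
            exact hX'.1
        _ = g := by rw [hg]; ring
    have := mul_le_mul_of_nonneg_left this (hβ.2 X.1)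
    linarith
  · rw [← hB]
    push_cast
    have : B * (1 / (2 * B)) = 1 / 2 := by field_simp
    linarith

end Hk

namespace Hk

section oneD

lemma glue_deriv {f g f' g' : ℝ → ℝ} (hf : ∀ x, HasDerivAt f (f' x) x) (hg : ∀ x, HasDerivAt g (g' x) x)
    (h0 : f 0 = g 0) (h1 : f' 0 = g' 0) (x : ℝ) :
    HasDerivAt (fun x => if 0 ≤ x then f x else g x) (if 0 ≤ x then f' x else g' x) x := by
  rcases lt_trichotomy x 0 with h | h | h
  · rw [if_neg (not_le.2 h)]
    refine (hg x).congr_of_eventuallyEq ?_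
    filter_upwards [Iio_mem_nhds h] with y hy
    rw [if_neg (not_le.2 hy)]
  · subst h
    rw [if_pos le_rfl]
    have a1 : HasDerivWithinAt (fun x => if 0 ≤ x then f x else g x) (f' 0) (Ici 0) 0 :=
      (hf 0).hasDerivWithinAt.congr (fun y hy => if_pos hy) (if_pos le_rfl)
    have a2 : HasDerivWithinAt (fun x => if 0 ≤ x then f x else g x) (f' 0) (Iic 0) 0 := by
      rw [h1]
      refine (hg 0).hasDerivWithinAt.congr (fun y hy => ?_) (by simp [h0])
      rcases (show y ≤ 0 from hy).eq_or_lt with h | h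
      · simp [h, h0]
      · rw [if_neg (not_le.2 h)]
    have := a2.union a1
    rwa [Iic_union_Ici, hasDerivWithinAt_univ] at this
  · rw [if_pos h.le]
    refine (hf x).congr_of_eventuallyEq ?_
    filter_upwards [Ioi_mem_nhds h] with y hy
    rw [if_pos (le_of_lt hy)]

def Bf (b : ℝ → ℝ) (x : ℝ) : ℝ := ∫ s in (0:ℝ)..x, b s
def Pf (b : ℝ → ℝ) (x : ℝ) : ℝ := Real.exp (- Bf b x) * ∫ s in (0:ℝ)..x, Real.exp (Bf b s)
def Yf (b : ℝ → ℝ) (x : ℝ) : ℝ := ∫ s in (0:ℝ)..x, Pf b s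

variable {b : ℝ → ℝ}

lemma hasDerivAt_Bf (hb : Continuous b) (x : ℝ) : HasDerivAt (Bf b) (b x) x :=
  (hb.integral_hasStrictDerivAt 0 x).hasDerivAt

lemma continuous_Bf (hb : Continuous b) : Continuous (Bf b) :=
  continuous_iff_continuousAt.2 fun x => (hasDerivAt_Bf hb x).continuousAt

lemma hasDerivAt_Pf (hb : Continuous b) (x : ℝ) : HasDerivAt (Pf b) (1 - b x * Pf b x) x := by
  have hc : Continuous (fun s => Real.exp (Bf b s)) := Real.continuous_exp.comp (continuous_Bf hb)
  have h1 := (hc.integral_hasStrictDerivAt 0 x).hasDerivAt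
  have h2 := (hasDerivAt_Bf hb x).neg.exp
  have h3 := h2.mul h1
  have e : 1 - b x * Pf b x = Real.exp (-Bf b x) * -b x * (∫ s in (0:ℝ)..x, Real.exp (Bf b s)) +
      Real.exp (-Bf b x) * Real.exp (Bf b x) := by
    rw [← Real.exp_add, neg_add_cancel, Real.exp_zero]; unfold Pf; ring
  rw [e]
  exact h3

lemma continuous_Pf (hb : Continuous b) : Continuous (Pf b) :=
  continuous_iff_continuousAt.2 fun x => (hasDerivAt_Pf hb x).continuousAt

lemma hasDerivAt_Yf (hb : Continuous b) (x : ℝ) : HasDerivAt (Yf b) (Pf b x) x :=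
  ((continuous_Pf hb).integral_hasStrictDerivAt 0 x).hasDerivAt

lemma Pf_bounds (hb : Continuous b) (hb0 : ∀ x, 0 ≤ b x) {x : ℝ} (hx : 0 ≤ x) :
    Real.exp (- Bf b x) * x ≤ Pf b x ∧ Pf b x ≤ x := by
  have hc : Continuous (fun s => Real.exp (Bf b s)) := Real.continuous_exp.comp (continuous_Bf hb)
  have h0 : ∀ y, 0 ≤ y → 0 ≤ Bf b y := fun y hy => intervalIntegral.integral_nonneg hy fun s _ => hb0 s
  have h1 : ∀ y, y ≤ x → Bf b y ≤ Bf b x := by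
    intro y hy
    have : Bf b x - Bf b y = ∫ s in y..x, b s :=
      intervalIntegral.integral_interval_sub_left (hb.intervalIntegrable _ _) (hb.intervalIntegrable _ _)
    have h2 := intervalIntegral.integral_nonneg hy (μ := volume) fun s _ => hb0 s
    linarith
  constructor
  · unfold Pf
    gcongr
    calc x = ∫ s in (0:ℝ)..x, (1:ℝ) := by simp
      _ ≤ _ := intervalIntegral.integral_mono_on hx (by simp) (hc.intervalIntegrable _ _)
        fun s hs => Real.one_le_exp (h0 s hs.1)
  · unfold Pf
    rw [Real.exp_neg, inv_mul_le_iff₀ (Real.exp_pos _)]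
    calc _ ≤ ∫ s in (0:ℝ)..x, Real.exp (Bf b x) :=
        intervalIntegral.integral_mono_on hx (hc.intervalIntegrable _ _) (by simp)
          fun s hs => Real.exp_le_exp.2 (h1 s hs.2)
      _ = _ := by simp [mul_comm]

lemma Pf_nonneg {x : ℝ} (hx : 0 ≤ x) : 0 ≤ Pf b x :=
  mul_nonneg (Real.exp_pos _).le (intervalIntegral.integral_nonneg hx fun s _ => (Real.exp_pos _).le)

lemma Yf_nonneg {x : ℝ} (hx : 0 ≤ x) : 0 ≤ Yf b x :=
  intervalIntegral.integral_nonneg hx fun s hs => Pf_nonneg hs.1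

lemma Yf_bounds (hb : Continuous b) (hb0 : ∀ x, 0 ≤ b x) {x k : ℝ} (hx : 0 ≤ x)
    (hk : Bf b x ≤ k) :
    Real.exp (- k) * (x ^ 2 / 2) ≤ Yf b x ∧ Yf b x ≤ x ^ 2 / 2 := by
  have e : (∫ s in (0:ℝ)..x, s) = x ^ 2 / 2 := by simp
  have h1 : ∀ y, y ≤ x → Bf b y ≤ Bf b x := by
    intro y hy
    have : Bf b x - Bf b y = ∫ s in y..x, b s :=
      intervalIntegral.integral_interval_sub_left (hb.intervalIntegrable _ _) (hb.intervalIntegrable _ _)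
    have h2 := intervalIntegral.integral_nonneg hy (μ := volume) fun s _ => hb0 s
    linarith
  constructor
  · rw [← e, ← intervalIntegral.integral_const_mul]
    refine intervalIntegral.integral_mono_on hx (Continuous.intervalIntegrable (by fun_prop) _ _)
      ((continuous_Pf hb).intervalIntegrable _ _) fun s hs => ?_
    refine le_trans ?_ (Pf_bounds hb hb0 hs.1).1
    have := hs.1
    gcongr
    exact (h1 s hs.2).trans hk
  · rw [← e]
    exact intervalIntegral.integral_mono_on hx ((continuous_Pf hb).intervalIntegrable _ _)
      (Continuous.intervalIntegrable (by fun_prop) _ _) fun s hs => (Pf_bounds hb hb0 hs.1).2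

def Y1 (b : ℝ → ℝ) (x : ℝ) : ℝ := if 0 ≤ x then Yf b x else Yf (fun s => b (-s)) (-x)
def P1 (b : ℝ → ℝ) (x : ℝ) : ℝ := if 0 ≤ x then Pf b x else - Pf (fun s => b (-s)) (-x)

lemma hasDerivAt_Y1 (hb : Continuous b) (x : ℝ) : HasDerivAt (Y1 b) (P1 b x) x := by
  have hb' : Continuous (fun s => b (-s)) := hb.comp continuous_neg
  refine glue_deriv (hasDerivAt_Yf hb) (g := fun x => Yf (fun s => b (-s)) (-x))
    (g' := fun x => - Pf (fun s => b (-s)) (-x)) (fun x => ?_) ?_ ?_ x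
  · have h4 : HasDerivAt (fun x => Yf (fun s => b (-s)) (-x)) _ x :=
      (hasDerivAt_Yf hb' (-x)).comp x (hasDerivAt_neg x)
    convert h4 using 1
    ring
  · simp [Yf]
  · simp [Pf]

lemma hasDerivAt_P1 (hb : Continuous b) (x : ℝ) :
    HasDerivAt (P1 b) (1 - b x * |P1 b x|) x := by
  have hb' : Continuous (fun s => b (-s)) := hb.comp continuous_neg
  have h := glue_deriv (hasDerivAt_Pf hb) (g := fun x => - Pf (fun s => b (-s)) (-x))
    (g' := fun x => 1 - b x * Pf (fun s => b (-s)) (-x)) (fun x => ?_) ?_ ?_ x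
  · have e : 1 - b x * |P1 b x| =
        if 0 ≤ x then 1 - b x * Pf b x else 1 - b x * Pf (fun s => b (-s)) (-x) := by
      unfold P1
      by_cases hx : 0 ≤ x
      · rw [if_pos hx, if_pos hx, abs_of_nonneg (Pf_nonneg hx)]
      · rw [if_neg hx, if_neg hx, abs_neg, abs_of_nonneg (Pf_nonneg (by linarith [not_le.1 hx]))]
    rw [e]; exact h
  · have h4 : HasDerivAt (fun x => - Pf (fun s => b (-s)) (-x)) _ x :=
      ((hasDerivAt_Pf hb' (-x)).comp x (hasDerivAt_neg x)).neg
    convert h4 using 1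
    rw [neg_neg]; ring
  · simp [Pf]
  · simp [Pf]

lemma continuous_P1 (hb : Continuous b) : Continuous (P1 b) :=
  continuous_iff_continuousAt.2 fun x => (hasDerivAt_P1 hb x).continuousAt

lemma contDiff_Y1 (hb : Continuous b) : ContDiff ℝ 2 (Y1 b) := by
  have h1 : ContDiff ℝ 1 (P1 b) := by
    rw [contDiff_one_iff_deriv]
    refine ⟨fun s => (hasDerivAt_P1 hb s).differentiableAt, ?_⟩
    have : deriv (P1 b) = fun x => 1 - b x * |P1 b x| := funext fun s => (hasDerivAt_P1 hb s).deriv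
    rw [this]
    have := continuous_P1 hb
    fun_prop
  have : (2 : WithTop ℕ∞) = 1 + 1 := by norm_num
  rw [this, contDiff_succ_iff_deriv]
  refine ⟨fun s => (hasDerivAt_Y1 hb s).differentiableAt, by simp, ?_⟩
  have : deriv (Y1 b) = P1 b := funext fun s => (hasDerivAt_Y1 hb s).deriv
  rw [this]; exact h1

lemma Y1_nonneg (x : ℝ) : 0 ≤ Y1 b x := by
  unfold Y1
  split_ifs with h
  · exact Yf_nonneg h
  · exact Yf_nonneg (by linarith [not_le.1 h])

/-- main 1D bounds -/
lemma oneD_bounds (hb : Continuous b) (hb0 : ∀ x, 0 ≤ b x) {x k : ℝ}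
    (h1 : Bf b |x| ≤ k) (h2 : Bf (fun s => b (-s)) |x| ≤ k) :
    Real.exp (-k) * (x ^ 2 / 2) ≤ Y1 b x ∧ Y1 b x ≤ x ^ 2 / 2 ∧ Real.exp (-k) * |x| ≤ |P1 b x| := by
  have hb' : Continuous (fun s => b (-s)) := hb.comp continuous_neg
  unfold Y1 P1
  split_ifs with h
  · rw [abs_of_nonneg h] at h1 ⊢
    refine ⟨(Yf_bounds hb hb0 h h1).1, (Yf_bounds hb hb0 h h1).2, ?_⟩
    rw [abs_of_nonneg (Pf_nonneg h)]
    refine le_trans ?_ (Pf_bounds hb hb0 h).1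
    gcongr
  · have h' : 0 ≤ -x := by linarith [not_le.1 h]
    have e : |x| = -x := abs_of_nonpos (by linarith)
    rw [e] at h2 ⊢
    have := Yf_bounds hb' (fun s => hb0 _) h' h2
    rw [neg_sq] at this
    refine ⟨this.1, this.2, ?_⟩
    rw [abs_neg, abs_of_nonneg (Pf_nonneg h')]
    refine le_trans ?_ (Pf_bounds hb' (fun s => hb0 _) h').1
    gcongr

lemma Dr_one {β : En 1 → ℝ} (hβ : Drift β) {R S x : ℝ} (hS0 : 0 ≤ S) (hx : 0 ≤ x) (hxR : x ≤ R)
    (hS : Dr β 0 R ≤ ENNReal.ofReal S) (v : En 1) (hv : ‖v‖ = 1) :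
    ∫ s in (0:ℝ)..x, β (s • v) ≤ S := by
  have hc : Continuous (fun s : ℝ => β (s • v)) := hβ.1.comp (by fun_prop)
  let e : ℝ ≃ₗᵢ[ℝ] En 1 := (LinearIsometry.toSpanSingleton ℝ (En 1) hv).toLinearIsometryEquiv (by simp)
  have he : ∀ s, e s = s • v := fun s => rfl
  have hpres := e.measurePreserving
  rw [intervalIntegral.integral_of_le hx, integral_eq_lintegral_of_nonneg_ae
    (Filter.Eventually.of_forall fun s => hβ.2 _) hc.aestronglyMeasurable]
  apply ENNReal.toReal_le_of_le_ofReal hS0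
  refine le_trans ?_ hS
  unfold Dr
  rw [← hpres.setLIntegral_comp_preimage measurableSet_closedBall
    (by have := hβ.1.measurable; fun_prop)]
  simp only [he, pow_one]
  apply lintegral_mono_set
  intro s hs
  have : e s ∈ closedBall (0 : En 1) R := by
    rw [mem_closedBall_zero_iff, e.norm_map, Real.norm_of_nonneg hs.1.le]
    exact hs.2.trans hxR
  exact this

lemma vec_one (x : En 1) : x = x 0 • (EuclideanSpace.single 0 (1:ℝ)) := by
  ext i; fin_cases i; simp

lemma norm_one (x : En 1) : ‖x‖ = |x 0| := by
  rw [EuclideanSpace.norm_eq]; simp [Real.sqrt_sq_eq_abs]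

lemma oneD_calc {F F1 F2 : ℝ → ℝ} (hF : ∀ r, HasDerivAt F (F1 r) r)
    (hF1 : ∀ r, HasDerivAt F1 (F2 r) r) (X : En 1 × ℝ) :
    Tt (fun X : En 1 × ℝ => F (X.1 0)) X = 0 ∧
    ‖Gr (fun X : En 1 × ℝ => F (X.1 0)) X‖ = |F1 (X.1 0)| ∧
    ∀ A : Matrix (Fin 1) (Fin 1) ℝ, aH A (fun X : En 1 × ℝ => F (X.1 0)) X = A 0 0 * F2 (X.1 0) := by
  let L : En 1 × ℝ →L[ℝ] ℝ := (EuclideanSpace.proj (0 : Fin 1)).comp (ContinuousLinearMap.fst ℝ (En 1) ℝ)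
  let s : En 1 × ℝ → ℝ := fun X => L X
  have hs : ContDiff ℝ 2 s := L.contDiff
  have hfd : ∀ X, fderiv ℝ s X = L := fun X => L.fderiv
  have hG : ∀ i X, Gi s i X = 1 := by
    intro i X; unfold Gi; rw [hfd]; fin_cases i; simp [L, ex]
  have hH : ∀ i j X, Hh s i j X = 0 := by
    intro i j X
    have : Gi s j = fun _ => 1 := funext fun X => hG j X
    unfold Hh; rw [this]; simp
  have hd : DifferentiableAt ℝ s X := (hs.differentiable (by norm_num)).differentiableAt
  have e1 : Tt (fun X => F (s X)) X = F1 (s X) * Tt s X := fderiv_comp1 (hF _) hd _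
  have e2 : Gi (fun X => F (s X)) 0 X = F1 (s X) * Gi s 0 X := fderiv_comp1 (hF _) hd _
  refine ⟨?_, ?_, ?_⟩
  · refine e1.trans ?_
    unfold Tt; rw [hfd]; simp [L]
  · rw [norm_one]
    rw [hG, mul_one] at e2
    exact congrArg abs e2
  · intro A
    have := Hh_comp1 hF hF1 hs 0 0 X
    rw [hG, hH] at this
    unfold aH
    simp only [Finset.univ_unique, Fin.default_eq_zero, Finset.sum_singleton]
    congr 1
    refine this.trans ?_
    simp [s, L]

lemma oneD_aux {A w ν μ : ℝ} (hν : 0 ≤ ν) (hμ : 0 ≤ μ) (hw : 0 ≤ w) (h1 : μ ≤ A) (h2 : A ≤ ν) :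
    A * (1 - w) + μ * w ≤ ν + μ := by
  rcases le_total w 1 with h | h
  · have h3 : A * (1 - w) ≤ ν * (1 - w) := mul_le_mul_of_nonneg_right h2 (by linarith)
    have h4 : μ * w ≤ μ * 1 := mul_le_mul_of_nonneg_left h hμ
    have h5 : 0 ≤ ν * w := mul_nonneg hν hw
    linarith
  · have h3 : μ * (w - 1) ≤ A * (w - 1) := mul_le_mul_of_nonneg_right h1 (by linarith)
    linarith

set_option maxHeartbeats 1000000 in
theorem spread_one {ν : ℝ} (hν : 0 < ν) {S τ T D : ℝ} (hS0 : 0 ≤ S) (hτ : 0 < τ) (hτT : τ ≤ T)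
    (hD : 1 ≤ D) : ∃ c R : ℝ, 0 < c ∧ c ≤ 1 ∧ D ≤ R ∧ Spread 1 ν S c R τ T D := by
  have hC := C0_pos (n := 1) hν
  set k := ν * S with hk
  set C := 2 * Real.exp k with hCd
  have hC2 : 2 ≤ C := by
    have := Real.one_le_exp (show 0 ≤ k by positivity)
    linarith
  set a := C * D ^ 2 / τ with ha
  have ha0 : 0 ≤ a := by positivity
  have hT0 : 0 < T := by linarith
  have haτ : a * τ = C * D ^ 2 := by rw [ha]; field_simp
  have haT : C * D ^ 2 ≤ a * T := by
    rw [← haτ]; gcongr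
  have hCD : D ^ 2 ≤ C * D ^ 2 := by nlinarith [sq_nonneg D]
  set R := Real.sqrt (1 + a * T) with hRdef
  have hR2 : R ^ 2 = 1 + a * T := Real.sq_sqrt (by positivity)
  have hDR : D ≤ R := by
    apply Real.le_sqrt_of_sq_le; linarith
  have hR0 : 0 < R := by linarith
  set κ := 4 * Real.exp (-k) with hκ
  have hκ0 : 0 < κ := by positivity
  set Λ := C * (ν + ν⁻¹) with hΛ
  set q := (3 * a + 3 * Λ + 6 * ν⁻¹ * κ) ^ 2 / (24 * ν⁻¹ * κ) with hq
  have hq0 : 0 ≤ q := by positivity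
  have hqe : (3 * a + 3 * Λ + 6 * ν⁻¹ * κ) ^ 2 ≤ 24 * ν⁻¹ * κ * q := by
    rw [hq]; apply le_of_eq; field_simp
  set η := Real.exp (-q * T) / 2 with hη
  have hη0 : 0 < η := by positivity
  obtain ⟨J, hJ⟩ := exists_nat_gt (C0 1 ν * 2 ^ 1 * S)
  refine ⟨η, R, hη0, ?_, hDR, USpread.scale hτ.le hDR ?_⟩
  · have : Real.exp (-q * T) ≤ 1 := by
      apply Real.exp_le_one_iff.2; nlinarith
    linarith
  intro u β hu hβ hS hsup hu0 hu1 x t hx ht1 ht2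
  let v : En 1 := EuclideanSpace.single 0 1
  have hv : ‖v‖ = 1 := by simp [v]
  let b : ℝ → ℝ := fun s => ν * β (s • v)
  have hb : Continuous b := by
    have := hβ.1
    unfold b; fun_prop
  have hb0 : ∀ s, 0 ≤ b s := fun s => mul_nonneg hν.le (hβ.2 _)
  have hβb : ∀ x : En 1, β x = ν⁻¹ * b (x 0) := by
    intro x
    simp only [b]
    rw [← mul_assoc, inv_mul_cancel₀ hν.ne', one_mul, ← vec_one]
  have hbd : ∀ r : ℝ, |r| ≤ R → Real.exp (-k) * (r ^ 2 / 2) ≤ Y1 b r ∧ Y1 b r ≤ r ^ 2 / 2 ∧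
      Real.exp (-k) * |r| ≤ |P1 b r| := by
    intro r hr
    apply oneD_bounds hb hb0
    · unfold Bf b
      rw [intervalIntegral.integral_const_mul]
      exact mul_le_mul_of_nonneg_left (Dr_one hβ hS0 (abs_nonneg r) hr hS v hv) hν.le
    · unfold Bf b
      rw [intervalIntegral.integral_const_mul]
      have := Dr_one hβ hS0 (abs_nonneg r) hr hS (-v) (by rw [norm_neg, hv])
      simp only [smul_neg, ← neg_smul] at this
      exact mul_le_mul_of_nonneg_left this hν.le
  have hee : Real.exp k * Real.exp (-k) = 1 := by rw [← Real.exp_add]; simp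
  let Y : En 1 × ℝ → ℝ := fun X => C * Y1 b (X.1 0)
  have hY : ContDiff ℝ 2 Y := by
    have h1 : ContDiff ℝ 2 (fun X : En 1 × ℝ => X.1 0) := by fun_prop
    exact contDiff_const.mul ((contDiff_Y1 hb).comp h1)
  have hcalc := fun X : En 1 × ℝ => oneD_calc (F := fun r => C * Y1 b r) (F1 := fun r => C * P1 b r)
    (F2 := fun r => C * (1 - b r * |P1 b r|)) (fun r => (hasDerivAt_Y1 hb r).const_mul C)
    (fun r => (hasDerivAt_P1 hb r).const_mul C) X
  have hYge : ∀ X : En 1 × ℝ, ‖X.1‖ ≤ R → ‖X.1‖ ^ 2 ≤ Y X := by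
    intro X hX
    rw [norm_one] at hX ⊢
    have := mul_le_mul_of_nonneg_left (hbd _ hX).1 (by positivity : 0 ≤ C)
    have e : C * (Real.exp (-k) * (X.1 0 ^ 2 / 2)) = X.1 0 ^ 2 := by
      rw [hCd]; linear_combination (X.1 0 ^ 2) * hee
    rw [sq_abs]
    linarith
  have hYle : ∀ X : En 1 × ℝ, ‖X.1‖ ≤ R → Y X ≤ C * (‖X.1‖ ^ 2 / 2) := by
    intro X hX
    rw [norm_one] at hX ⊢
    rw [sq_abs]
    exact mul_le_mul_of_nonneg_left (hbd _ hX).2.1 (by positivity : 0 ≤ C)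
  have key := barrier_abp (a := a) (q := q) one_pos hν (Λ := Λ) (κ := κ) (S := S) (g := 0)
    (γ := β) (R := R) (T := T) hY hu hβ hR0 ha0 hκ0 hS0 le_rfl
    hT0.le hqe (fun X => (hcalc X).1) (fun X => mul_nonneg (by positivity) (Y1_nonneg _))
    ?_ ?_ ?_ ?_ ?_ hS hsup hu0 (fun x hx _ => hu1 x hx) hη0
    (J := J) ?_ (x, t) (mem_cyl.2 ⟨by simpa using hx.trans hDR, by simp only; linarith, ht2⟩)
  · have hl := psiB_lower (a := a) (q := q) (τ := τ) (D := D) (T := T) (Y := Y)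
      (X := (x, t)) hq0 ?_ ht2
    · linarith
    · simp only [sB]
      have h0 := hYle (x, t) (hx.trans hDR)
      have h1 : ‖x‖ ^ 2 ≤ D ^ 2 := by gcongr
      have h2 : C * D ^ 2 ≤ a * t := by
        rw [← haτ]; gcongr
      have h3 : C * (‖x‖ ^ 2 / 2) ≤ C * D ^ 2 := by
        have : 0 ≤ ‖x‖ ^ 2 := by positivity
        gcongr; linarith
      simp only at h0
      linarith
  · intro X hX A hA
    rw [(hcalc X).2.1, (hcalc X).2.2, hβb, abs_mul, abs_of_nonneg (by positivity : 0 ≤ C)]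
    set p := |P1 b (X.1 0)|
    set B := b (X.1 0)
    have hB0 : 0 ≤ B := hb0 _
    have hp0 : 0 ≤ p := abs_nonneg _
    have hA1 := hA.1 (fun _ => 1)
    simp at hA1
    have hA2 : A 0 0 ≤ ν := (le_abs_self _).trans (hA.entry_le hν.le 0 0)
    have hν' : 0 < ν⁻¹ := by positivity
    have hBp : 0 ≤ B * p := by positivity
    have : A 0 0 * (1 - B * p) + ν⁻¹ * B * p ≤ ν + ν⁻¹ := by
      have := oneD_aux (w := B * p) hν.le hν'.le hBp hA1 hA2
      rwa [← mul_assoc] at this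
    rw [hΛ]
    calc A 0 0 * (C * (1 - B * p)) + ν⁻¹ * B * (C * p)
        = C * (A 0 0 * (1 - B * p) + ν⁻¹ * B * p) := by ring
      _ ≤ _ := by gcongr
  · intro X hX
    have hX' := (mem_cyl.1 hX).1
    rw [sub_zero] at hX'
    have h0 := hYle X hX'
    rw [(hcalc X).2.1, sq_abs]
    rw [norm_one] at hX' h0
    have h1 := (hbd _ hX').2.2
    have h2 : (Real.exp (-k) * |X.1 0|) ^ 2 ≤ |P1 b (X.1 0)| ^ 2 := by gcongr
    rw [sq_abs] at h2
    calc κ * Y X ≤ κ * (C * (|X.1 0| ^ 2 / 2)) := by gcongr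
      _ = C ^ 2 * (Real.exp (-k) * |X.1 0|) ^ 2 := by
        rw [hκ, hCd]
        linear_combination (4 * Real.exp (-k) * Real.exp k * |X.1 0| ^ 2 ) * (-hee)
      _ ≤ C ^ 2 * P1 b (X.1 0) ^ 2 := by gcongr
      _ = _ := by ring
  · intro x t hx _ _
    have := hYge (x, t) hx.le
    simp only [hx, hR2] at this; exact this
  · intro x hx hxR
    refine le_trans ?_ (hYge (x, 0) hxR)
    exact one_le_pow₀ hx
  · intro X hX
    simp
  · simpa using hJ

end oneD

end Hk

namespace Hk

section shell

lemma shell {β : En n → ℝ} (hβ : Drift β) (y : En n) {a l S ε : ℝ} {K : ℕ} (hK : 0 < K) (hl : 0 < l)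
    (hKS : S ≤ K * ε) (hS : Dr β y (a + l) ≤ ENNReal.ofReal S) :
    ∃ r, a + l / (4 * K) ≤ r ∧ r + l / (4 * K) ≤ a + l ∧
      ∀ p : En n, ‖p - y‖ = r → Dr β p (l / (4 * K)) ≤ ENNReal.ofReal ε := by
  have hK' : (0:ℝ) < K := by exact_mod_cast hK
  set q := l / (4 * K) with hq
  have hq0 : 0 < q := by positivity
  have hql : 4 * K * q = l := by rw [hq]; field_simp
  let f : En n → ℝ≥0∞ := fun x => ENNReal.ofReal (β x) ^ n
  have hf : Measurable f := by
    have := hβ.1.measurable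
    fun_prop
  let sh : ℕ → Set (En n) := fun i => (fun x => ‖x - y‖) ⁻¹' (Ico (a + 4 * i * q) (a + 4 * (i + 1) * q))
  have hms : ∀ i, MeasurableSet (sh i) := fun i =>
    (by fun_prop : Measurable (fun x : En n => ‖x - y‖)) measurableSet_Ico
  have hdis : Pairwise (Function.onFun Disjoint sh) := by
    intro i j hij
    refine Disjoint.preimage _ ?_
    rw [Set.disjoint_left]
    rintro x ⟨h1, h2⟩ ⟨h3, h4⟩
    rcases lt_or_gt_of_ne hij with h | h
    · have : (i:ℝ) + 1 ≤ j := by exact_mod_cast h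
      nlinarith
    · have : (j:ℝ) + 1 ≤ i := by exact_mod_cast h
      nlinarith
  have hex : ∃ i ∈ Finset.range K, ∫⁻ x in sh i, f x ≤ ENNReal.ofReal ε := by
    by_contra hcon
    push Not at hcon
    have h1 : ∑ i ∈ Finset.range K, ENNReal.ofReal ε < ∑ i ∈ Finset.range K, ∫⁻ x in sh i, f x := by
      refine ENNReal.sum_lt_sum_of_nonempty (by simp; omega) hcon
    rw [← lintegral_biUnion_finset (fun i _ j _ h => hdis h) (fun i _ => hms i)] at h1
    have h2 : ∫⁻ x in ⋃ i ∈ Finset.range K, sh i, f x ≤ Dr β y (a + l) := by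
      apply lintegral_mono_set
      intro x hx
      simp only [mem_iUnion, Finset.mem_range] at hx
      obtain ⟨i, hi, hx⟩ := hx
      rw [mem_closedBall, dist_eq_norm]
      have h3 : (i:ℝ) + 1 ≤ K := by exact_mod_cast hi
      have h4 : ‖x - y‖ < a + 4 * (i + 1) * q := hx.2
      nlinarith
    have h5 := h1.trans_le (h2.trans hS)
    rw [Finset.sum_const, Finset.card_range, nsmul_eq_mul, ← ENNReal.ofReal_natCast,
      ← ENNReal.ofReal_mul hK'.le] at h5
    exact absurd h5 (not_lt.2 (ENNReal.ofReal_le_ofReal hKS))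
  obtain ⟨i, hi, hi2⟩ := hex
  have hiK : (i:ℝ) + 1 ≤ K := by exact_mod_cast Finset.mem_range.1 hi
  have hi0 : (0:ℝ) ≤ i := by positivity
  refine ⟨a + 4 * i * q + 2 * q, by nlinarith, by nlinarith, fun p hp => le_trans ?_ hi2⟩
  apply lintegral_mono_set
  intro x hx
  rw [mem_closedBall, dist_eq_norm] at hx
  have h1 : ‖x - y‖ ≤ ‖x - p‖ + ‖p - y‖ := norm_sub_le_norm_sub_add_norm_sub _ _ _
  have h2 : ‖p - y‖ ≤ ‖p - x‖ + ‖x - y‖ := norm_sub_le_norm_sub_add_norm_sub _ _ _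
  rw [norm_sub_rev p x] at h2
  exact ⟨by show _ ≤ ‖x - y‖; linarith, by show ‖x - y‖ < _; linarith⟩

end shell

section chain

def Chn (A : Set (En n)) (h : ℝ) (m : ℕ) (x y : En n) : Prop :=
  ∃ p : ℕ → En n, p 0 = x ∧ (∀ i, m ≤ i → p i = y) ∧ (∀ i, p i ∈ A) ∧ ∀ i, ‖p (i + 1) - p i‖ ≤ h

lemma chain_exists (n : ℕ) (R : ℝ) {h : ℝ} (hh : 0 < h) :
    ∃ N : ℕ, ∀ (A : Set (En n)) (z : En n), IsPreconnected A → A ⊆ closedBall z R →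
      ∀ x ∈ A, ∀ y ∈ A, ∀ m, N ≤ m → Chn A h m x y := by
  obtain ⟨F, -, hF⟩ := (isCompact_closedBall (0 : En n) R).elim_finite_subcover_image
    (b := univ) (c := fun p : En n => ball p (h / 2)) (fun _ _ => isOpen_ball)
    (fun x _ => mem_iUnion₂.2 ⟨x, trivial, mem_ball_self (by linarith)⟩)
  obtain ⟨hFf, hF⟩ := hF
  lift F to Finset (En n) using hFf
  refine ⟨F.card + 1, fun A z hA hAz x hx y hy m hm => ?_⟩
  classical
  let B : F → Set (En n) := fun f => ball ((f : En n) + z) (h / 2)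
  have hcov : ∀ x ∈ A, ∃ f, x ∈ B f := by
    intro x hx
    have h1 : x - z ∈ closedBall (0 : En n) R := by
      have := hAz hx
      rw [mem_closedBall, dist_eq_norm] at this
      simpa using this
    have h2 := hF h1
    simp only [mem_iUnion] at h2
    obtain ⟨f, hf, hx2⟩ := h2
    refine ⟨⟨f, hf⟩, ?_⟩
    simp only [B, mem_ball, dist_eq_norm] at hx2 ⊢
    convert hx2 using 2
    abel
  let G : SimpleGraph F := SimpleGraph.fromRel (fun f g => (A ∩ (B f ∩ B g)).Nonempty)
  obtain ⟨f0, hf0⟩ := hcov x hx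
  obtain ⟨g0, hg0⟩ := hcov y hy
  have hreach : G.Reachable f0 g0 := by
    by_contra hcon
    have := hA (⋃ f : {f // G.Reachable f0 f}, B f) (⋃ f : {f // ¬ G.Reachable f0 f}, B f)
      (isOpen_iUnion fun _ => isOpen_ball) (isOpen_iUnion fun _ => isOpen_ball) ?_
      ⟨x, hx, mem_iUnion.2 ⟨⟨f0, SimpleGraph.Reachable.refl _⟩, hf0⟩⟩
      ⟨y, hy, mem_iUnion.2 ⟨⟨g0, hcon⟩, hg0⟩⟩
    · obtain ⟨q, hqA, hq1, hq2⟩ := this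
      obtain ⟨⟨f, hf⟩, hq1⟩ := mem_iUnion.1 hq1
      obtain ⟨⟨g, hg⟩, hq2⟩ := mem_iUnion.1 hq2
      apply hg
      refine hf.trans (SimpleGraph.Adj.reachable ?_)
      rw [SimpleGraph.fromRel_adj]
      refine ⟨fun e => hg (e ▸ hf), Or.inl ⟨q, hqA, hq1, hq2⟩⟩
    · intro q hq
      obtain ⟨f, hf⟩ := hcov q hq
      by_cases hr : G.Reachable f0 f
      · exact Or.inl (mem_iUnion.2 ⟨⟨f, hr⟩, hf⟩)
      · exact Or.inr (mem_iUnion.2 ⟨⟨f, hr⟩, hf⟩)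
  have hdist : ∀ f : F, ∀ x ∈ B f, ∀ y ∈ B f, ‖y - x‖ ≤ h := by
    intro f x hx y hy
    rw [← dist_eq_norm]
    have h1 : dist y ((f:En n) + z) < h / 2 := hy
    have h2 : dist x ((f:En n) + z) < h / 2 := hx
    have := dist_triangle_right y x ((f:En n) + z)
    linarith
  have main : ∀ (f g : F) (w : G.Walk f g), ∀ x ∈ A ∩ B f, ∀ y ∈ A ∩ B g, Chn A h (w.length + 1) x y := by
    intro f g w
    induction w with
    | nil =>
      intro x hx y hy
      refine ⟨fun i => if i = 0 then x else y, by simp, ?_, ?_, ?_⟩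
      · intro i hi; simp at hi; exact if_neg (by omega)
      · intro i; dsimp only; split_ifs; exacts [hx.1, hy.1]
      · intro i
        simp only [Nat.add_eq_zero_iff, one_ne_zero, and_false, if_false]
        split_ifs
        · exact hdist _ x hx.2 y hy.2
        · simp [hh.le]
    | @cons fa fb _ hadj w ih =>
      intro x hx y hy
      rw [SimpleGraph.fromRel_adj] at hadj
      have hq : ∃ q ∈ A, q ∈ B fa ∧ q ∈ B fb := by
        rcases hadj.2 with ⟨q, h1, h2, h3⟩ | ⟨q, h1, h2, h3⟩
        · exact ⟨q, h1, h2, h3⟩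
        · exact ⟨q, h1, h3, h2⟩
      obtain ⟨q, hqA, hq1, hq2⟩ := hq
      obtain ⟨p, hp0, hp1, hp2, hp3⟩ := ih q ⟨hqA, hq2⟩ y hy
      refine ⟨fun i => match i with | 0 => x | i + 1 => p i, rfl, ?_, ?_, ?_⟩
      · rintro (_ | i) hi
        · simp at hi
        · simp only [SimpleGraph.Walk.length_cons] at hi
          exact hp1 i (by omega)
      · rintro (_ | i)
        exacts [hx.1, hp2 i]
      · rintro (_ | i)
        · show ‖p 0 - x‖ ≤ h
          rw [hp0]; exact hdist _ x hx.2 q hq1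
        · exact hp3 i
  obtain ⟨w, hw⟩ := hreach.exists_isPath
  obtain ⟨p, hp0, hp1, hp2, hp3⟩ := main _ _ w x ⟨hx, hf0⟩ y ⟨hy, hg0⟩
  refine ⟨p, hp0, fun i hi => hp1 i ?_, hp2, hp3⟩
  have := hw.length_lt
  simp only [Fintype.card_coe] at this
  omega

end chain

lemma Spread.chain {ν ε c R τ : ℝ} (hc : 0 < c) (H : Spread n ν ε c R τ τ 2)
    {u : En n × ℝ → ℝ} {β : En n → ℝ} (hu : ContDiff ℝ 2 u) (hβ : Drift β) {ρ t₀ m : ℝ} (hρ : 0 < ρ)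
    (hm : 0 ≤ m) (p : ℕ → En n) (hp : ∀ i, ‖p (i + 1) - p i‖ ≤ ρ) (N : ℕ)
    (hD : ∀ i < N, Dr β (p i) (R * ρ) ≤ ENNReal.ofReal ε)
    (hsup : ∀ i < N, ∀ X ∈ cyl (p i) (R * ρ) (t₀ + i * (τ * ρ ^ 2)) (t₀ + (i + 1) * (τ * ρ ^ 2)),
      SupAt ν β u X ∧ 0 ≤ u X)
    (h0 : ∀ x : En n, ‖x - p 0‖ ≤ ρ → m ≤ u (x, t₀)) :
    ∀ x : En n, ‖x - p N‖ ≤ ρ → c ^ N * m ≤ u (x, t₀ + N * (τ * ρ ^ 2)) := by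
  induction N with
  | zero => simpa using h0
  | succ k ih =>
    intro x hx
    have e : t₀ + ((k + 1 : ℕ) : ℝ) * (τ * ρ ^ 2) = t₀ + k * (τ * ρ ^ 2) + τ * ρ ^ 2 := by push_cast; ring
    have e2 : t₀ + ((k : ℝ) + 1) * (τ * ρ ^ 2) = t₀ + k * (τ * ρ ^ 2) + τ * ρ ^ 2 := by ring
    have hs := hsup k (by omega)
    rw [e2] at hs
    have := H u β (p k) ρ (t₀ + k * (τ * ρ ^ 2)) (c ^ k * m) hu hβ hρ (by positivity) (hD k (by omega))
      (fun X hX => (hs X hX).1) (fun X hX => (hs X hX).2)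
      (ih (fun i hi => hD i (by omega)) (fun i hi => hsup i (by omega))) x
      (t₀ + ((k + 1 : ℕ) : ℝ) * (τ * ρ ^ 2)) ?_ e.ge e.le
    · rw [pow_succ]; linarith
    · have h1 : ‖x - p k‖ ≤ ‖x - p (k + 1)‖ + ‖p (k + 1) - p k‖ := norm_sub_le_norm_sub_add_norm_sub _ _ _
      linarith [hp k]

end Hk

namespace Hk

/-- filling in the interior for supersolutions -/
lemma super_fill (hn : 0 < n) {ν : ℝ} (hν : 0 < ν) (S : ℝ) (hS0 : 0 ≤ S) :
    ∃ K : ℝ, 1 ≤ K ∧ ∀ (u : En n × ℝ → ℝ) (β : En n → ℝ) (z : En n) (R t₀ t₁ m : ℝ),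
      ContDiff ℝ 2 u → Drift β → 0 < R → 0 < m →
      K * R ^ 2 ≤ t₁ - t₀ → Dr β z R ≤ ENNReal.ofReal S →
      (∀ X ∈ cyl z R t₀ t₁, SupAt ν β u X ∧ 0 ≤ u X) →
      (∀ (x : En n) (t : ℝ), ‖x - z‖ = R → t₀ ≤ t → t ≤ t₁ → m ≤ u (x, t)) →
      ∀ x : En n, ‖x - z‖ ≤ R → m / 2 ≤ u (x, t₁) := by
  obtain ⟨K, hK, H⟩ := fill hn hν S hS0
  refine ⟨K, hK, fun u β z R t₀ t₁ m hu hβ hR hm hT hD hsup hlat x hx => ?_⟩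
  have hm' : (0:ℝ) ≤ 1 / (2 * m) := by positivity
  have := H (fun X => (1 / (2 * m)) * (- u X) + 1) β z R t₀ t₁
    (by have := hu.neg; fun_prop) hβ hR hT hD ?_ ?_ ?_ x hx
  · have e : 1 / (2 * m) * (- u (x, t₁)) + 1 = 1 - u (x, t₁) / (2 * m) := by ring
    rw [e] at this
    have h2 : 1 / 4 ≤ u (x, t₁) / (2 * m) := by linarith
    rw [le_div_iff₀ (by positivity)] at h2
    linarith
  · intro X hX
    exact SubAt.add_const (contDiff_const.mul hu.neg)
      (SubAt.const_mul hu.neg (hsup X hX).1 hm') 1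
  · intro X hX
    have := mul_nonneg hm' (hsup X hX).2
    linarith
  · intro x t hx h1 h2
    have := mul_le_mul_of_nonneg_left (hlat x t hx h1 h2) hm'
    have e : 1 / (2 * m) * m = 1 / 2 := by field_simp
    linarith

lemma exists_sphere_pt (hn : 2 ≤ n) (y : En n) {r : ℝ} (hr : 0 ≤ r) :
    ∃ p : En n, ‖p - y‖ = r ∧ ‖p‖ ≤ |r - ‖y‖| := by
  have : NeZero n := ⟨by omega⟩
  rcases eq_or_ne y 0 with rfl | hy
  · refine ⟨EuclideanSpace.single 0 r, ?_, ?_⟩ <;> simp [hr]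
  · have hy' : ‖y‖ ≠ 0 := norm_ne_zero_iff.2 hy
    refine ⟨y - (r / ‖y‖) • y, ?_, ?_⟩
    · have : y - (r / ‖y‖) • y - y = -((r / ‖y‖) • y) := by abel
      rw [this, norm_neg, norm_smul, Real.norm_of_nonneg (by positivity)]
      field_simp
    · have : y - (r / ‖y‖) • y = (1 - r / ‖y‖) • y := by rw [sub_smul, one_smul]
      rw [this, norm_smul, Real.norm_eq_abs]
      apply le_of_eq
      rw [abs_sub_comm r, ← abs_of_nonneg (norm_nonneg y), ← abs_mul, abs_of_nonneg (norm_nonneg y)]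
      congr 1
      field_simp

set_option maxHeartbeats 1000000 in
lemma step_two (hn : 2 ≤ n) {ν : ℝ} (hν : 0 < ν) {S : ℝ} (hS0 : 0 ≤ S) :
    ∃ c R K1 : ℝ, 0 < c ∧ c ≤ 1 ∧ 2 ≤ R ∧ 0 < K1 ∧ Spread n ν S c R K1 K1 2 := by
  have hn0 : 0 < n := by omega
  obtain ⟨ε, c, R, hε, hc, hc1, hR, hspread⟩ := spread_small (n := n) hn0 hν (τ := 1) (T := 1) (D := 2)
    one_pos le_rfl (by norm_num)
  obtain ⟨K, hK, hfill⟩ := super_fill hn0 hν S hS0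
  obtain ⟨k0, hk0⟩ := exists_nat_gt (S / ε)
  have hk0' : S ≤ ((k0 + 1 : ℕ) : ℝ) * ε := by
    rw [div_lt_iff₀ hε] at hk0
    push_cast
    nlinarith
  set k := k0 + 1 with hk
  set w : ℝ := (1/2) / (4 * (k:ℝ)) with hw
  have hkpos : (1:ℝ) ≤ k := by rw [hk]; push_cast; linarith [(Nat.cast_nonneg k0 : (0:ℝ) ≤ k0)]
  have hw0 : 0 < w := by positivity
  have hw1 : w ≤ 1 / 2 := by
    rw [hw, div_le_iff₀ (by positivity)]; nlinarith
  set ρ := w / R with hρd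
  have hR0 : 0 < R := by linarith
  have hρ : 0 < ρ := by positivity
  have hRρ : R * ρ = w := by rw [hρd]; field_simp
  have hρw : ρ ≤ w := by rw [hρd, div_le_iff₀ hR0]; nlinarith
  obtain ⟨N0, hN0⟩ := chain_exists n 3 (half_pos hρ)
  obtain ⟨N1, hN1⟩ := exists_nat_gt (18 * K / ρ ^ 2)
  set N := N0 + N1 + 1 with hN
  have hNpos : (0:ℝ) < N := by rw [hN]; positivity
  set K1 := N * ρ ^ 2 with hK1
  have hK1K : 18 * K ≤ K1 := by
    rw [div_lt_iff₀ (by positivity)] at hN1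
    have : (N1:ℝ) ≤ N := by rw [hN]; push_cast; linarith [(Nat.cast_nonneg N0 : (0:ℝ) ≤ N0)]
    rw [hK1]
    nlinarith [sq_nonneg ρ]
  have hK10 : 0 < K1 := by linarith
  refine ⟨c ^ N / 2, 5, K1, by positivity, ?_, by norm_num, hK10, USpread.scale hK10.le (by norm_num) ?_⟩
  · have : c ^ N ≤ 1 := pow_le_one₀ hc.le hc1
    linarith
  intro u β hu hβ hS hsup hu0 hu1 y t hy ht1 ht2
  have hte : t = K1 := le_antisymm ht2 ht1
  subst hte
  obtain ⟨r, hr1, hr2, hr3⟩ := shell hβ y (a := ‖y‖) (l := 1/2) (K := k) (S := S) (ε := ε)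
    (by omega) (by norm_num) hk0' (le_trans (Dr_mono (by
      intro x hx
      rw [mem_closedBall, dist_eq_norm] at *
      rw [sub_zero]
      have := norm_sub_norm_le x y
      linarith)) hS)
  rw [← hw] at hr1 hr2 hr3
  have hy0 := norm_nonneg y
  have hr0 : 0 < r := by linarith
  have hrle : r ≤ 5 / 2 := by linarith
  obtain ⟨p0, hp0, hp0'⟩ := exists_sphere_pt hn y hr0.le
  have hp0n : ‖p0‖ ≤ 1 / 2 := hp0'.trans (by rw [abs_of_nonneg] <;> linarith)
  have hconn : IsPreconnected (sphere y r) := by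
    refine (isConnected_sphere ?_ y hr0.le).isPreconnected
    rw [rank_eq_card_basis (EuclideanSpace.basisFun (Fin n) ℝ).toBasis]
    simp only [Fintype.card_fin]
    exact_mod_cast hn
  have hKr : K * r ^ 2 ≤ 9 * K := by
    have h9 : r ^ 2 ≤ 9 := by nlinarith
    nlinarith
  have hlat : ∀ (x : En n) (s : ℝ), ‖x - y‖ = r → K1 - K * r ^ 2 ≤ s → s ≤ K1 → c ^ N ≤ u (x, s) := by
    intro x s hx hs1 hs2
    have hs0 : K1 / 2 ≤ s := by linarith
    obtain ⟨p, hpa, hpb, hpc, hpd⟩ := hN0 (sphere y r) y hconn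
      (sphere_subset_closedBall.trans (closedBall_subset_closedBall (by linarith)))
      p0 (by simpa [dist_eq_norm] using hp0) x (by simpa [dist_eq_norm] using hx) N (by omega)
    have hps : ∀ i, ‖p i - y‖ = r := fun i => by simpa [dist_eq_norm] using hpc i
    set ρs := Real.sqrt (s / N) with hρs
    have hρs2 : ρs ^ 2 = s / N := Real.sq_sqrt (div_nonneg (by linarith) hNpos.le)
    have hNs : N * ρs ^ 2 = s := by rw [hρs2]; field_simp
    have hρs0 : 0 ≤ ρs := Real.sqrt_nonneg _
    have hρle : ρs ≤ ρ := by
      apply abs_le_of_sq_le_sq' _ hρ.le |>.2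
      have : N * ρs ^ 2 ≤ N * ρ ^ 2 := by rw [hNs, ← hK1]; exact hs2
      exact le_of_mul_le_mul_left this hNpos
    have hρge : ρ / 2 ≤ ρs := by
      apply abs_le_of_sq_le_sq' _ hρs0 |>.2
      have : N * (ρ / 2) ^ 2 ≤ N * ρs ^ 2 := by rw [hNs]; nlinarith
      exact le_of_mul_le_mul_left this hNpos
    have hRρs : R * ρs ≤ w := by rw [← hRρ]; gcongr
    have := hspread.chain hc hu hβ (ρ := ρs) (t₀ := 0) (m := 1) (by linarith) zero_le_one p
      (fun i => (hpd i).trans hρge) N ?_ ?_ ?_ x ?_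
    · rw [one_mul, hNs, zero_add, mul_one] at this; exact this
    · intro i hi
      exact (Dr_mono (closedBall_subset_closedBall hRρs)).trans (hr3 _ (hps i))
    · intro i hi X hX
      have hX' : X ∈ cyl 0 5 0 K1 := by
        rw [mem_cyl] at hX ⊢
        obtain ⟨h1, h2, h3⟩ := hX
        refine ⟨?_, ?_, ?_⟩
        · have e : X.1 - 0 = (X.1 - p i) + (p i - y) + y := by abel
          rw [e]
          have := norm_add₃_le (a := X.1 - p i) (b := p i - y) (c := y)
          rw [hps i] at this
          linarith
        · have : (0:ℝ) ≤ i * (1 * ρs ^ 2) := by positivity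
          linarith
        · have hi' : (i:ℝ) + 1 ≤ N := by exact_mod_cast hi
          have : ((i:ℝ) + 1) * (1 * ρs ^ 2) ≤ N * (1 * ρs ^ 2) := by gcongr
          rw [one_mul, hNs] at this
          linarith
      exact ⟨hsup X hX', hu0 X hX'⟩
    · intro x hx
      apply hu1
      rw [hpa] at hx
      have : x = (x - p0) + p0 := by abel
      rw [this]
      have := norm_add_le (x - p0) p0
      linarith
    · rw [hpb N le_rfl, sub_self, norm_zero]; exact hρs0
  have := hfill u β y r (K1 - K * r ^ 2) K1 (c ^ N) hu hβ hr0 (by positivity) (by linarith)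
    ((Dr_mono (fun x hx => by
      rw [mem_closedBall, dist_eq_norm] at *
      rw [sub_zero]
      have := norm_sub_norm_le x y
      linarith)).trans hS) (fun X hX => by
      have hX' : X ∈ cyl 0 5 0 K1 := by
        rw [mem_cyl] at hX ⊢
        obtain ⟨h1, h2, h3⟩ := hX
        refine ⟨?_, by linarith, h3⟩
        rw [sub_zero]
        have := norm_sub_norm_le X.1 y
        linarith
      exact ⟨hsup X hX', hu0 X hX'⟩) hlat y (by simpa using hr0.le)
  exact this

theorem step (hn : 0 < n) {ν : ℝ} (hν : 0 < ν) {S : ℝ} (hS0 : 0 ≤ S) :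
    ∃ c R K1 : ℝ, 0 < c ∧ c ≤ 1 ∧ 2 ≤ R ∧ 0 < K1 ∧ Spread n ν S c R K1 K1 2 := by
  rcases (show n = 1 ∨ 2 ≤ n by omega) with h | h
  · subst h
    obtain ⟨c, R, h1, h2, h3, h4⟩ := spread_one hν hS0 (τ := 1) (T := 1) (D := 2) one_pos le_rfl (by norm_num)
    exact ⟨c, R, 1, h1, h2, h3, one_pos, h4⟩
  · exact step_two h hν hS0

end Hk

namespace Hk

section oneDstack

lemma stack_one {ι : Type*} {I : Set ι} (hI : I.Countable) {a l : ι → ℝ} (hl : ∀ i, 0 < l i)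
    (hd : I.PairwiseDisjoint fun i => Ico (a i) (a i + l i)) (m : ℕ) (hm : 0 < m) :
    (m : ℝ≥0∞) * volume (⋃ i ∈ I, Ico (a i) (a i + l i)) ≤
      (m + 1) * volume (⋃ i ∈ I, Ico (a i + l i) (a i + l i + m * l i)) := by
  have hm' : (0:ℝ) < m := by exact_mod_cast hm
  set V := ⋃ i ∈ I, Ico (a i + l i) (a i + l i + m * l i) with hV
  let G : Set ι := {i ∈ I | ¬ Ico (a i) (a i + l i) ⊆ V}
  have hGI : G ⊆ I := fun i hi => hi.1
  have hGc : G.Countable := hI.mono hGI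
  have key : ∀ i ∈ I, ∀ j ∈ G, a i < a j →
      Disjoint (Ico (a i + l i) (a i + l i + m * l i)) (Ico (a j + l j) (a j + l j + m * l j)) := by
    intro i hi j hj hij
    rw [Set.disjoint_left]
    rintro x ⟨h1, h2⟩ ⟨h3, h4⟩
    have hne : i ≠ j := fun e => by rw [e] at hij; exact lt_irrefl _ hij
    have h5 : a i + l i ≤ a j := by
      by_contra hcon
      push Not at hcon
      exact Set.disjoint_left.1 (hd hi hj.1 hne) (show a j ∈ _ from ⟨hij.le, hcon⟩) ⟨le_rfl, by linarith [hl j]⟩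
    apply hj.2
    intro y hy
    rw [hV]
    refine mem_iUnion₂.2 ⟨i, hi, by linarith [hy.1], by linarith [hy.2]⟩
  have hJ : G.PairwiseDisjoint fun i => Ico (a i + l i) (a i + l i + m * l i) := by
    intro i hi j hj hij
    rcases lt_trichotomy (a i) (a j) with h | h | h
    · exact key i hi.1 j hj h
    · exfalso
      exact Set.disjoint_left.1 (hd hi.1 hj.1 hij) (show a i ∈ _ from ⟨le_rfl, by linarith [hl i]⟩)
        ⟨h.ge, by linarith [hl j]⟩
    · exact (key j hj.1 i hi h).symm
  have h1 : (m : ℝ≥0∞) * volume (⋃ i ∈ G, Ico (a i) (a i + l i)) ≤ volume V := by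
    rw [measure_biUnion hGc (hd.subset hGI) (fun i _ => measurableSet_Ico), ← ENNReal.tsum_mul_left]
    have e : ∀ i : G, (m : ℝ≥0∞) * volume (Ico (a i) (a i + l i)) =
        volume (Ico (a i + l i) (a i + l i + m * l i)) := by
      intro i
      rw [Real.volume_Ico, Real.volume_Ico, ← ENNReal.ofReal_natCast, ← ENNReal.ofReal_mul hm'.le]
      congr 1; ring
    simp only [e]
    rw [← measure_biUnion hGc hJ (fun i _ => measurableSet_Ico)]
    exact measure_mono (biUnion_subset_biUnion_left hGI)
  have h2 : (⋃ i ∈ I, Ico (a i) (a i + l i)) ⊆ V ∪ ⋃ i ∈ G, Ico (a i) (a i + l i) := by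
    intro y hy
    obtain ⟨i, hi, hy⟩ := mem_iUnion₂.1 hy
    by_cases h : Ico (a i) (a i + l i) ⊆ V
    · exact Or.inl (h hy)
    · exact Or.inr (mem_iUnion₂.2 ⟨i, ⟨hi, h⟩, hy⟩)
  calc (m : ℝ≥0∞) * volume (⋃ i ∈ I, Ico (a i) (a i + l i))
      ≤ m * (volume V + volume (⋃ i ∈ G, Ico (a i) (a i + l i))) := by
        gcongr; exact (measure_mono h2).trans (measure_union_le _ _)
    _ = m * volume V + m * volume (⋃ i ∈ G, Ico (a i) (a i + l i)) := mul_add _ _ _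
    _ ≤ m * volume V + volume V := by gcongr
    _ = _ := by ring

end oneDstack

section tiles

def hh (h : ℝ) (j : ℕ) : ℝ := h / 2 ^ j

lemma hh_pos {h : ℝ} (hp : 0 < h) (j : ℕ) : 0 < hh h j := by unfold hh; positivity

lemma hh_succ (h : ℝ) (j : ℕ) : hh h j = 2 * hh h (j + 1) := by
  unfold hh; rw [pow_succ]; field_simp

lemma hh_le {h : ℝ} (hp : 0 < h) (j : ℕ) : hh h j ≤ h := by
  unfold hh
  exact div_le_self hp.le (one_le_pow₀ (by norm_num))

abbrev TI (n : ℕ) := ℕ × (Fin n → ℤ) × ℤ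

def cube (h : ℝ) (j : ℕ) (k : Fin n → ℤ) : Set (En n) := {x | ∀ i, ⌊x i / hh h j⌋ = k i}

def tl (h : ℝ) (q : TI n) : Set (En n × ℝ) :=
  cube h q.1 q.2.1 ×ˢ Ico (q.2.2 * hh h q.1 ^ 2) (q.2.2 * hh h q.1 ^ 2 + hh h q.1 ^ 2)

def st (h : ℝ) (m : ℕ) (q : TI n) : Set (En n × ℝ) :=
  cube h q.1 q.2.1 ×ˢ Ico (q.2.2 * hh h q.1 ^ 2 + hh h q.1 ^ 2)
    (q.2.2 * hh h q.1 ^ 2 + hh h q.1 ^ 2 + m * hh h q.1 ^ 2)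

def tid (h : ℝ) (j : ℕ) (X : En n × ℝ) : TI n :=
  (j, fun i => ⌊X.1 i / hh h j⌋, ⌊X.2 / hh h j ^ 2⌋)

lemma mem_cube {h : ℝ} (hp : 0 < h) {j : ℕ} {k : Fin n → ℤ} {x : En n} :
    x ∈ cube h j k ↔ ∀ i, k i * hh h j ≤ x i ∧ x i < (k i + 1) * hh h j := by
  unfold cube
  simp only [mem_ofPred_eq, Int.floor_eq_iff, le_div_iff₀ (hh_pos hp j), div_lt_iff₀ (hh_pos hp j)]

lemma mem_tl {h : ℝ} (hp : 0 < h) {q : TI n} {X : En n × ℝ} : X ∈ tl h q ↔ tid h q.1 X = q := by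
  obtain ⟨j, k, l⟩ := q
  have h2 : 0 < hh h j ^ 2 := by have := hh_pos hp j; positivity
  simp only [tl, tid, mem_prod, cube, mem_ofPred_eq, mem_Ico, Prod.mk.injEq, true_and, funext_iff]
  rw [Int.floor_eq_iff (a := X.2 / hh h j ^ 2), le_div_iff₀ h2, div_lt_iff₀ h2, add_mul, one_mul]

lemma tid_succ {h : ℝ} (j : ℕ) {X Y : En n × ℝ} (e : tid h (j + 1) X = tid h (j + 1) Y) :
    tid h j X = tid h j Y := by
  simp only [tid, Prod.mk.injEq, true_and, funext_iff] at e ⊢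
  have e1 : ∀ x : ℝ, ⌊x / hh h j⌋ = ⌊x / hh h (j + 1)⌋ / (2 : ℕ) := by
    intro x
    rw [← Int.floor_div_natCast, hh_succ h j, div_div]
    congr 2; push_cast; ring
  have e2 : ∀ x : ℝ, ⌊x / hh h j ^ 2⌋ = ⌊x / hh h (j + 1) ^ 2⌋ / (4 : ℕ) := by
    intro x
    rw [← Int.floor_div_natCast, hh_succ h j, div_div]
    congr 2; push_cast; ring
  exact ⟨fun i => by rw [e1, e1, e.1 i], by rw [e2, e2, e.2]⟩

lemma tid_mono {h : ℝ} {j j' : ℕ} (hj : j ≤ j') {X Y : En n × ℝ} (e : tid h j' X = tid h j' Y) :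
    tid h j X = tid h j Y := by
  induction j', hj using Nat.le_induction with
  | base => exact e
  | succ k hk ih => exact ih (tid_succ k e)

lemma measurableSet_cube (h : ℝ) (j : ℕ) (k : Fin n → ℤ) : MeasurableSet (cube h j k) := by
  have : cube h j k = ⋂ i, (fun x : En n => ⌊x i / hh h j⌋) ⁻¹' {k i} := by
    ext x; simp [cube]
  rw [this]
  refine MeasurableSet.iInter fun i => ?_
  refine (Int.measurable_floor.comp ?_) (measurableSet_singleton _)
  fun_prop

lemma measurableSet_tl (h : ℝ) (q : TI n) : MeasurableSet (tl h q) :=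
  (measurableSet_cube _ _ _).prod measurableSet_Ico

lemma measurableSet_st (h : ℝ) (m : ℕ) (q : TI n) : MeasurableSet (st h m q) :=
  (measurableSet_cube _ _ _).prod measurableSet_Ico

lemma vol_cube {h : ℝ} (hp : 0 < h) (j : ℕ) (k : Fin n → ℤ) :
    volume (cube h j k) = ENNReal.ofReal (hh h j ^ n) := by
  have e : cube h j k = (@WithLp.ofLp 2 (Fin n → ℝ)) ⁻¹'
      (univ.pi fun i => Ico (k i * hh h j) ((k i + 1) * hh h j)) := by
    ext x
    rw [mem_cube hp]
    simp [mem_pi]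
  rw [e, (PiLp.volume_preserving_ofLp (Fin n)).measure_preimage
    (MeasurableSet.univ_pi fun i => measurableSet_Ico).nullMeasurableSet, Real.volume_pi_Ico]
  rw [Finset.prod_congr rfl (g := fun _ => ENNReal.ofReal (hh h j)) (fun i _ => by congr 1; ring)]
  rw [Finset.prod_const, Finset.card_univ, Fintype.card_fin, ENNReal.ofReal_pow (hh_pos hp j).le]

lemma vol_tl {h : ℝ} (hp : 0 < h) (q : TI n) :
    volume (tl h q) = ENNReal.ofReal (hh h q.1 ^ (n + 2)) := by
  have := hh_pos hp q.1
  rw [tl, Measure.volume_eq_prod, Measure.prod_prod, vol_cube hp, Real.volume_Ico,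
    ← ENNReal.ofReal_mul (by positivity)]
  congr 1; ring

def full (h μ : ℝ) (E : Set (En n × ℝ)) (q : TI n) : Prop :=
  volume (tl h q \ E) ≤ ENNReal.ofReal (μ * hh h q.1 ^ (n + 2))

lemma full.nonempty {h μ : ℝ} (hp : 0 < h) (hμ : μ < 1) {E : Set (En n × ℝ)} {q : TI n}
    (hf : full h μ E q) : (tl h q ∩ E).Nonempty := by
  by_contra hcon
  rw [not_nonempty_iff_eq_empty] at hcon
  have e : tl h q \ E = tl h q := by
    rw [sdiff_eq_left, disjoint_iff_inter_eq_empty]; exact hcon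
  unfold full at hf
  rw [e, vol_tl hp] at hf
  have := hh_pos hp q.1
  have h2 : 0 < hh h q.1 ^ (n + 2) := by positivity
  rw [ENNReal.ofReal_le_ofReal_iff'] at hf
  rcases hf with hf | hf <;> nlinarith

lemma not_full {h μ : ℝ} (hp : 0 < h) (hμ0 : 0 ≤ μ) (hμ : μ < 1) {E : Set (En n × ℝ)}
    (hE : MeasurableSet E) {q : TI n}
    (hf : ¬ full h μ E q) : volume (E ∩ tl h q) ≤ ENNReal.ofReal (1 - μ) * volume (tl h q) := by
  unfold full at hf
  push Not at hf
  have h1 := measure_inter_add_sdiff (μ := volume) (tl h q) hE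
  have := hh_pos hp q.1
  have h2 : 0 < hh h q.1 ^ (n + 2) := by positivity
  rw [inter_comm] at h1
  rw [vol_tl hp] at h1 ⊢
  rw [← ENNReal.ofReal_mul (by linarith)]
  have h3 : volume (E ∩ tl h q) + ENNReal.ofReal (μ * hh h q.1 ^ (n + 2)) ≤
      ENNReal.ofReal ((1 - μ) * hh h q.1 ^ (n + 2)) + ENNReal.ofReal (μ * hh h q.1 ^ (n + 2)) := by
    rw [← ENNReal.ofReal_add (by nlinarith) (by positivity)]
    refine le_trans (add_le_add_right hf.le _) ?_
    rw [h1]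
    apply le_of_eq
    congr 1; ring
  exact (ENNReal.add_le_add_iff_right ENNReal.ofReal_ne_top).1 h3

lemma ink {h μ : ℝ} (hp : 0 < h) (hμ0 : 0 ≤ μ) (hμ : μ < 1) {m : ℕ} (hm : 0 < m)
    {E F : Set (En n × ℝ)} (hEm : MeasurableSet E)
    (hE : ∀ X ∈ E, ∃ j, tl h (tid h (j + 1) X) ⊆ E)
    (hbase : ∀ X, ¬ full h μ E (tid h 0 X))
    (hF : ∀ j X, full h μ E (tid h (j + 1) X) → st h m (tid h j X) ⊆ F) :
    (m : ℝ≥0∞) * volume E ≤ ENNReal.ofReal (1 - μ) * ((m + 1) * volume F) := by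
  classical
  let P : En n × ℝ → ℕ → Prop := fun X j => ∃ Y, tid h j Y = tid h j X ∧ full h μ E (tid h (j + 1) Y)
  have hPE : ∀ X ∈ E, ∃ j, P X j := by
    intro X hX
    obtain ⟨j, hj⟩ := hE X hX
    refine ⟨j, X, rfl, ?_⟩
    unfold full
    rw [sdiff_eq_empty.2 hj, measure_empty]
    exact zero_le
  have hPc : ∀ X Y j, tid h j X = tid h j Y → P X j → P Y j := by
    rintro X Y j e ⟨Z, h1, h2⟩
    exact ⟨Z, h1.trans e, h2⟩
  let I : Set (TI n) := {q | ∃ X, tid h q.1 X = q ∧ P X q.1 ∧ ∀ j < q.1, ¬ P X j}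
  have hIc : I.Countable := Set.to_countable _
  have hdis : I.PairwiseDisjoint (tl h) := by
    rintro q ⟨X, e, hP, hmin⟩ q' ⟨X', e', hP', hmin'⟩ hne
    refine Set.disjoint_left.2 fun Y hY hY' => hne ?_
    rw [mem_tl hp] at hY hY'
    have hj : q.1 = q'.1 := by
      rcases lt_trichotomy q.1 q'.1 with hlt | he | hlt
      · exfalso
        refine hmin' _ hlt (hPc X X' _ ?_ hP)
        rw [e, ← hY]
        exact tid_mono hlt.le (hY'.trans e'.symm)
      · exact he
      · exfalso
        refine hmin _ hlt (hPc X' X _ ?_ hP')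
        rw [e', ← hY']
        exact tid_mono hlt.le (hY.trans e.symm)
    rw [← hY, ← hY', hj]
  have hnf : ∀ q ∈ I, ¬ full h μ E q := by
    rintro q ⟨X, e, hP, hmin⟩ hf
    rcases hq : q.1 with _ | j
    · rw [hq] at e
      exact hbase X (e ▸ hf)
    · refine hmin j (by omega) ⟨X, rfl, ?_⟩
      rw [hq] at e
      rwa [e]
  have hsub : E ⊆ ⋃ q ∈ I, tl h q := by
    intro X hX
    have hex := hPE X hX
    refine mem_iUnion₂.2 ⟨tid h (Nat.find hex) X, ⟨X, rfl, Nat.find_spec hex,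
      fun j hj => Nat.find_min hex hj⟩, ?_⟩
    rw [mem_tl hp]; rfl
  have h1 : volume E ≤ ENNReal.ofReal (1 - μ) * volume (⋃ q ∈ I, tl h q) := by
    rw [measure_biUnion hIc hdis (fun q _ => measurableSet_tl h q), ← ENNReal.tsum_mul_left]
    have : E ⊆ ⋃ q ∈ I, E ∩ tl h q := by
      intro X hX
      obtain ⟨q, hq, hXq⟩ := mem_iUnion₂.1 (hsub hX)
      exact mem_iUnion₂.2 ⟨q, hq, hX, hXq⟩
    refine (measure_mono this).trans ((measure_biUnion_le _ hIc _).trans ?_)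
    exact ENNReal.tsum_le_tsum fun q => not_full hp hμ0 hμ hEm (hnf q q.2)
  have h2 : (m : ℝ≥0∞) * volume (⋃ q ∈ I, tl h q) ≤ (m + 1) * volume (⋃ q ∈ I, st h m q) := by
    rw [Measure.volume_eq_prod, Measure.prod_apply (MeasurableSet.biUnion hIc fun q _ => measurableSet_tl h q),
      Measure.prod_apply (MeasurableSet.biUnion hIc fun q _ => measurableSet_st h m q)]
    rw [← lintegral_const_mul' _ _ (by simp), ← lintegral_const_mul' _ _ (by simp)]
    refine lintegral_mono fun x => ?_
    let Ix : Set (TI n) := {q ∈ I | x ∈ cube h q.1 q.2.1}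
    let a : TI n → ℝ := fun q => q.2.2 * hh h q.1 ^ 2
    let l : TI n → ℝ := fun q => hh h q.1 ^ 2
    have hs := stack_one (I := Ix) (hIc.mono fun q hq => hq.1) (a := a) (l := l)
      (fun q => by have := hh_pos hp q.1; simp only [l]; positivity) ?_ m hm
    · convert hs using 3
      · ext t
        simp only [mem_preimage, mem_iUnion, tl, mem_prod, exists_prop, Ix, mem_ofPred_eq, a, l]
        exact exists_congr fun q => by tauto
      · ext t
        simp only [mem_preimage, mem_iUnion, st, mem_prod, exists_prop, Ix, mem_ofPred_eq, a, l]
        exact exists_congr fun q => by tauto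
    · intro q hq q' hq' hne
      refine Set.disjoint_left.2 fun t ht ht' => ?_
      exact Set.disjoint_left.1 (hdis hq.1 hq'.1 hne) (show (x, t) ∈ _ from ⟨hq.2, ht⟩) ⟨hq'.2, ht'⟩
  have h3 : (⋃ q ∈ I, st h m q) ⊆ F := by
    refine iUnion₂_subset ?_
    rintro q ⟨X, e, ⟨Y, hY1, hY2⟩, hmin⟩
    rw [← e, ← hY1]
    exact hF _ _ hY2
  calc (m : ℝ≥0∞) * volume E ≤ m * (ENNReal.ofReal (1 - μ) * volume (⋃ q ∈ I, tl h q)) := by gcongr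
    _ = ENNReal.ofReal (1 - μ) * (m * volume (⋃ q ∈ I, tl h q)) := by ring
    _ ≤ ENNReal.ofReal (1 - μ) * ((m + 1) * volume (⋃ q ∈ I, st h m q)) := by gcongr
    _ ≤ _ := by gcongr

end tiles

end Hk

namespace Hk

section mp

lemma norm_le_of_coord {x : En n} {b : ℝ} (hb : ∀ i, |x i| ≤ b) : ‖x‖ ≤ n * b := by
  rw [sum_single_eq x]
  refine (norm_sum_le _ _).trans ?_
  have : ∀ i ∈ Finset.univ, ‖x i • (EuclideanSpace.single i (1:ℝ) : En n)‖ ≤ b := by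
    intro i _
    rw [norm_smul]
    simpa using hb i
  refine (Finset.sum_le_card_nsmul _ _ _ this).trans ?_
  simp

lemma coord_le_norm (x : En n) (i : Fin n) : |x i| ≤ ‖x‖ := by
  have := PiLp.norm_apply_le x i
  simpa using this

def ctr (h : ℝ) (q : TI n) : En n := WithLp.toLp 2 fun i => ((q.2.1 i : ℝ) + 1 / 2) * hh h q.1
def tct (h : ℝ) (q : TI n) : ℝ := q.2.2 * hh h q.1 ^ 2 + hh h q.1 ^ 2 / 2

lemma ctr_mem {h : ℝ} (hp : 0 < h) (q : TI n) {x : En n} {t : ℝ} (hx : ‖x - ctr h q‖ ≤ hh h q.1 / 4)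
    (ht1 : tct h q - hh h q.1 ^ 2 / 4 ≤ t) (ht2 : t ≤ tct h q) : (x, t) ∈ tl h q := by
  have h0 := hh_pos hp q.1
  have h02 : 0 < hh h q.1 ^ 2 := by positivity
  unfold tct at *
  refine ⟨(mem_cube hp).2 fun i => ?_, ?_, ?_⟩
  · have h1 := (coord_le_norm (x - ctr h q) i).trans hx
    have e : (x - ctr h q) i = x i - ((q.2.1 i : ℝ) + 1 / 2) * hh h q.1 := rfl
    rw [e, abs_le] at h1
    simp only
    constructor <;> linarith [h1.1, h1.2]
  · simp only; linarith
  · simp only; linarith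

lemma tile_ball (hn : 0 < n) {ν : ℝ} (hν : 0 < ν) :
    ∃ ε μ : ℝ, 0 < ε ∧ 0 < μ ∧ μ < 1 ∧ ∀ (u : En n × ℝ → ℝ) (β : En n → ℝ) (E : Set (En n × ℝ)) (q : TI n)
      (h L : ℝ), ContDiff ℝ 2 u → Drift β → 0 < h → 0 < L →
      Dr β (ctr h q) (hh h q.1 / 4) ≤ ENNReal.ofReal ε →
      (∀ X ∈ cyl (ctr h q) (hh h q.1 / 4) (tct h q - hh h q.1 ^ 2 / 4) (tct h q), SupAt ν β u X ∧ 0 ≤ u X) →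
      full h μ E q → (∀ X ∈ E, L < u X) →
      ∀ x, ‖x - ctr h q‖ ≤ hh h q.1 / 8 → L / 2 ≤ u (x, tct h q) := by
  obtain ⟨ε, μ₀, hε, hμ₀, H⟩ := growth_small hn hν
  refine ⟨ε, min (μ₀ / 8 ^ (n + 2)) (1 / 2), hε, by positivity,
    (min_le_right _ _).trans_lt (by norm_num), ?_⟩
  intro u β E q h L hu hβ hp hL hD hsup hf hE x hx
  have h0 := hh_pos hp q.1
  set h' := hh h q.1 with hh'
  have hin : ∀ X ∈ cyl x (h' / 8) (tct h q - (h' / 8) ^ 2) (tct h q),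
      X ∈ cyl (ctr h q) (h' / 4) (tct h q - h' ^ 2 / 4) (tct h q) := by
    intro X hX
    rw [mem_cyl] at hX ⊢
    have := norm_sub_le_norm_sub_add_norm_sub X.1 x (ctr h q)
    refine ⟨by linarith, by nlinarith [hX.2.1], hX.2.2⟩
  have hL' : (0:ℝ) ≤ 1 / L := by positivity
  have := H (fun X => (1 / L) * (- u X) + 1) β x (h' / 8) (tct h q) (by have := hu.neg; fun_prop) hβ
    (by positivity) (le_trans (Dr_mono ?_) hD) ?_ ?_ ?_
  · have e : 1 / L * (- u (x, tct h q)) + 1 = 1 - u (x, tct h q) / L := by ring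
    rw [e] at this
    have h2 : 1 / 2 ≤ u (x, tct h q) / L := by linarith
    rw [le_div_iff₀ hL] at h2
    linarith
  · intro y hy
    rw [mem_closedBall, dist_eq_norm] at *
    have := norm_sub_le_norm_sub_add_norm_sub y x (ctr h q)
    linarith
  · intro X hX
    exact SubAt.add_const (contDiff_const.mul hu.neg)
      (SubAt.const_mul hu.neg (hsup X (hin X hX)).1 hL') 1
  · intro X hX
    have := mul_nonneg hL' (hsup X (hin X hX)).2
    linarith
  · refine (measure_mono ?_).trans (hf.trans (ENNReal.ofReal_le_ofReal ?_))
    · rintro X ⟨hX, hv⟩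
      have h1 := mem_cyl.1 (hin X hX)
      refine ⟨ctr_mem hp q h1.1 h1.2.1 h1.2.2, fun hXE => ?_⟩
      have h2 := hE X hXE
      have h3 : 1 < 1 / L * u X := by rw [one_div, ← div_eq_inv_mul, lt_div_iff₀ hL]; linarith
      have hv' : 0 < 1 / L * (- u X) + 1 := hv
      linarith
    · calc min (μ₀ / 8 ^ (n + 2)) (1 / 2) * hh h q.1 ^ (n + 2) ≤ μ₀ / 8 ^ (n + 2) * hh h q.1 ^ (n + 2) := by
            gcongr; exact min_le_left _ _
        _ = _ := by rw [← hh', div_pow]; field_simp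

lemma child_stack {h : ℝ} (hp : 0 < h) {m j : ℕ} {X Y : En n × ℝ} (hY : Y ∈ st h m (tid h j X)) :
    (∀ i, |(Y.1 - ctr h (tid h (j + 1) X)) i| ≤ 2 * hh h (j + 1)) ∧
    tct h (tid h (j + 1) X) + hh h (j + 1) ^ 2 / 2 ≤ Y.2 ∧
    Y.2 ≤ tct h (tid h (j + 1) X) + 4 * (1 + m) * hh h (j + 1) ^ 2 := by
  have h0 := hh_pos hp (j + 1)
  set H := hh h (j + 1) with hH
  have eH : hh h j = 2 * H := hh_succ h j
  have e1 : ∀ x : ℝ, ⌊x / hh h j⌋ = ⌊x / H⌋ / 2 := by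
    intro x
    rw [show (2:ℤ) = ((2:ℕ):ℤ) from rfl, ← Int.floor_div_natCast, eH, div_div]
    congr 2; push_cast; ring
  have e2 : ∀ x : ℝ, ⌊x / hh h j ^ 2⌋ = ⌊x / H ^ 2⌋ / 4 := by
    intro x
    rw [show (4:ℤ) = ((4:ℕ):ℤ) from rfl, ← Int.floor_div_natCast, eH, div_div]
    congr 2; push_cast; ring
  obtain ⟨hY1, hY2, hY3⟩ := hY
  simp only [tid] at hY1 hY2 hY3
  rw [mem_cube hp] at hY1
  refine ⟨fun i => ?_, ?_, ?_⟩
  · have h1 := hY1 i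
    rw [e1, eH] at h1
    have e : (Y.1 - ctr h (tid h (j + 1) X)) i = Y.1 i - ((⌊X.1 i / H⌋ : ℝ) + 1 / 2) * H := rfl
    rw [e]
    set k := ⌊X.1 i / H⌋
    have a1 : ((2 * (k / 2) : ℤ) : ℝ) ≤ k := by exact_mod_cast (by omega)
    have a2 : (k : ℝ) ≤ ((2 * (k / 2) + 1 : ℤ) : ℝ) := by exact_mod_cast (by omega)
    push_cast at a1 a2
    set K : ℝ := ((k / 2 : ℤ) : ℝ)
    rw [abs_le]
    constructor <;> nlinarith [h1.1, h1.2]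
  · have e : tct h (tid h (j + 1) X) = ⌊X.2 / H ^ 2⌋ * H ^ 2 + H ^ 2 / 2 := rfl
    rw [e]
    rw [e2, eH] at hY2
    set k := ⌊X.2 / H ^ 2⌋
    have a2 : (k : ℝ) ≤ ((4 * (k / 4) + 3 : ℤ) : ℝ) := by exact_mod_cast (by omega)
    push_cast at a2
    set K : ℝ := ((k / 4 : ℤ) : ℝ)
    nlinarith [sq_nonneg H]
  · have e : tct h (tid h (j + 1) X) = ⌊X.2 / H ^ 2⌋ * H ^ 2 + H ^ 2 / 2 := rfl
    rw [e]
    rw [e2, eH] at hY3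
    set k := ⌊X.2 / H ^ 2⌋
    have a2 : ((4 * (k / 4) : ℤ) : ℝ) ≤ (k : ℝ) := by exact_mod_cast (by omega)
    push_cast at a2
    set K : ℝ := ((k / 4 : ℤ) : ℝ)
    nlinarith [sq_nonneg H]

def base (M : ℕ) (q : TI n) : Prop := (∀ i, -(2 * (M:ℤ)) ≤ q.2.1 i ∧ q.2.1 i < 2 * M) ∧ 0 ≤ q.2.2

lemma base_bd {M : ℕ} (hM : 0 < M) {X : En n × ℝ} (hb : base M (tid (1 / (M:ℝ)) 0 X)) :
    (∀ i, |X.1 i| ≤ 2) ∧ 0 ≤ X.2 := by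
  have hM' : (0:ℝ) < M := by exact_mod_cast hM
  simp only [base, tid, hh, pow_zero, div_one, div_div_eq_mul_div, one_div] at hb
  constructor
  · intro i
    obtain ⟨h1, h2⟩ := hb.1 i
    rw [Int.le_floor] at h1
    rw [Int.floor_lt] at h2
    rw [div_inv_eq_mul] at h1 h2
    push_cast at h1 h2
    rw [abs_le]
    constructor
    · by_contra hc; push Not at hc; nlinarith
    · by_contra hc; push Not at hc; nlinarith
  · have h1 := hb.2
    rw [Int.le_floor] at h1
    rw [le_div_iff₀ (by positivity)] at h1
    simpa using h1

lemma base_of {M : ℕ} (hM : 0 < M) {X : En n × ℝ} (h1 : ∀ i, |X.1 i| ≤ 1) (h2 : 0 ≤ X.2) :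
    base M (tid (1 / (M:ℝ)) 0 X) := by
  have hM' : (0:ℝ) < M := by exact_mod_cast hM
  simp only [base, tid, hh, pow_zero, div_one, one_div]
  refine ⟨fun i => ?_, ?_⟩
  · have := abs_le.1 (h1 i)
    rw [Int.le_floor, Int.floor_lt, div_inv_eq_mul]
    push_cast
    constructor <;> nlinarith [this.1, this.2]
  · rw [Int.le_floor]; push_cast; positivity

end mp

end Hk

namespace Hk

section mpu

lemma tile_geom {M : ℕ} (hM : 0 < M) {X : En n × ℝ} (hb : base M (tid (1 / (M:ℝ)) 0 X)) (j : ℕ) :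
    ‖ctr (1 / (M:ℝ)) (tid (1 / (M:ℝ)) j X)‖ ≤ 3 * n ∧
    0 ≤ tct (1 / (M:ℝ)) (tid (1 / (M:ℝ)) j X) - hh (1 / (M:ℝ)) j ^ 2 / 2 ∧
    tct (1 / (M:ℝ)) (tid (1 / (M:ℝ)) j X) ≤ X.2 + hh (1 / (M:ℝ)) j ^ 2 / 2 ∧
    hh (1 / (M:ℝ)) j ≤ 1 / M ∧ (1 / (M:ℝ)) ≤ 1 := by
  have hM' : (0:ℝ) < M := by exact_mod_cast hM
  have hM1 : (1:ℝ) ≤ M := by exact_mod_cast hM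
  have hp : (0:ℝ) < 1 / M := by positivity
  have hp1 : (1 / (M:ℝ)) ≤ 1 := by rw [div_le_one hM']; exact hM1
  have hle := hh_le hp j
  have h0 := hh_pos hp j
  obtain ⟨b1, b2⟩ := base_bd hM hb
  set H := hh (1 / (M:ℝ)) j with hH
  have h02 : 0 < H ^ 2 := by positivity
  refine ⟨?_, ?_, ?_, hle, hp1⟩
  · rw [mul_comm]
    refine norm_le_of_coord fun i => ?_
    have e : (ctr (1 / (M:ℝ)) (tid (1 / (M:ℝ)) j X)) i = ((⌊X.1 i / H⌋ : ℝ) + 1 / 2) * H := rfl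
    rw [e]
    have f1 := Int.floor_le (X.1 i / H)
    have f2 := Int.lt_floor_add_one (X.1 i / H)
    rw [le_div_iff₀ h0] at f1
    rw [div_lt_iff₀ h0] at f2
    have := abs_le.1 (b1 i)
    rw [abs_le]
    constructor <;> linarith [this.1, this.2]
  · have e : tct (1 / (M:ℝ)) (tid (1 / (M:ℝ)) j X) = (⌊X.2 / H ^ 2⌋ : ℝ) * H ^ 2 + H ^ 2 / 2 := rfl
    rw [e]
    have : (0:ℤ) ≤ ⌊X.2 / H ^ 2⌋ := Int.floor_nonneg.2 (by positivity)
    have : (0:ℝ) ≤ (⌊X.2 / H ^ 2⌋ : ℝ) := by exact_mod_cast this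
    have := mul_nonneg this h02.le
    linarith
  · have e : tct (1 / (M:ℝ)) (tid (1 / (M:ℝ)) j X) = (⌊X.2 / H ^ 2⌋ : ℝ) * H ^ 2 + H ^ 2 / 2 := rfl
    rw [e]
    have f1 := Int.floor_le (X.2 / H ^ 2)
    rw [le_div_iff₀ h02] at f1
    linarith

lemma small_tile {h : ℝ} (hp : 0 < h) {U : Set (En n × ℝ)} (hU : IsOpen U) {X : En n × ℝ} (hX : X ∈ U) :
    ∃ j, tl h (tid h (j + 1) X) ⊆ U := by
  obtain ⟨r, hr, hrU⟩ := Metric.isOpen_iff.1 hU X hX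
  have hlim : Filter.Tendsto (fun j : ℕ => hh h (j + 1)) Filter.atTop (nhds 0) := by
    have h1 : Filter.Tendsto (fun j : ℕ => h * (1 / 2 : ℝ) ^ (j + 1)) Filter.atTop (nhds (h * 0)) :=
      ((_root_.tendsto_pow_atTop_nhds_zero_of_lt_one (by norm_num) (by norm_num)).comp
        (Filter.tendsto_add_atTop_nat 1)).const_mul h
    rw [mul_zero] at h1
    refine h1.congr fun j => ?_
    unfold hh
    rw [div_pow, one_pow]; ring
  have hpos : 0 < min 1 (r / (n + 2)) := by positivity
  obtain ⟨j, hj⟩ := (hlim.eventually (gt_mem_nhds hpos)).exists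
  refine ⟨j, fun Y hY => hrU ?_⟩
  rw [mem_tl hp] at hY
  have h0 := hh_pos hp (j + 1)
  have h02 : 0 < hh h (j + 1) ^ 2 := by positivity
  simp only [tid, Prod.mk.injEq, true_and, funext_iff] at hY
  have hj1 := hj.trans_le (min_le_left _ _)
  have hj2 := hj.trans_le (min_le_right _ _)
  rw [lt_div_iff₀ (by positivity)] at hj2
  rw [mem_ball, Prod.dist_eq, max_lt_iff]
  constructor
  · rw [dist_eq_norm]
    refine (norm_le_of_coord (b := hh h (j + 1)) fun i => ?_).trans_lt (by nlinarith)
    have e := hY.1 i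
    have := Int.abs_sub_lt_one_of_floor_eq_floor e
    rw [← sub_div, abs_div, abs_of_pos h0, div_lt_one h0] at this
    exact this.le
  · have e := hY.2
    have := Int.abs_sub_lt_one_of_floor_eq_floor e
    rw [← sub_div, abs_div, abs_of_pos h02, div_lt_one h02] at this
    rw [Real.dist_eq]
    have hn' : (0:ℝ) ≤ n := Nat.cast_nonneg n
    nlinarith

def EE (M : ℕ) (σ θ L : ℝ) (u : En n × ℝ → ℝ) (k : ℕ) : Set (En n × ℝ) :=
  {X | base M (tid (1 / (M:ℝ)) 0 X) ∧ X.2 < 3 / 2 + k * σ ∧ θ ^ k * L < u X}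

lemma EE_tile {M : ℕ} (hM : 0 < M) {σ θ L : ℝ} {u : En n × ℝ → ℝ} (hu : Continuous u) (k : ℕ) :
    ∀ X ∈ EE M σ θ L u k, ∃ j, tl (1 / (M:ℝ)) (tid (1 / (M:ℝ)) (j + 1) X) ⊆ EE M σ θ L u k := by
  have hM' : (0:ℝ) < M := by exact_mod_cast hM
  have hp : (0:ℝ) < 1 / M := by positivity
  intro X hX
  have hU : IsOpen {X : En n × ℝ | X.2 < 3 / 2 + k * σ ∧ θ ^ k * L < u X} :=
    (isOpen_lt continuous_snd continuous_const).inter (isOpen_lt continuous_const hu)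
  obtain ⟨j, hj⟩ := small_tile hp hU (X := X) hX.2
  refine ⟨j, fun Y hY => ⟨?_, hj hY⟩⟩
  rw [mem_tl hp] at hY
  have := tid_mono (Nat.zero_le (j + 1)) hY
  rw [this]; exact hX.1

lemma EE_meas {M : ℕ} (hM : 0 < M) {σ θ L : ℝ} {u : En n × ℝ → ℝ} (hu : Continuous u) (k : ℕ) :
    MeasurableSet (EE M σ θ L u k) := by
  have hM' : (0:ℝ) < M := by exact_mod_cast hM
  have hp : (0:ℝ) < 1 / M := by positivity
  have : EE M σ θ L u k = ⋃ q ∈ {q : TI n | tl (1 / (M:ℝ)) q ⊆ EE M σ θ L u k}, tl (1 / (M:ℝ)) q := by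
    ext X
    constructor
    · intro hX
      obtain ⟨j, hj⟩ := EE_tile hM hu k X hX
      exact mem_iUnion₂.2 ⟨_, hj, (mem_tl hp).2 rfl⟩
    · intro hX
      obtain ⟨q, hq, hX⟩ := mem_iUnion₂.1 hX
      exact hq hX
  rw [this]
  exact MeasurableSet.biUnion (Set.to_countable _) fun q _ => measurableSet_tl _ _

end mpu

end Hk

namespace Hk

section mpu2

lemma Spread.mono_eps {ν ε ε' c R τ T D : ℝ} (h : ε' ≤ ε) (H : Spread n ν ε c R τ T D) : Spread n ν ε' c R τ T D :=
  fun u β z ρ t₀ m hu hβ hρ hm hD => H u β z ρ t₀ m hu hβ hρ hm (hD.trans (ENNReal.ofReal_le_ofReal h))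

set_option maxHeartbeats 1000000 in
/-- one step of the ink-spot growth -/
lemma mp_step (hn : 0 < n) {ν ε₁ μ' c R₁ Rb : ℝ} {m M ks : ℕ} (hM : 0 < M)
    (hμ0 : 0 < μ') (hμ1 : μ' < 1) (hc : 0 < c) (hm : 0 < m)
    (Ht : ∀ (u : En n × ℝ → ℝ) (β : En n → ℝ) (E : Set (En n × ℝ)) (q : TI n)
      (h L : ℝ), ContDiff ℝ 2 u → Drift β → 0 < h → 0 < L →
      Dr β (ctr h q) (hh h q.1 / 4) ≤ ENNReal.ofReal ε₁ →
      (∀ X ∈ cyl (ctr h q) (hh h q.1 / 4) (tct h q - hh h q.1 ^ 2 / 4) (tct h q), SupAt ν β u X ∧ 0 ≤ u X) →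
      full h μ' E q → (∀ X ∈ E, L < u X) →
      ∀ x, ‖x - ctr h q‖ ≤ hh h q.1 / 8 → L / 2 ≤ u (x, tct h q))
    (Hs : Spread n ν ε₁ c R₁ 32 (256 * (1 + m)) (16 * n)) (hR₁ : 0 ≤ R₁)
    (hMk : ((m:ℝ) + 1) * (ks + 1) ≤ M ^ 2)
    (hRb : 3 * n + R₁ + 1 ≤ Rb)
    {u : En n × ℝ → ℝ} {β : En n → ℝ} (hu : ContDiff ℝ 2 u) (hβ : Drift β) {L : ℝ} (hL : 0 < L)
    (hD : Dr β 0 Rb ≤ ENNReal.ofReal ε₁)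
    (hsup : ∀ X ∈ cyl (0 : En n) Rb 0 8, SupAt ν β u X ∧ 0 ≤ u X) {k : ℕ} (hk : k < ks)
    (hb : ∀ X, ¬ full (1 / (M:ℝ)) μ' (EE M ((m + 1) * (1 / (M:ℝ)) ^ 2) (c / 4) L u k) (tid (1 / (M:ℝ)) 0 X)) :
    (m : ℝ≥0∞) * volume (EE M ((m + 1) * (1 / (M:ℝ)) ^ 2) (c / 4) L u k) ≤
      ENNReal.ofReal (1 - μ') * ((m + 1) * volume (EE M ((m + 1) * (1 / (M:ℝ)) ^ 2) (c / 4) L u (k + 1))) := by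
  have hM' : (0:ℝ) < M := by exact_mod_cast hM
  set σ : ℝ := (m + 1) * (1 / (M:ℝ)) ^ 2 with hσ
  set h : ℝ := 1 / (M:ℝ) with hh0
  have hp : 0 < h := by positivity
  have hks : (ks + 1) * σ ≤ 1 := by
    rw [hσ, hh0, div_pow, one_pow]
    have : (((ks:ℝ) + 1) * ((m + 1) * (1 / (M:ℝ) ^ 2))) = ((m:ℝ) + 1) * (ks + 1) / M ^ 2 := by ring
    rw [this, div_le_one (by positivity)]
    exact hMk
  have hσ0 : 0 < σ := by positivity
  have hkσ : (k:ℝ) * σ ≤ 1 := by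
    have : (k:ℝ) ≤ ks := by exact_mod_cast hk.le
    have := mul_le_mul_of_nonneg_right this hσ0.le
    linarith
  have hσ1 : σ ≤ 1 := by
    have : (0:ℝ) ≤ ks * σ := by positivity
    linarith
  have hθ : 0 < (c / 4) ^ k * L := by positivity
  refine ink hp hμ0.le hμ1 hm (EE_meas hM hu.continuous k) (EE_tile hM hu.continuous k) hb ?_
  intro j X₀ hf Y hY
  obtain ⟨X, hXt, hXE⟩ := hf.nonempty hp hμ1
  rw [mem_tl hp] at hXt
  have hXt : tid h (j + 1) X = tid h (j + 1) X₀ := hXt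
  rw [← hXt] at hf
  rw [← tid_succ j hXt] at hY
  obtain ⟨hX1, hX2, hX3⟩ := hXE
  obtain ⟨g1, g2, g3, g4, g5⟩ := tile_geom hM hX1 (j + 1)
  rw [← hh0] at g1 g2 g3 g4 g5
  obtain ⟨s1, s2, s3⟩ := child_stack hp hY
  have hH0 := hh_pos hp (j + 1)
  have eH := hh_succ h j
  have hH1 : 2 * hh h (j + 1) ≤ h := by rw [← eH]; exact hh_le hp j
  set H := hh h (j + 1) with hH
  have hqH : hh h (tid h (j + 1) X).1 = H := rfl
  set q := tid h (j + 1) X with hq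
  have hHσ : 4 * (1 + m) * H ^ 2 ≤ σ := by
    have : 4 * H ^ 2 ≤ h ^ 2 := by nlinarith
    rw [hσ]
    nlinarith [Nat.cast_nonneg (α := ℝ) m]
  have hH2 : 4 * H ^ 2 ≤ 1 := by nlinarith
  have hn0 : (0:ℝ) ≤ n := Nat.cast_nonneg n
  have hH20 : 0 < H ^ 2 := by positivity
  have e32 : 32 * (H / 8) ^ 2 = H ^ 2 / 2 := by ring
  have e256 : 256 * (1 + (m:ℝ)) * (H / 8) ^ 2 = 4 * (1 + m) * H ^ 2 := by ring
  have hR1H : R₁ * (H / 8) ≤ R₁ * 1 := by gcongr; linarith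
  have hball : ∀ r, r ≤ R₁ + 1 → closedBall (ctr h q) r ⊆ closedBall (0 : En n) Rb := by
    intro r hr y hy
    rw [mem_closedBall, dist_eq_norm] at *
    have := norm_sub_le_norm_sub_add_norm_sub y (ctr h q) 0
    rw [sub_zero, sub_zero] at *
    linarith
  have hq1 := Ht u β _ q h ((c / 4) ^ k * L) hu hβ hp hθ
    (by rw [hqH]; exact (Dr_mono (hball _ (by linarith))).trans hD) (by
      intro X hX
      rw [hqH] at hX
      rw [mem_cyl] at hX
      apply hsup
      rw [mem_cyl]
      refine ⟨?_, by linarith [hX.2.1], by linarith [hX.2.2]⟩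
      rw [← dist_eq_norm]
      exact hball (H / 4) (by linarith) (by rw [mem_closedBall, dist_eq_norm]; exact hX.1)) hf
    (fun X hX => hX.2.2)
  rw [hqH] at hq1
  have hY4 : c * ((c / 4) ^ k * L / 2) ≤ u (Y.1, Y.2) := by
    refine Hs u β (ctr h q) (H / 8) (tct h q) ((c / 4) ^ k * L / 2) hu hβ (by positivity) (by positivity)
      ((Dr_mono (hball _ (by linarith))).trans hD) ?_ ?_ hq1 Y.1 Y.2 ?_ ?_ ?_
    · intro X hX
      refine (hsup X ?_).1
      rw [mem_cyl] at hX ⊢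
      refine ⟨?_, by linarith [hX.2.1], by linarith [hX.2.2]⟩
      rw [← dist_eq_norm]
      exact hball (R₁ * (H / 8)) (by linarith) (by rw [mem_closedBall, dist_eq_norm]; exact hX.1)
    · intro X hX
      refine (hsup X ?_).2
      rw [mem_cyl] at hX ⊢
      refine ⟨?_, by linarith [hX.2.1], by linarith [hX.2.2]⟩
      rw [← dist_eq_norm]
      exact hball (R₁ * (H / 8)) (by linarith) (by rw [mem_closedBall, dist_eq_norm]; exact hX.1)
    · refine (norm_le_of_coord s1).trans (le_of_eq ?_)
      ring
    · linarith
    · linarith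
  have hYp : 0 ≤ Y.2 := by linarith
  refine ⟨?_, ?_, ?_⟩
  · have hYX : tid h j (Y.1, X.2) = tid h j X := by
      obtain ⟨hY1, -⟩ := hY
      have : ∀ i, ⌊Y.1 i / hh h j⌋ = ⌊X.1 i / hh h j⌋ := hY1
      simp only [tid, Prod.mk.injEq, true_and, funext_iff]
      exact ⟨this, trivial⟩
    have h1 := tid_mono (Nat.zero_le j) hYX
    rw [← h1] at hX1
    refine ⟨hX1.1, ?_⟩
    exact Int.floor_nonneg.2 (by positivity)
  · have hY3 := hY.2.2
    simp only [tid] at hY3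
    have f1 := Int.floor_le (X.2 / hh h j ^ 2)
    have hHj : 0 < hh h j ^ 2 := by have := hh_pos hp j; positivity
    rw [le_div_iff₀ hHj] at f1
    have : hh h j ^ 2 ≤ h ^ 2 := by
      have := hh_le hp j
      have := hh_pos hp j
      gcongr
    push_cast
    have h5 : (m:ℝ) * hh h j ^ 2 ≤ m * h ^ 2 := by gcongr
    rw [hσ] at hX2 ⊢
    linarith
  · refine lt_of_lt_of_le ?_ hY4
    rw [pow_succ]
    have : 0 < c * ((c / 4) ^ k * L) := by positivity
    linarith

set_option maxHeartbeats 1000000 in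
lemma mp_unit (hn : 0 < n) {ν μ : ℝ} (hν : 0 < ν) (hμ : 0 < μ) :
    ∃ ε c R : ℝ, 0 < ε ∧ 0 < c ∧ c ≤ 1 ∧ 1 ≤ R ∧ ∀ (u : En n × ℝ → ℝ) (β : En n → ℝ) (L : ℝ),
      ContDiff ℝ 2 u → Drift β → 0 < L → Dr β 0 R ≤ ENNReal.ofReal ε →
      (∀ X ∈ cyl (0 : En n) R 0 8, SupAt ν β u X ∧ 0 ≤ u X) →
      ENNReal.ofReal μ ≤ volume {X ∈ cyl (0 : En n) 1 0 1 | L < u X} →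
      ∀ x, ‖x‖ ≤ 1 → c * L ≤ u (x, 4) := by
  have hn0 : (1:ℝ) ≤ n := by exact_mod_cast hn
  obtain ⟨ε₀, μ', hε₀, hμ0, hμ1, Ht⟩ := tile_ball (n := n) hn hν
  obtain ⟨m, hm⟩ := exists_nat_gt (1 / μ')
  have hm0 : (0:ℝ) < m := lt_trans (by positivity) hm
  have hmp : 0 < m := by exact_mod_cast hm0
  rw [div_lt_iff₀ hμ0] at hm
  obtain ⟨ε₁, c, R₁, hε₁, hc, hc1, hR₁, Hs⟩ := spread_small (n := n) hn hν (τ := 32) (T := 256 * (1 + m))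
    (D := 16 * n) (by norm_num) (by linarith) (by linarith)
  have hq1 : 1 < m / ((m + 1) * (1 - μ')) := by
    rw [lt_div_iff₀ (by have : 0 < 1 - μ' := by linarith
                        positivity)]
    nlinarith
  set q : ℝ := m / ((m + 1) * (1 - μ')) with hq
  set B : ℝ := (2 * n) ^ n * om n * 3 with hB
  obtain ⟨ks, hks⟩ := pow_unbounded_of_one_lt (B / μ) hq1
  rw [div_lt_iff₀ hμ] at hks
  let M : ℕ := (ks + 1) * (m + 1)
  have hM : 0 < M := Nat.mul_pos (by omega) (by omega)
  have hM1 : (1:ℝ) ≤ M := by exact_mod_cast hM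
  have hMk : ((m:ℝ) + 1) * (ks + 1) ≤ (M:ℝ) ^ 2 := by
    have : (M:ℝ) = (ks + 1) * (m + 1) := by simp only [M]; push_cast; ring
    have h2 : (M:ℝ) ≤ (M:ℝ) ^ 2 := by nlinarith
    linarith
  obtain ⟨ε₂, c₂, R₂, hε₂, hc₂, hc₂1, hR₂, Hs₂⟩ := spread_small (n := n) hn hν (τ := 32 * (M:ℝ) ^ 2)
    (T := 256 * (M:ℝ) ^ 2) (D := 8 * M * (1 + 3 * n)) (by positivity) (by nlinarith) (by nlinarith)
  have hR₁0 : 0 ≤ R₁ := le_trans (by positivity) hR₁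
  have hR₂0 : 0 ≤ R₂ := le_trans (by positivity) hR₂
  set ε := min ε₀ (min ε₁ ε₂) with hε
  have e0 : ε ≤ ε₀ := min_le_left _ _
  have e1 : ε ≤ ε₁ := (min_le_right _ _).trans (min_le_left _ _)
  have e2 : ε ≤ ε₂ := (min_le_right _ _).trans (min_le_right _ _)
  set R := 3 * n + R₁ + R₂ + 1 with hR
  refine ⟨ε, c₂ * ((c / 4) ^ ks / 2), R, by positivity, by positivity, ?_, by linarith, ?_⟩
  · have : (c / 4) ^ ks ≤ 1 := pow_le_one₀ (by positivity) (by linarith)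
    have h3 : 0 ≤ (c / 4) ^ ks := by positivity
    nlinarith
  intro u β L hu hβ hL hD hsup hvol x hx
  have hM' : (0:ℝ) < M := by linarith
  have hp : (0:ℝ) < 1 / M := by positivity
  have Ht' : ∀ (u : En n × ℝ → ℝ) (β : En n → ℝ) (E : Set (En n × ℝ)) (q : TI n)
      (h L : ℝ), ContDiff ℝ 2 u → Drift β → 0 < h → 0 < L →
      Dr β (ctr h q) (hh h q.1 / 4) ≤ ENNReal.ofReal ε →
      (∀ X ∈ cyl (ctr h q) (hh h q.1 / 4) (tct h q - hh h q.1 ^ 2 / 4) (tct h q), SupAt ν β u X ∧ 0 ≤ u X) →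
      full h μ' E q → (∀ X ∈ E, L < u X) →
      ∀ x, ‖x - ctr h q‖ ≤ hh h q.1 / 8 → L / 2 ≤ u (x, tct h q) :=
    fun u β E q h L hu hβ hp hL hD => Ht u β E q h L hu hβ hp hL (hD.trans (ENNReal.ofReal_le_ofReal e0))
  have hMp : (0:ℝ) < (M:ℝ) ^ 2 := by positivity
  have hks0 : (0:ℝ) ≤ ks := Nat.cast_nonneg ks
  set σ : ℝ := (m + 1) * (1 / (M:ℝ)) ^ 2 with hσ
  have hσ0 : 0 < σ := by positivity
  have hksσ : (ks:ℝ) * σ ≤ 1 := by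
    have h1 : (ks + 1) * σ ≤ 1 := by
      rw [hσ, div_pow, one_pow]
      have : (((ks:ℝ) + 1) * ((m + 1) * (1 / (M:ℝ) ^ 2))) = ((m:ℝ) + 1) * (ks + 1) / M ^ 2 := by ring
      rw [this, div_le_one (by positivity)]
      exact hMk
    linarith
  have hn0' : (0:ℝ) ≤ n := by linarith
  by_cases hbase : ∃ k ≤ ks, ∃ X, full (1 / (M:ℝ)) μ' (EE M σ (c / 4) L u k) (tid (1 / (M:ℝ)) 0 X)
  · obtain ⟨k, hk, X₀, hf⟩ := hbase
    obtain ⟨X, hXt, hX1, hX2, hX3⟩ := hf.nonempty hp hμ1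
    rw [mem_tl hp] at hXt
    have hXt : tid (1 / (M:ℝ)) 0 X = tid (1 / (M:ℝ)) 0 X₀ := hXt
    rw [← hXt] at hf
    obtain ⟨g1, g2, g3, g4, g5⟩ := tile_geom hM hX1 0
    have hk' : (k:ℝ) * σ ≤ 1 := by
      have : (k:ℝ) ≤ ks := by exact_mod_cast hk
      have := mul_le_mul_of_nonneg_right this hσ0.le
      linarith
    have eh : hh (1 / (M:ℝ)) 0 = 1 / M := by simp [hh]
    rw [eh] at g2 g3 g4
    have hqH : hh (1 / (M:ℝ)) (tid (1 / (M:ℝ)) 0 X).1 = 1 / M := eh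
    set q' := tid (1 / (M:ℝ)) 0 X with hq'
    have h2 : (1 / (M:ℝ)) ^ 2 ≤ 1 := pow_le_one₀ hp.le g5
    have h20 : 0 < (1 / (M:ℝ)) ^ 2 := by positivity
    have hball : ∀ r, r ≤ R₂ + 1 → closedBall (ctr (1 / (M:ℝ)) q') r ⊆ closedBall (0 : En n) R := by
      intro r hr y hy
      rw [mem_closedBall, dist_eq_norm] at *
      have := norm_sub_le_norm_sub_add_norm_sub y (ctr (1 / (M:ℝ)) q') 0
      rw [sub_zero, sub_zero] at *
      linarith
    have hθ : 0 < (c / 4) ^ k * L := by positivity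
    have hq1 := Ht' u β _ q' (1 / (M:ℝ)) ((c / 4) ^ k * L) hu hβ hp hθ
      (by rw [hqH]; exact (Dr_mono (hball _ (by linarith))).trans hD) (by
        intro X hX
        rw [hqH] at hX
        rw [mem_cyl] at hX
        apply hsup
        rw [mem_cyl]
        refine ⟨?_, by linarith [hX.2.1], by linarith [hX.2.2]⟩
        rw [← dist_eq_norm]
        exact hball (1 / (M:ℝ) / 4) (by linarith) (by rw [mem_closedBall, dist_eq_norm]; exact hX.1)) hf
      (fun X hX => hX.2.2)
    rw [hqH] at hq1
    have eT : 256 * (M:ℝ) ^ 2 * (1 / (M:ℝ) / 8) ^ 2 = 4 := by field_simp; norm_num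
    have eτ : 32 * (M:ℝ) ^ 2 * (1 / (M:ℝ) / 8) ^ 2 = 1 / 2 := by field_simp; norm_num
    have eD : 8 * (M:ℝ) * (1 + 3 * n) * (1 / (M:ℝ) / 8) = 1 + 3 * n := by field_simp
    have eR : R₂ * (1 / (M:ℝ) / 8) ≤ R₂ + 1 := by
      have : R₂ * (1 / (M:ℝ) / 8) ≤ R₂ * 1 := by gcongr; linarith
      linarith
    have hcy : ∀ X ∈ cyl (ctr (1 / (M:ℝ)) q') (R₂ * (1 / (M:ℝ) / 8)) (tct (1 / (M:ℝ)) q')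
        (tct (1 / (M:ℝ)) q' + 256 * (M:ℝ) ^ 2 * (1 / (M:ℝ) / 8) ^ 2), X ∈ cyl (0 : En n) R 0 8 := by
      intro X hX
      rw [eT] at hX
      rw [mem_cyl] at hX ⊢
      refine ⟨?_, by linarith [hX.2.1], by linarith [hX.2.2]⟩
      rw [← dist_eq_norm]
      exact hball _ eR (by rw [mem_closedBall, dist_eq_norm]; exact hX.1)
    have := Hs₂ u β (ctr (1 / (M:ℝ)) q') (1 / (M:ℝ) / 8) (tct (1 / (M:ℝ)) q') ((c / 4) ^ k * L / 2) hu hβ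
      (by positivity) (by positivity)
      (((Dr_mono (hball _ eR)).trans hD).trans (ENNReal.ofReal_le_ofReal e2))
      (fun X hX => (hsup X (hcy X hX)).1) (fun X hX => (hsup X (hcy X hX)).2) hq1 x 4
      (by rw [eD]; have := norm_sub_le x (ctr (1 / (M:ℝ)) q'); linarith)
      (by rw [eτ]; linarith) (by rw [eT]; linarith)
    refine le_trans ?_ this
    have h6 : (c / 4) ^ ks ≤ (c / 4) ^ k := pow_le_pow_of_le_one (by positivity) (by linarith) hk
    have h7 : c₂ * ((c / 4) ^ ks / 2) * L = c₂ * ((c / 4) ^ ks * L / 2) := by ring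
    rw [h7]
    gcongr
  · exfalso
    push Not at hbase
    have hstep : ∀ k < ks, (m : ℝ≥0∞) * volume (EE M σ (c / 4) L u k) ≤
      ENNReal.ofReal (1 - μ') * ((m + 1) * volume (EE M σ (c / 4) L u (k + 1))) := by
      intro k hk
      exact mp_step hn hM hμ0 hμ1 hc hmp Ht' (Hs.mono_eps e1) hR₁0 hMk (by linarith) hu hβ hL hD hsup hk
        (hbase k hk.le)
    have hB0 : ∀ k ≤ ks, volume (EE M σ (c / 4) L u k) ≤ ENNReal.ofReal B := by
      intro k hk
      have : EE M σ (c / 4) L u k ⊆ cyl (0 : En n) (2 * n) 0 3 := by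
        intro X hX
        obtain ⟨b1, b2⟩ := base_bd hM hX.1
        have hk' : (k:ℝ) * σ ≤ 1 := by
          have : (k:ℝ) ≤ ks := by exact_mod_cast hk
          have := mul_le_mul_of_nonneg_right this hσ0.le
          linarith
        rw [mem_cyl, sub_zero]
        refine ⟨?_, b2, by linarith [hX.2.1]⟩
        rw [mul_comm]
        exact norm_le_of_coord b1
      refine (measure_mono this).trans (le_of_eq ?_)
      rw [vol_cyl_le _ (by linarith) (by norm_num), hB, sub_zero]
    have hr : ∀ k < ks, q * (volume (EE M σ (c / 4) L u k)).toReal ≤ (volume (EE M σ (c / 4) L u (k + 1))).toReal := by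
      intro k hk
      have h1 := hstep k hk
      have hfin : volume (EE M σ (c / 4) L u (k + 1)) ≠ ⊤ :=
        ne_top_of_le_ne_top ENNReal.ofReal_ne_top (hB0 (k + 1) hk)
      have h2 := ENNReal.toReal_mono (by
        refine ENNReal.mul_ne_top ENNReal.ofReal_ne_top (ENNReal.mul_ne_top ?_ hfin)
        finiteness) h1
      rw [ENNReal.toReal_mul, ENNReal.toReal_mul, ENNReal.toReal_mul, ENNReal.toReal_ofReal (by linarith),
        ENNReal.toReal_natCast] at h2
      have e : ((m:ℝ≥0∞) + 1).toReal = m + 1 := by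
        have : ((m:ℝ≥0∞) + 1) = ((m + 1 : ℕ) : ℝ≥0∞) := by push_cast; rfl
        rw [this, ENNReal.toReal_natCast]; push_cast; rfl
      rw [e] at h2
      have h3 : 0 < 1 - μ' := by linarith
      rw [hq, div_mul_eq_mul_div, div_le_iff₀ (by positivity)]
      linarith
    have hind : ∀ k ≤ ks, q ^ k * μ ≤ (volume (EE M σ (c / 4) L u k)).toReal := by
      intro k
      induction k with
      | zero =>
        intro _
        have : {X ∈ cyl (0 : En n) 1 0 1 | L < u X} ⊆ EE M σ (c / 4) L u 0 := by
          rintro X ⟨hX, hXu⟩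
          rw [mem_cyl, sub_zero] at hX
          refine ⟨base_of hM (fun i => (coord_le_norm X.1 i).trans hX.1) hX.2.1, ?_, by simpa using hXu⟩
          push_cast; linarith [hX.2.2]
        have h1 := hvol.trans (measure_mono this)
        have hfin : volume (EE M σ (c / 4) L u 0) ≠ ⊤ :=
          ne_top_of_le_ne_top ENNReal.ofReal_ne_top (hB0 0 (Nat.zero_le _))
        have h2 := ENNReal.toReal_mono hfin h1
        rw [ENNReal.toReal_ofReal hμ.le] at h2
        simpa using h2
      | succ k ih =>
        intro hk
        have h1 := ih (by omega)
        have h2 := hr k (by omega)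
        rw [pow_succ]
        have : q * (q ^ k * μ) ≤ q * (volume (EE M σ (c / 4) L u k)).toReal := by gcongr
        linarith
    have h1 := hind ks le_rfl
    have hB1 : 0 ≤ B := by have := om_pos n; positivity
    have h2 := ENNReal.toReal_mono ENNReal.ofReal_ne_top (hB0 ks le_rfl)
    rw [ENNReal.toReal_ofReal hB1] at h2
    linarith

end mpu2

end Hk

namespace Hk

section mpscaled

lemma mp (hn : 0 < n) {ν μ : ℝ} (hν : 0 < ν) (hμ : 0 < μ) :
    ∃ ε c R : ℝ, 0 < ε ∧ 0 < c ∧ c ≤ 1 ∧ 1 ≤ R ∧ ∀ (u : En n × ℝ → ℝ) (β : En n → ℝ) (L : ℝ)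
      (z : En n) (ρ t₀ : ℝ),
      ContDiff ℝ 2 u → Drift β → 0 < L → 0 < ρ → Dr β z (ρ * R) ≤ ENNReal.ofReal ε →
      (∀ X ∈ cyl z (ρ * R) t₀ (t₀ + ρ ^ 2 * 8), SupAt ν β u X ∧ 0 ≤ u X) →
      ENNReal.ofReal (μ * ρ ^ (n + 2)) ≤ volume {X ∈ cyl z ρ t₀ (t₀ + ρ ^ 2) | L < u X} →
      ∀ x, ‖x - z‖ ≤ ρ → c * L ≤ u (x, t₀ + ρ ^ 2 * 4) := by
  obtain ⟨ε, c, R, hε, hc, hc1, hR, H⟩ := mp_unit (n := n) hn hν hμ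
  refine ⟨ε, c, R, hε, hc, hc1, hR, ?_⟩
  intro u β L z ρ t₀ hu hβ hL hρ hD hsup hvol x hx
  have hmem : ∀ X ∈ cyl (0 : En n) R 0 8, smap z t₀ ρ X ∈ cyl z (ρ * R) t₀ (t₀ + ρ ^ 2 * 8) := by
    intro X hX
    have := smap_mem (z := z) (t₀ := t₀) hρ hX
    simpa using this
  have := H (fun Y => u (smap z t₀ ρ Y)) (bsc β z ρ) L (contDiff_comp_smap hu) (hβ.bsc z hρ.le) hL
    (by rw [Dr_bsc z hρ]; simpa using hD)
    (fun X hX => ⟨SupAt.smap hu hρ.le (hsup _ (hmem X hX)).1, (hsup _ (hmem X hX)).2⟩) ?_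
    (ρ⁻¹ • (x - z)) ?_
  · have e : smap z t₀ ρ (ρ⁻¹ • (x - z), 4) = (x, t₀ + ρ ^ 2 * 4) := by
      simp only [smap]
      rw [smul_smul, mul_inv_cancel₀ hρ.ne']; simp
    rw [e] at this
    exact this
  · have e : {X ∈ cyl (0 : En n) 1 0 1 | L < u (smap z t₀ ρ X)} =
        smap z t₀ ρ ⁻¹' {X ∈ cyl z ρ t₀ (t₀ + ρ ^ 2) | L < u X} := by
      ext X
      have := smap_mem_cyl (z := z) (t₀ := t₀) hρ (y := 0) (R := 1) (s₀ := 0) (s₁ := 1) (X := X)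
      simp only [smul_zero, add_zero, mul_one, mul_zero] at this
      simp only [mem_ofPred_eq, mem_preimage, this]
    rw [e, volume_smap_preimage z t₀ hρ]
    calc ENNReal.ofReal μ = ENNReal.ofReal ((ρ ^ (n + 2))⁻¹) * ENNReal.ofReal (μ * ρ ^ (n + 2)) := by
          rw [← ENNReal.ofReal_mul (by positivity)]
          congr 1
          field_simp
      _ ≤ _ := by gcongr
  · rw [norm_smul, norm_inv, Real.norm_of_nonneg hρ.le, inv_mul_le_iff₀ hρ]; linarith

end mpscaled

section poly

/-- doubling phase -/
lemma doubling {ν S c R K1 : ℝ} (hc : 0 < c) (hK1 : 0 < K1) (hR : 0 < R) (H : Spread n ν S c R K1 K1 2)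
    {u : En n × ℝ → ℝ} {β : En n → ℝ} (hu : ContDiff ℝ 2 u) (hβ : Drift β) {z : En n} {t₀ ρ m r : ℝ}
    (hρ : 0 < ρ) (hm : 0 ≤ m)
    (hD : Dr β z (R * r) ≤ ENNReal.ofReal S)
    (hsup : ∀ X ∈ cyl z (R * r) t₀ (t₀ + K1 * r ^ 2), SupAt ν β u X ∧ 0 ≤ u X)
    (h0 : ∀ x : En n, ‖x - z‖ ≤ ρ → m ≤ u (x, t₀)) (k : ℕ) (hk : 2 ^ k * ρ ≤ r) :
    ∀ x : En n, ‖x - z‖ ≤ 2 ^ k * ρ → c ^ k * m ≤ u (x, t₀ + K1 * ρ ^ 2 * ((4 ^ k - 1) / 3)) := by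
  induction k with
  | zero => intro x hx; simpa using h0 x (by simpa using hx)
  | succ k ih =>
    intro x hx
    have hpk : (0:ℝ) < 2 ^ k * ρ := by positivity
    have hk1 : 2 ^ k * ρ ≤ r := by rw [pow_succ] at hk; linarith
    have e4 : ((4:ℝ) ^ k) = (2 ^ k) ^ 2 := by rw [← pow_mul, mul_comm, pow_mul]; norm_num
    have hsq : 4 ^ (k + 1) * ρ ^ 2 ≤ r ^ 2 := by
      have h1 : (2 ^ (k + 1) * ρ) ^ 2 ≤ r ^ 2 := by gcongr
      have h2 : (2 ^ (k + 1) * ρ) ^ 2 = 4 ^ (k + 1) * ρ ^ 2 := by rw [pow_succ, pow_succ 4, e4]; ring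
      linarith
    have h41 : (1:ℝ) ≤ 4 ^ k := one_le_pow₀ (by norm_num)
    have ht : K1 * ρ ^ 2 * ((4 ^ k - 1) / 3) + K1 * (2 ^ k * ρ) ^ 2 = K1 * ρ ^ 2 * ((4 ^ (k + 1) - 1) / 3) := by
      rw [mul_pow, ← e4, pow_succ 4]; ring
    have ht0 : 0 ≤ K1 * ρ ^ 2 * ((4 ^ k - 1) / 3) := by
      have : (0:ℝ) ≤ 4 ^ k - 1 := by linarith
      positivity
    have ht1 : K1 * ρ ^ 2 * ((4 ^ (k + 1) - 1) / 3) ≤ K1 * r ^ 2 := by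
      rw [mul_assoc]
      gcongr
      nlinarith [sq_nonneg ρ]
    have hRr : R * (2 ^ k * ρ) ≤ R * r := by gcongr
    have hcy : ∀ X ∈ cyl z (R * (2 ^ k * ρ)) (t₀ + K1 * ρ ^ 2 * ((4 ^ k - 1) / 3))
        (t₀ + K1 * ρ ^ 2 * ((4 ^ k - 1) / 3) + K1 * (2 ^ k * ρ) ^ 2), X ∈ cyl z (R * r) t₀ (t₀ + K1 * r ^ 2) := by
      intro X hX
      rw [mem_cyl] at hX ⊢
      refine ⟨hX.1.trans hRr, by linarith [hX.2.1], by linarith [hX.2.2]⟩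
    have := H u β z (2 ^ k * ρ) (t₀ + K1 * ρ ^ 2 * ((4 ^ k - 1) / 3)) (c ^ k * m) hu hβ hpk (by positivity)
      ((Dr_mono (closedBall_subset_closedBall hRr)).trans hD) (fun X hX => (hsup X (hcy X hX)).1)
      (fun X hX => (hsup X (hcy X hX)).2) (ih hk1) x (t₀ + K1 * ρ ^ 2 * ((4 ^ (k + 1) - 1) / 3))
      (by rw [pow_succ] at hx; linarith) (by linarith) (by linarith)
    rw [pow_succ, mul_comm _ c, mul_assoc]
    exact this

lemma exists_dyadic {ρ r : ℝ} (hρ : 0 < ρ) (hr : ρ ≤ r) : ∃ k : ℕ, 2 ^ k * ρ ≤ r ∧ r < 2 ^ (k + 1) * ρ := by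
  classical
  have hex : ∃ k : ℕ, r < 2 ^ (k + 1) * ρ := by
    obtain ⟨k, hk⟩ := pow_unbounded_of_one_lt (r / ρ) (one_lt_two)
    rw [div_lt_iff₀ hρ] at hk
    refine ⟨k, hk.trans_le ?_⟩
    rw [pow_succ]
    have : 0 < 2 ^ k * ρ := by positivity
    linarith
  refine ⟨Nat.find hex, ?_, Nat.find_spec hex⟩
  rcases Nat.eq_zero_or_pos (Nat.find hex) with h | h
  · rw [h]; simpa using hr
  · have := Nat.find_min hex (m := Nat.find hex - 1) (by omega)
    push Not at this
    rwa [Nat.sub_add_cancel h] at this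

lemma poly (hn : 0 < n) {ν : ℝ} (hν : 0 < ν) {S : ℝ} (hS0 : 0 ≤ S) {η Λ : ℝ} (hη : 0 < η) (hΛ : η ≤ Λ) :
    ∃ (r C : ℝ) (γ : ℕ), 0 < r ∧ r ≤ 1 ∧ 0 < C ∧ ∀ (u : En n × ℝ → ℝ) (β : En n → ℝ) (z : En n) (ρ t₀ m : ℝ),
      ContDiff ℝ 2 u → Drift β → Dr β 0 1 ≤ ENNReal.ofReal S →
      (∀ X ∈ cyl (0 : En n) 1 (-1) Λ, SupAt ν β u X ∧ 0 ≤ u X) →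
      ‖z‖ ≤ 1 / 2 → -1 ≤ t₀ → t₀ ≤ η / 2 → 0 < ρ → ρ ≤ r → 0 ≤ m →
      (∀ x : En n, ‖x - z‖ ≤ ρ → m ≤ u (x, t₀)) →
      ∀ y τ, ‖y‖ ≤ 1 / 4 → η ≤ τ → τ ≤ Λ → C * ρ ^ γ * m ≤ u (y, τ) := by
  obtain ⟨c, R, K1, hc, hc1, hR, hK1, H⟩ := step (n := n) hn hν hS0
  set r : ℝ := min (1 / (4 * R)) (min 1 (η / (4 * K1))) with hr
  have hR0 : 0 < R := by linarith
  have hr0 : 0 < r := by positivity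
  have hr1 : r ≤ 1 := (min_le_right _ _).trans (min_le_left _ _)
  have hrR : R * r ≤ 1 / 4 := by
    have : r ≤ 1 / (4 * R) := min_le_left _ _
    rw [le_div_iff₀ (by positivity)] at this
    linarith
  have hrK : K1 * r ^ 2 ≤ η / 4 := by
    have : r ≤ η / (4 * K1) := (min_le_right _ _).trans (min_le_right _ _)
    rw [le_div_iff₀ (by positivity)] at this
    have h2 : K1 * r ^ 2 ≤ K1 * r := by gcongr; nlinarith
    linarith
  obtain ⟨γ, hγ⟩ : ∃ γ : ℕ, (1 / 2 : ℝ) ^ γ ≤ c := by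
    obtain ⟨γ, hγ⟩ := exists_pow_lt_of_lt_one hc (show (1 / 2 : ℝ) < 1 by norm_num)
    exact ⟨γ, hγ.le⟩
  obtain ⟨M, hM⟩ := exists_nat_gt (max ((Λ + 1) / (K1 * (r / 2) ^ 2)) (4 * K1 / η))
  have hM1 := (le_max_left _ _).trans_lt hM
  have hM2 := (le_max_right _ _).trans_lt hM
  have hM0 : (0:ℝ) < M := lt_trans (by positivity) hM2
  rw [div_lt_iff₀ (by positivity)] at hM1 hM2
  refine ⟨r, c ^ M, γ, hr0, hr1, by positivity, ?_⟩
  intro u β z ρ t₀ m hu hβ hD hsup hz ht0 ht0' hρ hρr hm h0 y τ hy hτ hτΛ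
  obtain ⟨k, hk1, hk2⟩ := exists_dyadic hρ hρr
  have hball : ∀ w : En n, ‖w‖ ≤ 1 / 2 → ∀ s, s ≤ 1 / 4 → closedBall w s ⊆ closedBall (0 : En n) 1 := by
    intro w hw s hs x hx
    rw [mem_closedBall, dist_eq_norm] at *
    have := norm_sub_le_norm_sub_add_norm_sub x w 0
    rw [sub_zero, sub_zero] at *
    linarith
  have hcyl : ∀ w : En n, ‖w‖ ≤ 1 / 2 → ∀ s, s ≤ 1 / 4 → ∀ a b, -1 ≤ a → b ≤ Λ → ∀ X ∈ cyl w s a b,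
      SupAt ν β u X ∧ 0 ≤ u X := by
    intro w hw s hs a b ha hb X hX
    rw [mem_cyl] at hX
    apply hsup
    rw [mem_cyl, ← dist_eq_norm]
    exact ⟨hball w hw s hs (by rw [mem_closedBall, dist_eq_norm]; exact hX.1), by linarith [hX.2.1],
      by linarith [hX.2.2]⟩
  have hdb := doubling hc hK1 hR0 H hu hβ hρ hm (r := r)
    ((Dr_mono (hball z hz _ hrR)).trans hD) (hcyl z hz _ hrR _ _ ht0 (by linarith)) h0 k hk1
  set t₁ := t₀ + K1 * ρ ^ 2 * ((4 ^ k - 1) / 3) with ht1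
  have h41 : (1:ℝ) ≤ 4 ^ k := one_le_pow₀ (by norm_num)
  have ht1a : t₀ ≤ t₁ := by
    have : (0:ℝ) ≤ 4 ^ k - 1 := by linarith
    have : 0 ≤ K1 * ρ ^ 2 * ((4 ^ k - 1) / 3) := by positivity
    linarith
  have ht1b : t₁ ≤ t₀ + K1 * r ^ 2 := by
    have e4 : ((4:ℝ) ^ k) = (2 ^ k) ^ 2 := by rw [← pow_mul, mul_comm, pow_mul]; norm_num
    have hsq : 4 ^ k * ρ ^ 2 ≤ r ^ 2 := by
      have h1 : (2 ^ k * ρ) ^ 2 ≤ r ^ 2 := by gcongr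
      rwa [mul_pow, ← e4] at h1
    have : K1 * ρ ^ 2 * ((4 ^ k - 1) / 3) ≤ K1 * r ^ 2 := by
      rw [mul_assoc]
      gcongr
      nlinarith [sq_nonneg ρ]
    linarith
  have hT1 : η / 4 ≤ τ - t₁ := by linarith
  have hT2 : τ - t₁ ≤ Λ + 1 := by linarith
  set ρ' := Real.sqrt ((τ - t₁) / (M * K1)) with hρ'
  have hq0 : 0 < (τ - t₁) / (M * K1) := div_pos (by linarith) (by positivity)
  have hρ'0 : 0 < ρ' := Real.sqrt_pos.2 hq0
  have hρ'2 : ρ' ^ 2 = (τ - t₁) / (M * K1) := Real.sq_sqrt hq0.le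
  have hMρ : M * (K1 * ρ' ^ 2) = τ - t₁ := by rw [hρ'2]; field_simp
  have hρ'r : ρ' ≤ r / 2 := by
    apply Real.sqrt_le_iff.2
    refine ⟨by positivity, ?_⟩
    rw [div_le_iff₀ (by positivity)]
    linarith
  have hMρ1 : 1 ≤ M * ρ' := by
    have h1 : 1 ≤ (M * ρ') ^ 2 := by
      have e : (M * ρ') ^ 2 = M * (τ - t₁) / K1 := by rw [mul_pow, hρ'2]; field_simp
      rw [e, le_div_iff₀ hK1]
      have := mul_le_mul_of_nonneg_left hT1 hM0.le
      linarith
    by_contra hcon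
    push Not at hcon
    have : (M * ρ') ^ 2 < 1 := pow_lt_one₀ (by positivity) hcon (by norm_num)
    linarith
  let p : ℕ → En n := fun i => z + ((min i M : ℕ) / (M:ℝ)) • (y - z)
  have hfr : ∀ i : ℕ, 0 ≤ (((min i M : ℕ) : ℝ) / M) ∧ (((min i M : ℕ) : ℝ) / M) ≤ 1 := by
    intro i
    refine ⟨by positivity, ?_⟩
    rw [div_le_one hM0]
    exact_mod_cast min_le_right i M
  have hpn : ∀ i, ‖p i‖ ≤ 1 / 2 := by
    intro i
    have e : p i = (1 - ((min i M : ℕ) : ℝ) / M) • z + (((min i M : ℕ) : ℝ) / M) • y := by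
      simp only [p]; module
    rw [e]
    refine (norm_add_le _ _).trans ?_
    rw [norm_smul, norm_smul, Real.norm_of_nonneg (hfr i).1, Real.norm_of_nonneg (by linarith [(hfr i).2])]
    have h1 := (hfr i).1
    have h2 : 0 ≤ 1 - ((min i M : ℕ) : ℝ) / M := by linarith [(hfr i).2]
    have h3 := mul_le_mul_of_nonneg_left hz h2
    have h4 := mul_le_mul_of_nonneg_left hy h1
    linarith
  have hyz : ‖y - z‖ ≤ 1 := (norm_sub_le _ _).trans (by linarith)
  have hstep : ∀ i, ‖p (i + 1) - p i‖ ≤ ρ' := by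
    intro i
    have e : p (i + 1) - p i = ((((min (i + 1) M : ℕ) : ℝ) - ((min i M : ℕ) : ℝ)) / M) • (y - z) := by
      simp only [p]; module
    have h1 : 0 ≤ ((min (i + 1) M : ℕ) : ℝ) - ((min i M : ℕ) : ℝ) := by
      rw [sub_nonneg]
      exact_mod_cast (by omega : min i M ≤ min (i + 1) M)
    have h2 : ((min (i + 1) M : ℕ) : ℝ) - ((min i M : ℕ) : ℝ) ≤ 1 := by
      rw [sub_le_iff_le_add]
      exact_mod_cast (by omega : min (i + 1) M ≤ 1 + min i M)
    rw [e, norm_smul, Real.norm_of_nonneg (by positivity), div_mul_eq_mul_div, div_le_iff₀ hM0]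
    calc _ ≤ (1:ℝ) * 1 := mul_le_mul h2 hyz (norm_nonneg _) zero_le_one
      _ ≤ _ := by linarith
  have hRρ' : R * ρ' ≤ 1 / 4 := by
    have : R * ρ' ≤ R * r := by gcongr; linarith
    linarith
  have hpM : p M = y := by
    simp only [p, min_self]
    rw [div_self hM0.ne', one_smul]; abel
  have hp0 : p 0 = z := by simp [p]
  have hfin := Spread.chain hc H hu hβ hρ'0 (t₀ := t₁) (m := c ^ k * m) (by positivity) p hstep M
    (fun i _ => (Dr_mono (hball (p i) (hpn i) _ hRρ')).trans hD)
    (by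
      intro i hi
      have hi' : ((i:ℝ) + 1) ≤ M := by exact_mod_cast hi
      have h1 : ((i:ℝ) + 1) * (K1 * ρ' ^ 2) ≤ M * (K1 * ρ' ^ 2) := by gcongr
      have h2 : 0 ≤ (i:ℝ) * (K1 * ρ' ^ 2) := by positivity
      exact hcyl (p i) (hpn i) _ hRρ' _ _ (by linarith) (by linarith))
    (by
      intro x hx
      rw [hp0] at hx
      refine hdb x (hx.trans (hρ'r.trans ?_))
      rw [pow_succ] at hk2; linarith) y (by rw [hpM, sub_self, norm_zero]; exact hρ'0.le)
  rw [hMρ, add_sub_cancel] at hfin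
  refine le_trans ?_ hfin
  have hkey : ρ ^ γ ≤ c ^ k := by
    have h1 : ρ ≤ (1 / 2) ^ k := by
      rw [one_div, inv_pow, le_inv_comm₀ hρ (by positivity), ← one_div, le_div_iff₀ hρ]
      linarith
    calc ρ ^ γ ≤ ((1 / 2 : ℝ) ^ k) ^ γ := by gcongr
      _ = ((1 / 2 : ℝ) ^ γ) ^ k := by rw [← pow_mul, ← pow_mul, mul_comm]
      _ ≤ _ := by gcongr
  calc c ^ M * ρ ^ γ * m ≤ c ^ M * c ^ k * m := by gcongr
    _ = _ := by ring

end poly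

end Hk

namespace Hk

section core

lemma low (hn : 0 < n) {ν : ℝ} (hν : 0 < ν) {S : ℝ} (hS0 : 0 ≤ S) :
    ∃ K a c : ℝ, 1 ≤ K ∧ 0 < a ∧ a ≤ 1 ∧ 0 < c ∧ ∀ (u₁ u₂ : En n × ℝ → ℝ) (β : En n → ℝ) (z : En n) (t l A : ℝ),
      ContDiff ℝ 2 u₁ → ContDiff ℝ 2 u₂ → Drift β → 0 < l → 0 < A → Dr β z l ≤ ENNReal.ofReal S →
      (∀ X ∈ cyl z l (t - K * l ^ 2) (t + 8 * l ^ 2), SupAt ν β u₁ X ∧ 0 ≤ u₁ X) →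
      (∀ X ∈ cyl z l (t - K * l ^ 2) t, SubAt ν β u₂ X ∧ u₂ X ≤ u₁ X ∧ u₂ X ≤ 9 / 8 * A) →
      u₂ (z, t) = A →
      ∃ p s, ‖p - z‖ ≤ l ∧ t - K * l ^ 2 ≤ s ∧ s ≤ t + 8 * l ^ 2 ∧
        ∀ x, ‖x - p‖ ≤ a * l → c * A ≤ u₁ (x, s) := by
  obtain ⟨K₀, hK₀, Hf⟩ := fill (n := n) hn hν S hS0
  obtain ⟨ε₁, μ₀, hε₁, hμ₀, Hg⟩ := growth_small (n := n) hn hν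
  obtain ⟨ε₂, c, R, hε₂, hc, hc1, hR, Hm⟩ := mp (n := n) hn hν hμ₀
  set ε := min ε₁ ε₂ with hε
  have hε0 : 0 < ε := lt_min hε₁ hε₂
  obtain ⟨k, hk⟩ := exists_nat_gt (S / ε)
  have hk0 : (0:ℝ) < k := lt_of_le_of_lt (by positivity) hk
  have hk1 : (1:ℝ) ≤ k := by exact_mod_cast hk0
  have hkn : 0 < k := by exact_mod_cast hk0
  rw [div_lt_iff₀ hε0] at hk
  have h4 : 1 ≤ 4 * (k:ℝ) * R := by nlinarith
  refine ⟨K₀ + 1, 1 / (4 * k * R), c / 2, by linarith, by positivity, ?_, by positivity, ?_⟩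
  · rw [div_le_one (by linarith)]; exact h4
  intro u₁ u₂ β z t l A hu₁ hu₂ hβ hl hA hD h1 h2 hz
  obtain ⟨r, hr1, hr2, hr3⟩ := shell hβ z (a := 0) (l := l) hkn hl hk.le (by rw [zero_add]; exact hD)
  rw [zero_add] at hr1 hr2
  set w := 1 / (4 * k * R) * l with hw
  have hw0 : 0 < w := by positivity
  have hwR : w * R = l / (4 * k) := by rw [hw]; field_simp
  have hwR' : w ≤ w * R := by nlinarith
  set q := l / (4 * (k:ℝ)) with hq
  have hq0 : 0 < q := by positivity
  have hr0 : 0 < r := by linarith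
  have hrl : r ≤ l := by linarith
  have hwl : w ≤ l := by linarith
  have hr2' : K₀ * r ^ 2 ≤ K₀ * l ^ 2 := by gcongr
  have hw2' : w ^ 2 ≤ l ^ 2 := by gcongr
  have hl2 : 0 < l ^ 2 := by positivity
  set b : ℝ := 16 / (9 * A) with hb
  have hb0 : 0 < b := by positivity
  have hbA : b * A = 16 / 9 := by rw [hb]; field_simp
  have hv : ContDiff ℝ 2 (fun X => b * u₂ X + (-1)) := by fun_prop
  have hvs : ∀ X ∈ cyl z l (t - (K₀ + 1) * l ^ 2) t, SubAt ν β (fun X => b * u₂ X + (-1)) X := fun X hX =>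
    SubAt.add_const (contDiff_const.mul hu₂) (SubAt.const_mul hu₂ (h2 X hX).1 hb0.le) _
  have hv1 : ∀ X ∈ cyl z l (t - (K₀ + 1) * l ^ 2) t, b * u₂ X + (-1) ≤ 1 := by
    intro X hX
    have := mul_le_mul_of_nonneg_left (h2 X hX).2.2 hb0.le
    linarith
  have hsub : ∀ X ∈ cyl z r (t - K₀ * r ^ 2) t, X ∈ cyl z l (t - (K₀ + 1) * l ^ 2) t := by
    intro X hX
    rw [mem_cyl] at hX ⊢
    exact ⟨by linarith [hX.1], by linarith [hX.2.1], hX.2.2⟩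
  have hlat : ∃ (p : En n) (s : ℝ), ‖p - z‖ = r ∧ t - K₀ * r ^ 2 ≤ s ∧ s ≤ t ∧ 1 / 2 < b * u₂ (p, s) + (-1) := by
    by_contra hcon
    push Not at hcon
    have := Hf (fun X => b * u₂ X + (-1)) β z r (t - K₀ * r ^ 2) t hv hβ hr0 (by linarith)
      ((Dr_mono (closedBall_subset_closedBall hrl)).trans hD) (fun X hX => hvs X (hsub X hX))
      (fun X hX => hv1 X (hsub X hX)) (fun x s hx hs1 hs2 => hcon x s hx hs1 hs2) z
      (by rw [sub_self, norm_zero]; exact hr0.le)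
    rw [hz] at this
    linarith
  obtain ⟨p, s, hp, hs1, hs2, hps⟩ := hlat
  have hDp := hr3 p hp
  have hpb : closedBall p (w * R) ⊆ closedBall z l := by
    intro y hy
    rw [mem_closedBall, dist_eq_norm] at *
    have := norm_sub_le_norm_sub_add_norm_sub y p z
    linarith
  have hsub2 : ∀ X ∈ cyl p w (s - w ^ 2) s, X ∈ cyl z l (t - (K₀ + 1) * l ^ 2) t := by
    intro X hX
    rw [mem_cyl] at hX ⊢
    refine ⟨?_, by linarith [hX.2.1], by linarith [hX.2.2]⟩
    rw [← dist_eq_norm]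
    exact hpb (by rw [mem_closedBall, dist_eq_norm]; linarith [hX.1])
  have hvol : ENNReal.ofReal (μ₀ * w ^ (n + 2)) ≤
      volume {X ∈ cyl p w (s - w ^ 2) s | 0 < b * u₂ X + (-1)} := by
    by_contra hcon
    push Not at hcon
    have := Hg (fun X => b * u₂ X + (-1)) β p w s hv hβ hw0
      (((Dr_mono (closedBall_subset_closedBall (by linarith))).trans hDp).trans
        (ENNReal.ofReal_le_ofReal (min_le_left _ _)))
      (fun X hX => hvs X (hsub2 X hX)) (fun X hX => hv1 X (hsub2 X hX)) hcon.le
    linarith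
  refine ⟨p, s - w ^ 2 + w ^ 2 * 4, by linarith, by nlinarith, by linarith, ?_⟩
  intro x hx
  have := Hm u₁ β (A / 2) p w (s - w ^ 2) hu₁ hβ (by linarith) hw0
    (by rw [hwR]; exact hDp.trans (ENNReal.ofReal_le_ofReal (min_le_right _ _))) ?_ ?_ x hx
  · linarith
  · intro X hX
    apply h1
    rw [mem_cyl] at hX ⊢
    refine ⟨?_, by linarith [hX.2.1], by linarith [hX.2.2]⟩
    rw [← dist_eq_norm]
    exact hpb (by rw [mem_closedBall, dist_eq_norm]; linarith [hX.1])
  · refine hvol.trans (measure_mono ?_)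
    rintro X ⟨hX, hX0⟩
    refine ⟨by rw [sub_add_cancel]; exact hX, ?_⟩
    have h3 := (h2 X (hsub2 X hX)).2.1
    refine lt_of_lt_of_le ?_ h3
    by_contra hcon
    push Not at hcon
    have := mul_le_mul_of_nonneg_left hcon hb0.le
    have e : b * (A / 2) = 8 / 9 := by linarith
    have hX0' : 0 < b * u₂ X + (-1) := hX0
    linarith

set_option maxHeartbeats 1000000 in
theorem core (hn : 0 < n) {ν : ℝ} (hν : 0 < ν) {S : ℝ} (hS0 : 0 ≤ S) {η Λ : ℝ} (hη : 0 < η) (hΛ : η ≤ Λ) :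
    ∃ N : ℝ, 0 < N ∧ ∀ (u₁ u₂ : En n × ℝ → ℝ) (β : En n → ℝ),
      ContDiff ℝ 2 u₁ → ContDiff ℝ 2 u₂ → Drift β → Dr β 0 1 ≤ ENNReal.ofReal S →
      (∀ X ∈ cyl (0 : En n) 1 (-1) Λ, SupAt ν β u₁ X ∧ 0 ≤ u₁ X) →
      (∀ X ∈ cyl (0 : En n) 1 (-1) Λ, SubAt ν β u₂ X ∧ u₂ X ≤ u₁ X) →
      ∀ y τ, ‖y‖ ≤ 1 / 4 → η ≤ τ → τ ≤ Λ → u₂ (0, 0) ≤ N * u₁ (y, τ) := by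
  obtain ⟨K, a, c, hK, ha, ha1, hc, Hl⟩ := low (n := n) hn hν hS0
  obtain ⟨r, C, γ, hr, hr1, hC, Hp⟩ := poly (n := n) hn hν hS0 hη hΛ
  set g := γ + 1 with hg
  set κ : ℝ := 1 / (9 * (g + 1)) with hκ
  have hκ0 : 0 < κ := by positivity
  have hgκ : (g:ℝ) * κ ≤ 1 / 9 := by
    rw [hκ, mul_one_div, div_le_div_iff₀ (by positivity) (by norm_num)]; linarith
  have hκ1 : κ ≤ 1 / 9 := by
    rw [hκ, div_le_div_iff₀ (by positivity) (by norm_num)]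
    have : (0:ℝ) ≤ g := Nat.cast_nonneg _
    linarith
  have hbern : 8 / 9 ≤ (1 - κ) ^ g := by
    have := one_add_mul_le_pow (show (-2:ℝ) ≤ -κ by linarith) g
    rw [← sub_eq_add_neg] at this
    linarith
  set b : ℝ := min (κ / K) (min (η / 16) r) with hb
  have hb0 : 0 < b := by positivity
  have hbK : K * b ≤ κ := by
    have : b ≤ κ / K := min_le_left _ _
    rw [le_div_iff₀ (by linarith)] at this
    linarith
  have hbη : b ≤ η / 16 := (min_le_right _ _).trans (min_le_left _ _)
  have hbr : b ≤ r := (min_le_right _ _).trans (min_le_right _ _)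
  have hbκ : b ≤ κ := le_trans (le_mul_of_one_le_left hb0.le hK) hbK
  refine ⟨1 / (C * (a * b) ^ g * c * (1 / 2) ^ g), by positivity, ?_⟩
  intro u₁ u₂ β hu₁ hu₂ hβ hD h1 h2 y τ hy hτ hτΛ
  have hu1y : 0 ≤ u₁ (y, τ) := (h1 (y, τ) (by rw [mem_cyl]; simp only [sub_zero]; exact ⟨by linarith, by linarith, hτΛ⟩)).2
  rcases le_or_gt (u₂ (0, 0)) 0 with hA0 | hA0
  · exact hA0.trans (by positivity)
  rw [div_mul_eq_mul_div, one_mul, le_div_iff₀ (by positivity)]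
  let w : En n × ℝ → ℝ := fun X => min (1 / 2 - ‖X.1‖) (X.2 + 1 / 2)
  have hwc : Continuous w := by simp only [w]; fun_prop
  obtain ⟨⟨x, t⟩, hX, hmax⟩ := (isCompact_cyl (0 : En n) (1 / 2) (-(1 / 2)) 0).exists_isMaxOn
    ⟨(0, 0), by rw [mem_cyl]; simp only [sub_zero, norm_zero]; norm_num⟩
    ((hwc.pow g).mul hu₂.continuous).continuousOn
  have hmax' : ∀ X ∈ cyl (0 : En n) (1 / 2) (-(1 / 2)) 0, w X ^ g * u₂ X ≤ w (x, t) ^ g * u₂ (x, t) :=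
    fun X hX => hmax hX
  rw [mem_cyl, sub_zero] at hX
  obtain ⟨hx1, ht1, ht2⟩ := hX
  dsimp only at hx1 ht1 ht2
  have hw0 : 0 ≤ w (x, t) := le_min (by simp only; linarith) (by simp only; linarith)
  have h00 := hmax' (0, 0) (by rw [mem_cyl]; simp only [sub_zero, norm_zero]; norm_num)
  have hw00 : w (0, 0) = 1 / 2 := by simp [w]
  rw [hw00] at h00
  have hpos : 0 < w (x, t) ^ g * u₂ (x, t) := lt_of_lt_of_le (by positivity) h00
  have hwx1 : w (x, t) ≤ 1 / 2 - ‖x‖ := min_le_left _ _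
  have hwx2 : w (x, t) ≤ t + 1 / 2 := min_le_right _ _
  set W := w (x, t) with hW
  set A := u₂ (x, t) with hA
  have hWp : 0 < W := by
    rcases hw0.eq_or_lt with h | h
    · rw [← h, zero_pow (by omega), zero_mul] at hpos
      exact absurd hpos (lt_irrefl _)
    · exact h
  have hAp : 0 < A := by
    by_contra hcon
    push Not at hcon
    have : W ^ g * A ≤ 0 := mul_nonpos_of_nonneg_of_nonpos (by positivity) hcon
    linarith
  have hW1 : W ≤ 1 / 2 := by linarith [norm_nonneg x]
  set l := b * W with hl
  have hl0 : 0 < l := by positivity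
  have hlκ : l ≤ κ * W := mul_le_mul_of_nonneg_right hbκ hWp.le
  have hκW : κ * W ≤ W := by
    have := mul_le_mul_of_nonneg_right (show κ ≤ 1 by linarith) hWp.le
    linarith
  have hlb : l ≤ b := mul_le_of_le_one_right hb0.le (by linarith)
  have hl1 : l ≤ 1 := by linarith
  have hll : l ^ 2 ≤ l := by
    have := mul_le_mul_of_nonneg_left hl1 hl0.le
    rw [sq]; linarith
  have hKl : K * l ^ 2 ≤ κ * W := by
    have : K * l ^ 2 ≤ K * l := by gcongr
    have h3 : K * l = (K * b) * W := by rw [hl]; ring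
    have h4 : (K * b) * W ≤ κ * W := by gcongr
    linarith
  have hball : closedBall x l ⊆ closedBall (0 : En n) 1 := by
    intro y hy
    rw [mem_closedBall, dist_eq_norm] at *
    have := norm_sub_le_norm_sub_add_norm_sub y x 0
    rw [sub_zero, sub_zero] at *
    linarith
  obtain ⟨p, s, hp, hs1, hs2, hps⟩ := Hl u₁ u₂ β x t l A hu₁ hu₂ hβ hl0 hAp ((Dr_mono hball).trans hD)
    (by
      intro X hX
      apply h1
      rw [mem_cyl] at hX ⊢
      refine ⟨?_, by linarith [hX.2.1], by linarith [hX.2.2]⟩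
      rw [← dist_eq_norm]
      exact hball (by rw [mem_closedBall, dist_eq_norm]; exact hX.1))
    (by
      intro X hX
      rw [mem_cyl] at hX
      have hXn : ‖X.1‖ ≤ ‖x‖ + l := by
        have := norm_sub_le_norm_sub_add_norm_sub X.1 x 0
        rw [sub_zero, sub_zero] at this
        linarith [hX.1]
      have h3 := h2 X (by
        rw [mem_cyl, sub_zero]
        exact ⟨by linarith, by linarith [hX.2.1], by linarith [hX.2.2]⟩)
      refine ⟨h3.1, h3.2, ?_⟩
      rcases le_or_gt (u₂ X) 0 with h | h
      · linarith
      have hwX : (1 - κ) * W ≤ w X := by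
        refine le_min ?_ ?_
        · linarith
        · linarith [hX.2.1]
      have h4 := hmax' X (by
        rw [mem_cyl, sub_zero]
        exact ⟨by linarith, by linarith [hX.2.1], by linarith [hX.2.2]⟩)
      have h5 : ((1 - κ) * W) ^ g ≤ w X ^ g := by
        have : 0 ≤ (1 - κ) * W := mul_nonneg (by linarith) hWp.le
        gcongr
      have h6 : W ^ g * (8 / 9 * u₂ X) ≤ W ^ g * A := by
        calc W ^ g * (8 / 9 * u₂ X) ≤ W ^ g * ((1 - κ) ^ g * u₂ X) := by gcongr
          _ = ((1 - κ) * W) ^ g * u₂ X := by rw [mul_pow]; ring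
          _ ≤ w X ^ g * u₂ X := by gcongr
          _ ≤ _ := h4
      have h7 := le_of_mul_le_mul_left h6 (by positivity)
      linarith) rfl
  have hpn : ‖p‖ ≤ 1 / 2 := by
    have := norm_sub_le_norm_sub_add_norm_sub p x 0
    rw [sub_zero, sub_zero] at this
    linarith
  have hal : a * l ≤ l := mul_le_of_le_one_left hl0.le ha1
  have := Hp u₁ β p (a * l) s (c * A) hu₁ hβ hD h1 hpn (by linarith) (by linarith) (by positivity) (by linarith)
    (by positivity) hps y τ hy hτ hτΛ
  refine le_trans ?_ this
  have hpow : (a * l) ^ g ≤ (a * l) ^ γ := pow_le_pow_of_le_one (by positivity) (by linarith) (by omega)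
  calc u₂ (0, 0) * (C * (a * b) ^ g * c * (1 / 2) ^ g)
      = (C * (a * b) ^ g * c) * ((1 / 2) ^ g * u₂ (0, 0)) := by ring
    _ ≤ (C * (a * b) ^ g * c) * (W ^ g * A) := by gcongr
    _ = C * (a * l) ^ g * (c * A) := by rw [hl, mul_pow, mul_pow, mul_pow]; ring
    _ ≤ _ := by gcongr

end core

end Hk

namespace Hk

section red

theorem core_scaled (hn : 0 < n) {ν : ℝ} (hν : 0 < ν) {S : ℝ} (hS0 : 0 ≤ S) {η Λ : ℝ} (hη : 0 < η) (hΛ : η ≤ Λ) :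
    ∃ N : ℝ, 0 < N ∧ ∀ (u₁ u₂ : En n × ℝ → ℝ) (β : En n → ℝ) (z : En n) (t₀ r : ℝ), 0 < r →
      ContDiff ℝ 2 u₁ → ContDiff ℝ 2 u₂ → Drift β → Dr β z r ≤ ENNReal.ofReal S →
      (∀ X ∈ cyl z r (t₀ - r ^ 2) (t₀ + r ^ 2 * Λ), SupAt ν β u₁ X ∧ 0 ≤ u₁ X) →
      (∀ X ∈ cyl z r (t₀ - r ^ 2) (t₀ + r ^ 2 * Λ), SubAt ν β u₂ X ∧ u₂ X ≤ u₁ X) →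
      ∀ y τ, ‖y - z‖ ≤ r / 4 → t₀ + r ^ 2 * η ≤ τ → τ ≤ t₀ + r ^ 2 * Λ → u₂ (z, t₀) ≤ N * u₁ (y, τ) := by
  obtain ⟨N, hN, H⟩ := core (n := n) hn hν hS0 hη hΛ
  refine ⟨N, hN, ?_⟩
  intro u₁ u₂ β z t₀ r hr hu₁ hu₂ hβ hD h1 h2 y τ hy hτ hτΛ
  have hmem : ∀ X ∈ cyl (0 : En n) 1 (-1) Λ, smap z t₀ r X ∈ cyl z r (t₀ - r ^ 2) (t₀ + r ^ 2 * Λ) := by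
    intro X hX
    have := smap_mem (z := z) (t₀ := t₀) hr hX
    rw [mul_one, mul_neg, mul_one, ← sub_eq_add_neg] at this
    exact this
  have hr2 : 0 < r ^ 2 := by positivity
  have := H (fun Y => u₁ (smap z t₀ r Y)) (fun Y => u₂ (smap z t₀ r Y)) (bsc β z r)
    (contDiff_comp_smap hu₁) (contDiff_comp_smap hu₂) (hβ.bsc z hr.le)
    (by rw [Dr_bsc z hr]; simpa using hD)
    (fun X hX => ⟨SupAt.smap hu₁ hr.le (h1 _ (hmem X hX)).1, (h1 _ (hmem X hX)).2⟩)
    (fun X hX => ⟨SubAt.smap hu₂ hr.le (h2 _ (hmem X hX)).1, (h2 _ (hmem X hX)).2⟩)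
    (r⁻¹ • (y - z)) ((τ - t₀) / r ^ 2) ?_ ?_ ?_
  · rw [smap_inv (z := z) (t₀ := t₀) hr (y, τ)] at this
    simpa [smap] using this
  · rw [norm_smul, norm_inv, Real.norm_of_nonneg hr.le, inv_mul_le_iff₀ hr]; linarith
  · rw [le_div_iff₀ hr2]; linarith
  · rw [div_le_iff₀ hr2]; linarith

/-- distance of the equation to being solvable by the second order part -/
def Fd (ν p : ℝ) (q : Fin n → Fin n → ℝ) : ℝ :=
  ⨅ a : {a : Matrix (Fin n) (Fin n) ℝ // Ell ν a}, |p - ∑ i, ∑ j, a.1 i j * q i j|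

lemma Fd_le {ν : ℝ} (p : ℝ) (q : Fin n → Fin n → ℝ) {a : Matrix (Fin n) (Fin n) ℝ} (ha : Ell ν a) :
    Fd ν p q ≤ |p - ∑ i, ∑ j, a i j * q i j| :=
  ciInf_le (f := fun a : {a : Matrix (Fin n) (Fin n) ℝ // Ell ν a} => |p - ∑ i, ∑ j, a.1 i j * q i j|)
    ⟨0, by rintro _ ⟨a, rfl⟩; exact abs_nonneg _⟩ ⟨a, ha⟩

lemma Fd_nonneg (ν p : ℝ) (q : Fin n → Fin n → ℝ) : 0 ≤ Fd ν p q :=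
  Real.iInf_nonneg fun _ => abs_nonneg _

lemma Fd_exists {ν : ℝ} (p : ℝ) (q : Fin n → Fin n → ℝ) (hne : ∃ a : Matrix (Fin n) (Fin n) ℝ, Ell ν a)
    {κ : ℝ} (hκ : 0 < κ) :
    ∃ a : Matrix (Fin n) (Fin n) ℝ, Ell ν a ∧ |p - ∑ i, ∑ j, a i j * q i j| ≤ Fd ν p q + κ := by
  obtain ⟨a₀, ha₀⟩ := hne
  have : Nonempty {a : Matrix (Fin n) (Fin n) ℝ // Ell ν a} := ⟨⟨a₀, ha₀⟩⟩
  obtain ⟨a, ha⟩ := exists_lt_of_ciInf_lt (f := fun a : {a : Matrix (Fin n) (Fin n) ℝ // Ell ν a} =>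
    |p - ∑ i, ∑ j, a.1 i j * q i j|) (show _ < Fd ν p q + κ by unfold Fd; linarith)
  exact ⟨a.1, a.2, ha.le⟩

lemma sum_diff_le {ν : ℝ} (hν : 0 ≤ ν) (q q' : Fin n → Fin n → ℝ) {a : Matrix (Fin n) (Fin n) ℝ} (ha : Ell ν a) :
    |(∑ i, ∑ j, a i j * q i j) - ∑ i, ∑ j, a i j * q' i j| ≤ ∑ i, ∑ j, ν * |q i j - q' i j| := by
  rw [← Finset.sum_sub_distrib]
  refine (Finset.abs_sum_le_sum_abs _ _).trans (Finset.sum_le_sum fun i _ => ?_)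
  rw [← Finset.sum_sub_distrib]
  refine (Finset.abs_sum_le_sum_abs _ _).trans (Finset.sum_le_sum fun j _ => ?_)
  rw [← mul_sub, abs_mul]
  exact mul_le_mul_of_nonneg_right (ha.entry_le hν i j) (abs_nonneg _)

lemma Fd_lip {ν : ℝ} (hν : 0 ≤ ν) (hne : ∃ a : Matrix (Fin n) (Fin n) ℝ, Ell ν a)
    (p p' : ℝ) (q q' : Fin n → Fin n → ℝ) :
    Fd ν p q ≤ Fd ν p' q' + (|p - p'| + ∑ i, ∑ j, ν * |q i j - q' i j|) := by
  refine le_of_forall_pos_le_add fun κ hκ => ?_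
  obtain ⟨a, ha, h⟩ := Fd_exists p' q' hne hκ
  have h1 := Fd_le p q ha
  have h2 := sum_diff_le hν q q' ha
  have h3 : |p - ∑ i, ∑ j, a i j * q i j| ≤ |p' - ∑ i, ∑ j, a i j * q' i j| + |p - p'| +
      |(∑ i, ∑ j, a i j * q i j) - ∑ i, ∑ j, a i j * q' i j| := by
    have e : p - ∑ i, ∑ j, a i j * q i j = (p' - ∑ i, ∑ j, a i j * q' i j) + (p - p') -
      ((∑ i, ∑ j, a i j * q i j) - ∑ i, ∑ j, a i j * q' i j) := by ring
    rw [e]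
    exact (abs_sub _ _).trans (by gcongr; exact abs_add_le _ _)
  linarith

lemma Fd_contOn {ν : ℝ} (hν : 0 ≤ ν) (hne : ∃ a : Matrix (Fin n) (Fin n) ℝ, Ell ν a)
    {Q : Set (En n × ℝ)} {p : En n × ℝ → ℝ} {q : Fin n → Fin n → En n × ℝ → ℝ}
    (hp : ContinuousOn p Q) (hq : ∀ i j, ContinuousOn (q i j) Q) :
    ContinuousOn (fun X => Fd ν (p X) (fun i j => q i j X)) Q := by
  intro X hX
  rw [ContinuousWithinAt, tendsto_iff_dist_tendsto_zero]
  have hc : ContinuousOn (fun Y => |p Y - p X| + ∑ i, ∑ j, ν * |q i j Y - q i j X|) Q := by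
    refine (hp.sub continuousOn_const).abs.add (continuousOn_finsetSum _ fun i _ =>
      continuousOn_finsetSum _ fun j _ => continuousOn_const.mul ((hq i j).sub continuousOn_const).abs)
  have h0 := hc X hX
  rw [ContinuousWithinAt] at h0
  simp only [sub_self, abs_zero, mul_zero, Finset.sum_const_zero, add_zero] at h0
  refine squeeze_zero (fun _ => dist_nonneg) (fun Y => ?_) h0
  rw [Real.dist_eq, abs_le]
  have h1 := Fd_lip hν hne (p X) (p Y) (fun i j => q i j X) (fun i j => q i j Y)
  have h2 := Fd_lip hν hne (p Y) (p X) (fun i j => q i j Y) (fun i j => q i j X)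
  have e : |p X - p Y| + ∑ i, ∑ j, ν * |q i j X - q i j Y| = |p Y - p X| + ∑ i, ∑ j, ν * |q i j Y - q i j X| := by
    simp only [abs_sub_comm]
  constructor <;> linarith

/-- spatial gradient in the frozen form -/
def Du (u : En n × ℝ → ℝ) (X : En n × ℝ) : En n := WithLp.toLp 2 (fun i => Dx u i X)

lemma Du_contOn {u : En n × ℝ → ℝ} {Q : Set (En n × ℝ)} (h : ∀ i, ContinuousOn (Dx u i) Q) :
    ContinuousOn (Du u) Q := by
  have : ContinuousOn (fun X => (fun i => Dx u i X)) Q := continuousOn_pi.2 h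
  exact (PiLp.continuous_toLp 2 (fun _ : Fin n => ℝ)).comp_continuousOn this

lemma quot_contOn {Q : Set (En n × ℝ)} {d : En n × ℝ → ℝ} {g : En n × ℝ → En n} {κ : ℝ} (hκ : 0 < κ)
    (hd : ContinuousOn d Q) (hg : ContinuousOn g Q) (h0 : ∀ X ∈ Q, g X = 0 → d X ≤ 0) :
    ContinuousOn (fun X => max (d X - κ) 0 / ‖g X‖) Q := by
  intro X hX
  by_cases hgX : g X = 0
  · have h1 : ∀ᶠ Y in nhdsWithin X Q, d Y < κ := (hd X hX).eventually (gt_mem_nhds (by linarith [h0 X hX hgX]))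
    have h2 : (fun X => max (d X - κ) 0 / ‖g X‖) =ᶠ[nhdsWithin X Q] fun _ => 0 := by
      filter_upwards [h1] with Y hY
      rw [max_eq_right (by linarith), zero_div]
    refine (continuousWithinAt_const (b := (0:ℝ))).congr_of_eventuallyEq h2 ?_
    simp [hgX]
  · exact ContinuousWithinAt.div (((hd X hX).sub continuousWithinAt_const).max continuousWithinAt_const) (hg X hX).norm
      (by simpa using hgX)

lemma tietze {C : Set (En n × ℝ)} (hC : IsClosed C) {f : En n × ℝ → ℝ} (hf : ContinuousOn f C) :
    ∃ G : En n × ℝ → ℝ, Continuous G ∧ ∀ X ∈ C, G X = f X := by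
  obtain ⟨G, hG⟩ := ContinuousMap.exists_restrict_eq hC ⟨C.domRestrict f, continuousOn_iff_continuous_domRestrict.1 hf⟩
  refine ⟨G, G.continuous, fun X hX => ?_⟩
  exact congrArg (fun F : C(C, ℝ) => F ⟨X, hX⟩) hG

lemma le_essSup_of_cont {f : ℝ → ℝ} {b : ℝ → En n} {T t : ℝ} (hf : ContinuousOn f (Ioo 0 T))
    (hb : ∀ s ∈ Ioo 0 T, f s ≤ ‖b s‖) (ht : t ∈ Ioo 0 T) :
    ENNReal.ofReal (f t) ≤ essSup (fun s => (‖b s‖₊ : ℝ≥0∞)) (volume.restrict (Ioo 0 T)) := by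
  by_contra hcon
  push Not at hcon
  set E := essSup (fun s => (‖b s‖₊ : ℝ≥0∞)) (volume.restrict (Ioo 0 T)) with hE
  have hae : ∀ᵐ s ∂(volume.restrict (Ioo 0 T)), (‖b s‖₊ : ℝ≥0∞) ≤ E := ENNReal.ae_le_essSup _
  have hc : ContinuousOn (fun s => ENNReal.ofReal (f s)) (Ioo 0 T) :=
    ENNReal.continuous_ofReal.comp_continuousOn hf
  have hopen : IsOpen (Ioo 0 T ∩ (fun s => ENNReal.ofReal (f s)) ⁻¹' Ioi E) :=
    hc.isOpen_inter_preimage isOpen_Ioo isOpen_Ioi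
  have hpos := hopen.measure_pos volume ⟨t, ht, hcon⟩
  rw [ae_restrict_iff' measurableSet_Ioo, ae_iff] at hae
  refine hpos.ne' (measure_mono_null ?_ hae)
  rintro s ⟨hs, hs2⟩
  simp only [mem_ofPred_eq]
  push Not
  refine ⟨hs, lt_of_lt_of_le hs2 ?_⟩
  have e : (‖b s‖₊ : ℝ≥0∞) = ENNReal.ofReal ‖b s‖ := (ofReal_norm (b s)).symm
  rw [e]
  exact ENNReal.ofReal_le_ofReal (hb s hs)

theorem beta {ν S T : ℝ} (hν : 0 ≤ ν) {Ω : Set (En n)} {u : En n × ℝ → ℝ}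
    {a : En n × ℝ → Matrix (Fin n) (Fin n) ℝ} {b : En n × ℝ → En n}
    (hu : IsC21 u (Ω ×ˢ Ioo (0 : ℝ) T)) (ha : UnifParabolic ν a (Ω ×ˢ Ioo (0 : ℝ) T))
    (hb : LxnLtinfPow b (Ω ×ˢ Ioo (0 : ℝ) T) ≤ ENNReal.ofReal S)
    (heq : ∀ X ∈ Ω ×ˢ Ioo (0 : ℝ) T, -Dt u X + Lop a b u X = 0)
    {z : En n} {r t₀ t₁ : ℝ} (hr : 0 ≤ r) (hz : closedBall z r ⊆ Ω) (ht₀ : 0 < t₀) (ht : t₀ ≤ t₁) (ht₁ : t₁ < T)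
    {κ : ℝ} (hκ : 0 < κ) :
    ∃ β : En n → ℝ, Drift β ∧ Dr β z r ≤ ENNReal.ofReal S ∧ ∀ X ∈ cyl z r t₀ t₁, ∃ a' : Matrix (Fin n) (Fin n) ℝ,
      Ell ν a' ∧ |Dt u X - ∑ i, ∑ j, a' i j * Dxx u i j X| ≤ β X.1 * ‖Du u X‖ + κ := by
  set Q := Ω ×ˢ Ioo (0 : ℝ) T with hQ
  have hCQ : cyl z r t₀ t₁ ⊆ Q := by
    rintro X ⟨h1, h2⟩
    exact ⟨hz h1, lt_of_lt_of_le ht₀ h2.1, lt_of_le_of_lt h2.2 ht₁⟩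
  have hzz : (z, t₀) ∈ cyl z r t₀ t₁ := by rw [mem_cyl]; simp [hr, ht]
  have hne : ∃ a : Matrix (Fin n) (Fin n) ℝ, Ell ν a := ⟨a (z, t₀), ha _ (hCQ hzz)⟩
  let d : En n × ℝ → ℝ := fun X => Fd ν (Dt u X) (fun i j => Dxx u i j X)
  have hd : ContinuousOn d Q := Fd_contOn hν hne hu.cont_t hu.cont_xx
  have hDu := Du_contOn hu.cont_x
  have hdb : ∀ X ∈ Q, d X ≤ ‖b X‖ * ‖Du u X‖ := by
    intro X hX
    refine (Fd_le _ _ (ha X hX)).trans ?_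
    have h1 := heq X hX
    unfold Lop at h1
    have h2 : Dt u X - ∑ i, ∑ j, a X i j * Dxx u i j X = ⟪Du u X, b X⟫ := by
      rw [PiLp.inner_apply]
      have : ∑ i, b X i * Dx u i X = ∑ i, ⟪Du u X i, b X i⟫ := by
        apply Finset.sum_congr rfl
        intro i _
        simp [Du]
      rw [← this]
      linarith
    rw [h2, mul_comm]
    exact abs_real_inner_le_norm _ _
  let g : En n × ℝ → ℝ := fun X => max (d X - κ / 2) 0 / ‖Du u X‖
  have hg : ContinuousOn g Q := quot_contOn (by linarith) hd hDu (fun X hX h => by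
    have := hdb X hX
    rwa [h, norm_zero, mul_zero] at this)
  have hg0 : ∀ X, 0 ≤ g X := fun X => div_nonneg (le_max_right _ _) (norm_nonneg _)
  have hgb : ∀ X ∈ Q, g X ≤ ‖b X‖ := by
    intro X hX
    apply div_le_of_le_mul₀ (norm_nonneg _) (norm_nonneg _)
    refine max_le ?_ (by positivity)
    linarith [hdb X hX]
  have hdg : ∀ X ∈ Q, d X ≤ g X * ‖Du u X‖ + κ / 2 := by
    intro X hX
    rcases (norm_nonneg (Du u X)).eq_or_lt with h | h
    · have := hdb X hX
      rw [← h] at this ⊢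
      linarith
    · have : g X * ‖Du u X‖ = max (d X - κ / 2) 0 := div_mul_cancel₀ _ h.ne'
      rw [this]
      linarith [le_max_left (d X - κ / 2) 0]
  obtain ⟨G, hGc, hG⟩ := tietze (isCompact_cyl z r t₀ t₁).isClosed (hg.mono hCQ)
  let f : En n → ℝ → ℝ := fun x t => max (G (x, t)) 0
  have hfc : Continuous ↿f := hGc.max continuous_const
  have hfc' : ∀ x, Continuous (f x) := fun x => hfc.comp (Continuous.prodMk_right x)
  have hne' : (Icc t₀ t₁).Nonempty := ⟨t₀, le_rfl, ht⟩
  have hbdd : ∀ x, BddAbove (f x '' Icc t₀ t₁) := fun x =>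
    (isCompact_Icc.image (hfc' x)).bddAbove
  have hfg : ∀ x ∈ closedBall z r, ∀ t ∈ Icc t₀ t₁, f x t = g (x, t) := by
    intro x hx t ht
    simp only [f]
    rw [hG (x, t) ⟨hx, ht⟩, max_eq_left (hg0 _)]
  refine ⟨fun x => sSup (f x '' Icc t₀ t₁), ⟨isCompact_Icc.continuous_sSup hfc, ?_⟩, ?_, ?_⟩
  · intro x
    exact Real.sSup_nonneg (by rintro _ ⟨t, _, rfl⟩; exact le_max_right _ _)
  · refine le_trans ?_ hb
    unfold Dr LxnLtinfPow
    refine le_trans (setLIntegral_mono' measurableSet_closedBall ?_) (setLIntegral_le_lintegral _ _)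
    intro x hx
    have hset : {t | (x, t) ∈ Q} = Ioo 0 T := by
      ext t; simp [hQ, hz hx]
    rw [hset]
    gcongr
    obtain ⟨t, ht, hmax⟩ := isCompact_Icc.exists_sSup_image_eq hne' (hfc' x).continuousOn
    have hmax' : (fun x => sSup (f x '' Icc t₀ t₁)) x = f x t := hmax
    rw [hmax', hfg x hx t ht]
    refine le_essSup_of_cont (f := fun t => g (x, t)) (b := fun t => b (x, t)) ?_ ?_ ⟨by linarith [ht.1], by linarith [ht.2]⟩
    · exact hg.comp (Continuous.prodMk_right x).continuousOn (fun s hs => ⟨hz hx, hs⟩)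
    · exact fun s hs => hgb _ ⟨hz hx, hs⟩
  · intro X hX
    obtain ⟨a', ha', h⟩ := Fd_exists (Dt u X) (fun i j => Dxx u i j X) hne (half_pos hκ)
    refine ⟨a', ha', h.trans ?_⟩
    have h1 : d X ≤ g X * ‖Du u X‖ + κ / 2 := hdg X (hCQ hX)
    have h2 : g X ≤ sSup (f X.1 '' Icc t₀ t₁) := by
      rw [← hfg X.1 hX.1 X.2 hX.2]
      exact le_csSup (hbdd _) ⟨X.2, hX.2, rfl⟩
    have h3 := mul_le_mul_of_nonneg_right h2 (norm_nonneg (Du u X))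
    have h4 : Fd ν (Dt u X) (fun i j => Dxx u i j X) = d X := rfl
    rw [h4]
    linarith

end red

end Hk

namespace Hk

section moll
open Filter Topology

instance haar_prod : (volume : Measure (En n × ℝ)).IsAddHaarMeasure :=
  inferInstanceAs (((volume : Measure (En n)).prod (volume : Measure ℝ)).IsAddHaarMeasure)

/-- mollification -/
def Mo (φ : ContDiffBump (0 : En n × ℝ)) (f : En n × ℝ → ℝ) : En n × ℝ → ℝ :=
  convolution (φ.normed volume) f (ContinuousLinearMap.lsmul ℝ ℝ) volume

lemma Mo_apply (φ : ContDiffBump (0 : En n × ℝ)) (f : En n × ℝ → ℝ) (X) :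
    Mo φ f X = ∫ Y, φ.normed volume Y • f (X - Y) := rfl

lemma contDiff_Mo (φ : ContDiffBump (0 : En n × ℝ)) {f : En n × ℝ → ℝ} (hf : Continuous f) :
    ContDiff ℝ 2 (Mo φ f) :=
  HasCompactSupport.contDiff_convolution_left _ φ.hasCompactSupport_normed (φ.contDiff_normed (n := 2))
    hf.locallyIntegrable

lemma dist_Mo_le (φ : ContDiffBump (0 : En n × ℝ)) {f : En n × ℝ → ℝ} (hf : Continuous f) {X κ}
    (h : ∀ Y, dist Y X < φ.rOut → dist (f Y) (f X) ≤ κ) : |Mo φ f X - f X| ≤ κ := by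
  rw [← Real.dist_eq]
  exact φ.dist_normed_convolution_le hf.aestronglyMeasurable (fun Y hY => h Y hY)

lemma moll_deriv (φ : ContDiffBump (0 : En n × ℝ)) {f f' : En n × ℝ → ℝ} (hf : Continuous f)
    (hf' : Continuous f') (e X : En n × ℝ) {ε₁ : ℝ} (hε : φ.rOut < ε₁)
    (hd : ∀ Y, dist Y X < ε₁ → HasLineDerivAt ℝ f (f' Y) Y e) :
    fderiv ℝ (Mo φ f) X e = Mo φ f' X := by
  have h1 : HasLineDerivAt ℝ (Mo φ f) (fderiv ℝ (Mo φ f) X e) X e :=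
    (((contDiff_Mo φ hf).differentiable (by norm_num)).differentiableAt.hasFDerivAt).hasLineDerivAt e
  obtain ⟨B, hB⟩ := (isCompact_closedBall X ε₁).exists_bound_of_continuousOn hf'.continuousOn
  set σ := (ε₁ - φ.rOut) / (‖e‖ + 1) with hσ
  have he1 : 0 < ‖e‖ + 1 := by positivity
  have hσ0 : 0 < σ := div_pos (by linarith) he1
  have hσe : σ * (‖e‖ + 1) = ε₁ - φ.rOut := div_mul_cancel₀ _ he1.ne'
  have hφc : Continuous (φ.normed volume : En n × ℝ → ℝ) := φ.continuous_normed
  have hφi : Integrable (φ.normed volume : En n × ℝ → ℝ) := φ.integrable_normed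
  have hclose : ∀ Y ∈ ball (0 : En n × ℝ) φ.rOut, ∀ s ∈ ball (0 : ℝ) σ, dist (X + s • e - Y) X < ε₁ := by
    intro Y hY s hs
    rw [mem_ball_zero_iff] at hY hs
    rw [dist_eq_norm]
    have : X + s • e - Y - X = s • e - Y := by abel
    rw [this]
    have h2 := norm_sub_le (s • e) Y
    rw [norm_smul] at h2
    have h3 : ‖s‖ * ‖e‖ ≤ σ * ‖e‖ := by gcongr
    linarith
  have key := hasDerivAt_integral_of_dominated_loc_of_deriv_le (μ := (volume : Measure (En n × ℝ)))
    (F := fun s Y => φ.normed volume Y • f (X + s • e - Y))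
    (F' := fun s Y => φ.normed volume Y • f' (X + s • e - Y)) (x₀ := (0:ℝ)) (s := ball (0:ℝ) σ)
    (bound := fun Y => φ.normed volume Y * B) (ball_mem_nhds _ hσ0) ?_ ?_ ?_ ?_ ?_ ?_
  · have h2 := key.2
    have h3 := h1.unique (show HasLineDerivAt ℝ (Mo φ f) _ X e from h2)
    rw [h3, Mo_apply]
    simp only [zero_smul, add_zero]
  · exact Eventually.of_forall fun s => (by fun_prop : Continuous _).aestronglyMeasurable
  · refine Continuous.integrable_of_hasCompactSupport (by fun_prop) ?_
    exact φ.hasCompactSupport_normed.smul_right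
  · exact (by fun_prop : Continuous _).aestronglyMeasurable
  · refine Eventually.of_forall fun Y s hs => ?_
    rw [norm_smul, Real.norm_of_nonneg (φ.nonneg_normed Y)]
    by_cases hY : Y ∈ ball (0 : En n × ℝ) φ.rOut
    · exact mul_le_mul_of_nonneg_left (hB _ (hclose Y hY s hs).le) (φ.nonneg_normed Y)
    · rw [← φ.support_normed_eq (μ := volume), Function.mem_support, not_not] at hY
      rw [hY, zero_mul, zero_mul]
  · exact hφi.mul_const B
  · refine Eventually.of_forall fun Y s hs => ?_
    by_cases hY : Y ∈ ball (0 : En n × ℝ) φ.rOut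
    · have h2 := hd _ (hclose Y hY s hs)
      unfold HasLineDerivAt at h2
      rw [← sub_self s] at h2
      have h3 := HasDerivAt.comp_sub_const s s h2
      refine (h3.congr_of_eventuallyEq (Eventually.of_forall fun s' => ?_)).const_smul (φ.normed volume Y)
      congr 1
      module
    · rw [← φ.support_normed_eq (μ := volume), Function.mem_support, not_not] at hY
      simp only [hY, zero_smul]
      exact hasDerivAt_const _ _

lemma unif_ev {f : En n × ℝ → ℝ} (hf : Continuous f) {C : Set (En n × ℝ)} (hC : IsCompact C) {κ : ℝ} (hκ : 0 < κ) :
    ∀ᶠ ε in 𝓝[>] (0:ℝ), ∀ X ∈ C, ∀ Y, dist Y X < ε → dist (f Y) (f X) ≤ κ := by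
  have := hC.uniformContinuousAt_of_continuousAt f (fun a _ => hf.continuousAt) (Metric.dist_mem_uniformity hκ)
  obtain ⟨ε₀, hε₀, h⟩ := Metric.mem_uniformity_dist.1 this
  filter_upwards [Ioo_mem_nhdsGT hε₀] with ε hε X hX Y hY
  have := h (a := X) (b := Y) (by rw [dist_comm]; linarith [hε.2]) hX
  rw [dist_comm]
  exact le_of_lt this

lemma line_x {f : En n × ℝ → ℝ} {Y : En n × ℝ} (h : DifferentiableAt ℝ (fun x => f (x, Y.2)) Y.1) (i : Fin n) :
    HasLineDerivAt ℝ f (Dx f i Y) Y (ex i) := by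
  have h1 := h.hasFDerivAt.hasLineDerivAt (EuclideanSpace.single i (1:ℝ))
  unfold HasLineDerivAt at h1 ⊢
  refine h1.congr_of_eventuallyEq (Eventually.of_forall fun s => ?_)
  simp only
  congr 1
  apply Prod.ext <;> simp [ex]

lemma line_t {f : En n × ℝ → ℝ} {Y : En n × ℝ} (h : DifferentiableAt ℝ (fun t => f (Y.1, t)) Y.2) :
    HasLineDerivAt ℝ f (Dt f Y) Y (0, 1) := by
  have h1 := h.hasDerivAt
  rw [← add_zero Y.2] at h1
  have h2 := HasDerivAt.comp_const_add Y.2 0 h1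
  unfold HasLineDerivAt
  rw [add_zero] at h2
  refine h2.congr_of_eventuallyEq (Eventually.of_forall fun s => ?_)
  simp only
  congr 1
  apply Prod.ext <;> simp

theorem smooth_approx {u : En n × ℝ → ℝ} {Q C : Set (En n × ℝ)} (hQ : IsOpen Q) (hu : IsC21 u Q)
    (hC : IsCompact C) (hCQ : C ⊆ Q) {κ : ℝ} (hκ : 0 < κ) :
    ∃ v : En n × ℝ → ℝ, ContDiff ℝ 2 v ∧ ∀ X ∈ C, |v X - u X| ≤ κ ∧ |Tt v X - Dt u X| ≤ κ ∧
      (∀ i, |Gi v i X - Dx u i X| ≤ κ) ∧ ∀ i j, |Hh v i j X - Dxx u i j X| ≤ κ := by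
  obtain ⟨ρ, hρ, hρQ⟩ := hC.exists_cthickening_subset_open hQ hCQ
  have hK : IsClosed (cthickening ρ C) := isClosed_cthickening
  have hCK : C ⊆ thickening ρ C := self_subset_thickening hρ C
  have hTK : thickening ρ C ⊆ cthickening ρ C := thickening_subset_cthickening _ _
  obtain ⟨U, hUc, hU⟩ := tietze hK (hu.cont.mono hρQ)
  obtain ⟨Ut, hUtc, hUt⟩ := tietze hK (hu.cont_t.mono hρQ)
  choose Ux hUxc hUx using fun i => tietze hK ((hu.cont_x i).mono hρQ)
  choose Uxx hUxxc hUxx using fun i j => tietze hK ((hu.cont_xx i j).mono hρQ)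
  have hev : ∀ {f g : En n × ℝ → ℝ}, (∀ X ∈ cthickening ρ C, f X = g X) → ∀ Y ∈ thickening ρ C, f =ᶠ[𝓝 Y] g := by
    intro f g h Y hY
    filter_upwards [isOpen_thickening.mem_nhds hY] with Z hZ
    exact h Z (hTK hZ)
  have l1 : ∀ Y ∈ thickening ρ C, HasLineDerivAt ℝ U (Ut Y) Y (0, 1) := by
    intro Y hY
    rw [hUt Y (hTK hY)]
    exact (line_t (hu.diff_t Y (hρQ (hTK hY)))).congr_of_eventuallyEq (hev hU Y hY)
  have l2 : ∀ i, ∀ Y ∈ thickening ρ C, HasLineDerivAt ℝ U (Ux i Y) Y (ex i) := by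
    intro i Y hY
    rw [hUx i Y (hTK hY)]
    exact (line_x (hu.diff_x Y (hρQ (hTK hY))) i).congr_of_eventuallyEq (hev hU Y hY)
  have l3 : ∀ i j, ∀ Y ∈ thickening ρ C, HasLineDerivAt ℝ (Ux j) (Uxx i j Y) Y (ex i) := by
    intro i j Y hY
    rw [hUxx i j Y (hTK hY)]
    exact (line_x (hu.diff_xx j Y (hρQ (hTK hY))) i).congr_of_eventuallyEq (hev (hUx j) Y hY)
  obtain ⟨ε, ⟨⟨⟨e1, e2⟩, e3⟩, e4⟩, hε⟩ := ((((unif_ev hUc hC hκ).and (unif_ev hUtc hC hκ)).and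
    (eventually_all.2 fun i => unif_ev (hUxc i) hC hκ)).and
    (eventually_all.2 fun i => eventually_all.2 fun j => unif_ev (hUxxc i j) hC hκ)).and
    (Ioo_mem_nhdsGT (half_pos hρ)) |>.exists
  let φ : ContDiffBump (0 : En n × ℝ) := ⟨ε / 2, ε, half_pos hε.1, half_lt_self hε.1⟩
  have hnear : ∀ X ∈ C, ∀ Z, dist Z X < ρ / 2 → ∀ Y, dist Y Z < ρ / 2 → Y ∈ thickening ρ C := by
    intro X hX Z hZ Y hY
    rw [mem_thickening_iff]
    exact ⟨X, hX, by linarith [dist_triangle Y Z X]⟩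
  have hG : ∀ i, ∀ X ∈ C, ∀ Z, dist Z X < ρ / 2 → Gi (Mo φ U) i Z = Mo φ (Ux i) Z := by
    intro i X hX Z hZ
    exact moll_deriv φ hUc (hUxc i) (ex i) Z hε.2 (fun Y hY => l2 i Y (hnear X hX Z hZ Y hY))
  have hX0 : ∀ X : En n × ℝ, dist X X < ρ / 2 := fun X => by rw [dist_self]; linarith
  refine ⟨Mo φ U, contDiff_Mo φ hUc, fun X hX => ⟨?_, ?_, fun i => ?_, fun i j => ?_⟩⟩
  · rw [← hU X (hTK (hCK hX))]
    exact dist_Mo_le φ hUc (e1 X hX)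
  · have : Tt (Mo φ U) X = Mo φ Ut X :=
      moll_deriv φ hUc hUtc (0, 1) X hε.2 (fun Y hY => l1 Y (hnear X hX X (hX0 X) Y hY))
    rw [this, ← hUt X (hTK (hCK hX))]
    exact dist_Mo_le φ hUtc (e2 X hX)
  · rw [hG i X hX X (hX0 X), ← hUx i X (hTK (hCK hX))]
    exact dist_Mo_le φ (hUxc i) (e3 i X hX)
  · have h1 : Gi (Mo φ U) j =ᶠ[𝓝 X] Mo φ (Ux j) := by
      filter_upwards [ball_mem_nhds X (half_pos hρ)] with Z hZ
      exact hG j X hX Z hZ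
    have h2 : Hh (Mo φ U) i j X = Mo φ (Uxx i j) X := by
      unfold Hh
      rw [h1.fderiv_eq]
      exact moll_deriv φ (hUxc j) (hUxxc i j) (ex i) X hε.2 (fun Y hY => l3 i j Y (hnear X hX X (hX0 X) Y hY))
    rw [h2, ← hUxx i j X (hTK (hCK hX))]
    exact dist_Mo_le φ (hUxxc i j) (e4 i j X hX)

end moll

end Hk

namespace Hk

section loc

lemma norm_le_sum (x : En n) : ‖x‖ ≤ ∑ i, |x i| := by
  conv_lhs => rw [sum_single_eq x]
  refine (norm_sum_le _ _).trans (Finset.sum_le_sum fun i _ => ?_)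
  rw [norm_smul]
  simp

theorem approx {ν S T : ℝ} (hν : 0 ≤ ν) {Ω : Set (En n)} (hΩ : IsOpen Ω) {u : En n × ℝ → ℝ}
    {a : En n × ℝ → Matrix (Fin n) (Fin n) ℝ} {b : En n × ℝ → En n}
    (hu : IsC21 u (Ω ×ˢ Ioo (0 : ℝ) T)) (ha : UnifParabolic ν a (Ω ×ˢ Ioo (0 : ℝ) T))
    (hb : LxnLtinfPow b (Ω ×ˢ Ioo (0 : ℝ) T) ≤ ENNReal.ofReal S)
    (heq : ∀ X ∈ Ω ×ˢ Ioo (0 : ℝ) T, -Dt u X + Lop a b u X = 0)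
    {z : En n} {r t₀ t₁ : ℝ} (hr : 0 ≤ r) (hz : closedBall z r ⊆ Ω) (ht₀ : 0 < t₀) (ht : t₀ ≤ t₁) (ht₁ : t₁ < T)
    {θ : ℝ} (hθ : 0 < θ) :
    ∃ (v : En n × ℝ → ℝ) (β : En n → ℝ), ContDiff ℝ 2 v ∧ Drift β ∧ Dr β z r ≤ ENNReal.ofReal S ∧
      ∀ X ∈ cyl z r t₀ t₁, |v X - u X| ≤ θ ∧ ∃ a' : Matrix (Fin n) (Fin n) ℝ,
      Ell ν a' ∧ |Tt v X - aH a' v X| ≤ β X.1 * ‖Gr v X‖ + 2 * θ := by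
  obtain ⟨β, hβ, hD, h⟩ := beta hν hu ha hb heq hr hz ht₀ ht ht₁ hθ
  obtain ⟨B, hB⟩ := (isCompact_closedBall z r).exists_bound_of_continuousOn hβ.1.continuousOn
  have hB0 : 0 ≤ B := (norm_nonneg _).trans (hB z (mem_closedBall_self hr))
  have hCQ : cyl z r t₀ t₁ ⊆ Ω ×ˢ Ioo (0 : ℝ) T := by
    rintro X ⟨h1, h2⟩
    exact ⟨hz h1, lt_of_lt_of_le ht₀ h2.1, lt_of_le_of_lt h2.2 ht₁⟩
  set M : ℝ := B * n + 1 + n * (n * ν) with hM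
  have hM1 : 1 ≤ M := by
    have h1 : 0 ≤ B * n := by positivity
    have h2 : 0 ≤ (n:ℝ) * (n * ν) := by positivity
    linarith
  have hM0 : 0 < M := by linarith
  have hκ0 : 0 < θ / M := by positivity
  obtain ⟨v, hv, hvu⟩ := smooth_approx (hΩ.prod isOpen_Ioo) hu (isCompact_cyl z r t₀ t₁) hCQ hκ0
  set κ := θ / M with hκ
  have hκM : κ * M = θ := div_mul_cancel₀ _ hM0.ne'
  refine ⟨v, β, hv, hβ, hD, fun X hX => ?_⟩
  obtain ⟨h1, h2, h3, h4⟩ := hvu X hX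
  obtain ⟨a', ha', h5⟩ := h X hX
  refine ⟨h1.trans (div_le_self hθ.le hM1), a', ha', ?_⟩
  have h6 : ‖Du u X - Gr v X‖ ≤ n * κ := by
    refine (norm_le_sum _).trans ?_
    refine (Finset.sum_le_sum (g := fun _ => κ) fun i _ => ?_).trans (by simp)
    have := h3 i
    rw [abs_sub_comm] at this
    exact this
  have h7 : ‖Du u X‖ ≤ ‖Gr v X‖ + n * κ := by
    have := norm_sub_norm_le (Du u X) (Gr v X)
    linarith
  have hβ0 := hβ.2 X.1
  have hβB : β X.1 ≤ B := (le_abs_self _).trans (hB X.1 hX.1)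
  have h8 : β X.1 * ‖Du u X‖ ≤ β X.1 * ‖Gr v X‖ + B * (n * κ) := by
    have e1 := mul_le_mul_of_nonneg_left h7 hβ0
    have e2 : β X.1 * (n * κ) ≤ B * (n * κ) := mul_le_mul_of_nonneg_right hβB (by positivity)
    linarith
  have h9 : |aH a' v X - ∑ i, ∑ j, a' i j * Dxx u i j X| ≤ n * (n * (ν * κ)) := by
    refine (sum_diff_le hν (fun i j => Hh v i j X) (fun i j => Dxx u i j X) ha').trans ?_
    refine (Finset.sum_le_sum (g := fun _ => n * (ν * κ)) fun i _ => ?_).trans (by simp)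
    refine (Finset.sum_le_sum (g := fun _ => ν * κ) fun j _ => ?_).trans (by simp)
    exact mul_le_mul_of_nonneg_left (h4 i j) hν
  have h10 : B * (n * κ) + κ + n * (n * (ν * κ)) = θ := by rw [← hκM, hM]; ring
  rw [abs_le] at *
  constructor <;> linarith [h2.1, h2.2, h5.1, h5.2, h9.1, h9.2]

lemma contDiff_lin (c d : ℝ) : ContDiff ℝ 2 (fun Y : En n × ℝ => c * Y.2 + d) := by fun_prop

lemma fderiv_lin (c d : ℝ) (X e : En n × ℝ) : fderiv ℝ (fun Y : En n × ℝ => c * Y.2 + d) X e = c * e.2 := by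
  have h : HasFDerivAt (fun Y : En n × ℝ => c * Y.2 + d) (c • ContinuousLinearMap.snd ℝ (En n) ℝ) X :=
    ((hasFDerivAt_snd (𝕜 := ℝ) (E := En n) (F := ℝ)).const_mul c).add_const d
  rw [h.fderiv]; simp

lemma Tt_lin (c d : ℝ) (X : En n × ℝ) : Tt (fun Y : En n × ℝ => c * Y.2 + d) X = c := by
  unfold Tt; rw [fderiv_lin]; simp

lemma Gi_lin (c d : ℝ) (i : Fin n) : Gi (fun Y : En n × ℝ => c * Y.2 + d) i = fun _ => 0 := by
  funext X; unfold Gi; rw [fderiv_lin]; simp [ex]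

lemma Gr_lin (c d : ℝ) (X : En n × ℝ) : Gr (fun Y : En n × ℝ => c * Y.2 + d) X = 0 := by
  ext i; simp [Gi_lin]

lemma aH_lin (c d : ℝ) (a) (X : En n × ℝ) : aH a (fun Y : En n × ℝ => c * Y.2 + d) X = 0 := by
  simp [aH, Hh, Gi_lin]

theorem local_harnack (hn : 0 < n) {ν : ℝ} (hν : 0 < ν) {S : ℝ} (hS0 : 0 ≤ S) {Λ : ℝ} (hΛ : 0 < Λ) :
    ∃ N : ℝ, 0 < N ∧ ∀ (T : ℝ) (Ω : Set (En n)) (u : En n × ℝ → ℝ)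
      (a : En n × ℝ → Matrix (Fin n) (Fin n) ℝ) (b : En n × ℝ → En n), IsOpen Ω →
      IsC21 u (Ω ×ˢ Ioo (0 : ℝ) T) → UnifParabolic ν a (Ω ×ˢ Ioo (0 : ℝ) T) →
      LxnLtinfPow b (Ω ×ˢ Ioo (0 : ℝ) T) ≤ ENNReal.ofReal S →
      (∀ X ∈ Ω ×ˢ Ioo (0 : ℝ) T, 0 ≤ u X) →
      (∀ X ∈ Ω ×ˢ Ioo (0 : ℝ) T, -Dt u X + Lop a b u X = 0) →
      ∀ (z : En n) (t₀ r : ℝ), 0 < r → closedBall z r ⊆ Ω → 0 < t₀ - r ^ 2 → t₀ + r ^ 2 * Λ < T →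
      ∀ y, ‖y - z‖ ≤ r / 4 → u (z, t₀) ≤ N * u (y, t₀ + r ^ 2 * Λ) := by
  obtain ⟨N, hN, H⟩ := core_scaled (n := n) hn hν hS0 hΛ le_rfl
  refine ⟨N, hN, ?_⟩
  intro T Ω u a b hΩ hu ha hb hu0 heq z t₀ r hr hz ht hT y hy
  refine le_of_forall_pos_le_add fun ε hε => ?_
  have hr2 : 0 < r ^ 2 := by positivity
  have hrΛ : 0 < r ^ 2 * Λ := by positivity
  set M : ℝ := 1 + 2 * r ^ 2 + N * (2 + 2 * (r ^ 2 + r ^ 2 * Λ)) with hM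
  have hM0 : 0 < M := by positivity
  have hθ0 : 0 < ε / M := by positivity
  set θ := ε / M with hθ
  have hθM : θ * M = ε := div_mul_cancel₀ _ hM0.ne'
  obtain ⟨v, β, hv, hβ, hD, h⟩ := approx hν.le hΩ hu ha hb heq hr.le hz ht (by linarith) hT hθ0
  have hCQ : cyl z r (t₀ - r ^ 2) (t₀ + r ^ 2 * Λ) ⊆ Ω ×ˢ Ioo (0 : ℝ) T := by
    rintro X ⟨h1, h2⟩
    exact ⟨hz h1, lt_of_lt_of_le ht h2.1, lt_of_le_of_lt h2.2 hT⟩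
  have hl1 := contDiff_lin (n := n) (2 * θ) (θ - 2 * θ * (t₀ - r ^ 2))
  have hl2 := contDiff_lin (n := n) (-(2 * θ)) (2 * θ * (t₀ - r ^ 2))
  have hw1 : ContDiff ℝ 2 (fun Y => v Y + (2 * θ * Y.2 + (θ - 2 * θ * (t₀ - r ^ 2)))) := hv.add hl1
  have hw2 : ContDiff ℝ 2 (fun Y => v Y + (-(2 * θ) * Y.2 + 2 * θ * (t₀ - r ^ 2))) := hv.add hl2
  have key := H (fun Y => v Y + (2 * θ * Y.2 + (θ - 2 * θ * (t₀ - r ^ 2))))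
    (fun Y => v Y + (-(2 * θ) * Y.2 + 2 * θ * (t₀ - r ^ 2))) β z t₀ r hr hw1 hw2 hβ hD
    (by
      intro X hX
      obtain ⟨h1, a', ha', h2⟩ := h X hX
      have h3 := hu0 X (hCQ hX)
      rw [abs_le] at h1 h2
      have h4 : 0 ≤ 2 * θ * (X.2 - (t₀ - r ^ 2)) := mul_nonneg (by linarith) (by linarith [(mem_cyl.1 hX).2.1])
      refine ⟨(supAt_iff hw1).2 ⟨a', ha', ?_⟩, by linarith [h1.1]⟩
      rw [Tt_add hv hl1, aH_add hv hl1, Gr_add hv hl1, Tt_lin, aH_lin, Gr_lin, add_zero, add_zero]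
      linarith [h2.1])
    (by
      intro X hX
      obtain ⟨h1, a', ha', h2⟩ := h X hX
      rw [abs_le] at h1 h2
      have h4 : 0 ≤ 2 * θ * (X.2 - (t₀ - r ^ 2)) := mul_nonneg (by linarith) (by linarith [(mem_cyl.1 hX).2.1])
      refine ⟨⟨a', ha', ?_⟩, by linarith [h1.1]⟩
      rw [Tt_add hv hl2, aH_add hv hl2, Gr_add hv hl2, Tt_lin, aH_lin, Gr_lin, add_zero, add_zero]
      linarith [h2.2])
    y (t₀ + r ^ 2 * Λ) hy le_rfl le_rfl
  dsimp only at key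
  have h1 := (abs_le.1 (h (z, t₀) (by rw [mem_cyl]; simp only [sub_self, norm_zero]; exact ⟨hr.le, by linarith, by linarith⟩)).1).1
  have h2 := (abs_le.1 (h (y, t₀ + r ^ 2 * Λ) (by rw [mem_cyl]; exact ⟨by dsimp only; linarith, by dsimp only; linarith, le_rfl⟩)).1).2
  have h3 := mul_le_mul_of_nonneg_left h2 hN.le
  have h4 : θ * M = θ + 2 * θ * r ^ 2 + N * (2 * θ + 2 * θ * (r ^ 2 + r ^ 2 * Λ)) := by rw [hM]; ring
  have h5 : N * (v (y, t₀ + r ^ 2 * Λ) + (2 * θ * (t₀ + r ^ 2 * Λ) + (θ - 2 * θ * (t₀ - r ^ 2)))) =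
    N * (v (y, t₀ + r ^ 2 * Λ) - u (y, t₀ + r ^ 2 * Λ)) + N * u (y, t₀ + r ^ 2 * Λ) + N * θ + N * (2 * θ * (r ^ 2 + r ^ 2 * Λ)) := by ring
  have h6 : v (z, t₀) + (-(2 * θ) * t₀ + 2 * θ * (t₀ - r ^ 2)) = v (z, t₀) - 2 * θ * r ^ 2 := by ring
  rw [h5, h6] at key
  linarith

lemma ball_sub {Ω : Set (En n)} {δ : ℝ} (hδ : 0 < δ) {x : En n} (hx : x ∈ Ω)
    (h : δ < Metric.infDist x (frontier Ω)) : closedBall x (δ / 2) ⊆ Ω := by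
  intro y hy
  by_contra hcon
  have hpre : IsPreconnected (closedBall x (δ / 2)) := (convex_closedBall x (δ / 2)).isPreconnected
  have hnf : ∀ p ∈ closedBall x (δ / 2), p ∉ frontier Ω := by
    intro p hp hpf
    have := Metric.infDist_le_dist_of_mem (x := x) hpf
    rw [mem_closedBall, dist_comm] at hp
    linarith
  have hcov : ∀ p ∈ closedBall x (δ / 2), (p ∈ Ω → p ∈ interior Ω) ∧ (p ∉ Ω → p ∈ (closure Ω)ᶜ) := by
    intro p hp
    have h1 := hnf p hp
    rw [frontier, mem_diff, not_and, not_not] at h1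
    exact ⟨fun h2 => h1 (subset_closure h2), fun h2 h3 => h2 (interior_subset (h1 h3))⟩
  have hxb : x ∈ closedBall x (δ / 2) := mem_closedBall_self (by linarith)
  obtain ⟨p, _, hp1, hp2⟩ := hpre (interior Ω) (closure Ω)ᶜ isOpen_interior isClosed_closure.isOpen_compl
    (fun p hp => (em (p ∈ Ω)).imp (hcov p hp).1 (hcov p hp).2)
    ⟨x, hxb, (hcov x hxb).1 hx⟩ ⟨y, hy, (hcov y hy).2 hcon⟩
  exact hp2 (subset_closure (interior_subset hp1))

theorem final (hn : 0 < n) (ν S R₀ T δ : ℝ) (hν : 1 ≤ ν) (hT : 0 < T) (hδ : 0 < δ) :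
    ∃ N : ℝ, 0 < N ∧
      ∀ (Ω : Set (En n)) (u : En n × ℝ → ℝ)
        (a : En n × ℝ → Matrix (Fin n) (Fin n) ℝ) (b : En n × ℝ → En n),
        IsOpen Ω → Bornology.IsBounded Ω → Metric.diam Ω ≤ R₀ →
        IsConnected {x ∈ Ω | δ < Metric.infDist x (frontier Ω)} →
        IsC21 u (Ω ×ˢ Ioo (0 : ℝ) T) →
        UnifParabolic ν a (Ω ×ˢ Ioo (0 : ℝ) T) →
        LxnLtinfPow b (Ω ×ˢ Ioo (0 : ℝ) T) ≤ ENNReal.ofReal S →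
        (∀ X ∈ Ω ×ˢ Ioo (0 : ℝ) T, 0 ≤ u X) →
        (∀ X ∈ Ω ×ˢ Ioo (0 : ℝ) T, -Dt u X + Lop a b u X = 0) →
        ∀ X ∈ {x ∈ Ω | δ < Metric.infDist x (frontier Ω)} ×ˢ Ioo (δ ^ 2) T,
          ∀ Y ∈ {x ∈ Ω | δ < Metric.infDist x (frontier Ω)} ×ˢ Ioo (δ ^ 2) T,
            δ ^ 2 ≤ Y.2 - X.2 → u X ≤ N * u Y := by
  set rl : ℝ := δ / 2 * (δ / √T) with hrl
  have hsT : 0 < √T := Real.sqrt_pos.2 hT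
  have hrl0 : 0 < rl := by positivity
  obtain ⟨k₁, hk₁⟩ := chain_exists n R₀ (h := rl / 4) (by positivity)
  set k := max k₁ 1 with hk
  have hkk : k₁ ≤ k := le_max_left _ _
  have hk0 : (0:ℝ) < k := by
    have : 1 ≤ k := le_max_right _ _
    exact_mod_cast this
  set Λ : ℝ := 4 * T / (k * δ ^ 2) with hΛ
  have hΛ0 : 0 < Λ := by positivity
  obtain ⟨N, hN, H⟩ := local_harnack (n := n) hn (ν := ν) (by linarith) (S := max S 0) (le_max_right _ _) hΛ0
  refine ⟨N ^ k, by positivity, ?_⟩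
  rintro Ω u a b hΩ hbd hdiam hconn hu ha hb hu0 heq ⟨x, t⟩ ⟨hx, ht1, ht2⟩ ⟨y, s⟩ ⟨hy, hs1, hs2⟩ hst
  dsimp only at hx ht1 ht2 hy hs1 hs2 hst
  have hb' : LxnLtinfPow b (Ω ×ˢ Ioo (0 : ℝ) T) ≤ ENNReal.ofReal (max S 0) :=
    hb.trans (ENNReal.ofReal_le_ofReal (le_max_left _ _))
  set A := {x ∈ Ω | δ < Metric.infDist x (frontier Ω)} with hA
  have hAR : A ⊆ closedBall x R₀ := by
    intro w hw
    exact (Metric.dist_le_diam_of_mem hbd hw.1 hx.1).trans hdiam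
  obtain ⟨p, hp0, hpk, hpA, hps⟩ := hk₁ A x hconn.isPreconnected hAR x hx y hy k hkk
  set h := (s - t) / k with hh
  have hkh : k * h = s - t := mul_div_cancel₀ _ hk0.ne'
  have hδ2 : 0 < δ ^ 2 := by positivity
  have hh0 : 0 < h := div_pos (by linarith) hk0
  set r := √(h / Λ) with hr
  have hr0 : 0 < r := Real.sqrt_pos.2 (by positivity)
  have hr2 : r ^ 2 = h / Λ := Real.sq_sqrt (by positivity)
  have hr2Λ : r ^ 2 * Λ = h := by rw [hr2]; exact div_mul_cancel₀ _ hΛ0.ne'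
  have hr2' : r ^ 2 = (s - t) * δ ^ 2 / (4 * T) := by
    rw [hr2, hΛ, hh]; field_simp
  have hrhi : r ^ 2 ≤ (δ / 2) ^ 2 := by
    rw [hr2', div_le_iff₀ (by positivity)]
    have : (s - t) * δ ^ 2 ≤ T * δ ^ 2 := mul_le_mul_of_nonneg_right (by linarith) hδ2.le
    linarith
  have hrδ : r ≤ δ / 2 := (sq_le_sq₀ hr0.le (by positivity)).1 hrhi
  have hrlo : rl ≤ r := by
    refine (sq_le_sq₀ hrl0.le hr0.le).1 ?_
    rw [hr2', hrl, mul_pow, div_pow, div_pow, Real.sq_sqrt hT.le, div_mul_div_comm, div_le_div_iff₀ (by positivity) (by positivity)]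
    have : δ ^ 2 * δ ^ 2 ≤ (s - t) * δ ^ 2 := mul_le_mul_of_nonneg_right hst hδ2.le
    nlinarith
  have key : ∀ i : ℕ, i ≤ k → u (x, t) ≤ N ^ i * u (p i, t + i * h) := by
    intro i
    induction i with
    | zero => intro _; simp [hp0]
    | succ i ih =>
      intro hi
      refine (ih (by omega)).trans ?_
      have hik : ((i:ℝ) + 1) * h ≤ k * h := by
        apply mul_le_mul_of_nonneg_right _ hh0.le
        exact_mod_cast hi
      have hih : 0 ≤ (i:ℝ) * h := by positivity
      have h1 := H T Ω u a b hΩ hu ha hb' hu0 heq (p i) (t + i * h) r hr0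
        ((closedBall_subset_closedBall hrδ).trans (ball_sub hδ (hpA i).1 (hpA i).2))
        (by nlinarith) (by rw [hr2Λ]; linarith) (p (i + 1)) ((hps i).trans (by linarith))
      rw [hr2Λ] at h1
      have e : t + ((i + 1 : ℕ) : ℝ) * h = t + i * h + h := by push_cast; ring
      rw [e, pow_succ, mul_assoc]
      exact mul_le_mul_of_nonneg_left h1 (by positivity)
  have := key k le_rfl
  rw [hpk k le_rfl, hkh, add_sub_cancel] at this
  exact this

end loc

end Hk

/-- **Harnack principle in a bounded cylinder** (Theorem 8.1). -/
theorem harnack_principle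
    (n : ℕ) (hn : 0 < n) (ν S R₀ T δ : ℝ) (hν : 1 ≤ ν) (hT : 0 < T) (hδ : 0 < δ) :
    ∃ N : ℝ, 0 < N ∧
      ∀ (Ω : Set (En n)) (u : En n × ℝ → ℝ)
        (a : En n × ℝ → Matrix (Fin n) (Fin n) ℝ) (b : En n × ℝ → En n),
        IsOpen Ω → IsConnected Ω → Bornology.IsBounded Ω → Metric.diam Ω ≤ R₀ →
        IsConnected {x ∈ Ω | δ < Metric.infDist x (frontier Ω)} →
        IsC21 u (Ω ×ˢ Ioo (0 : ℝ) T) →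
        UnifParabolic ν a (Ω ×ˢ Ioo (0 : ℝ) T) →
        LxnLtinfPow b (Ω ×ˢ Ioo (0 : ℝ) T) ≤ ENNReal.ofReal S →
        (∀ X ∈ Ω ×ˢ Ioo (0 : ℝ) T, 0 ≤ u X) →
        (∀ X ∈ Ω ×ˢ Ioo (0 : ℝ) T, -Dt u X + Lop a b u X = 0) →
        ∀ X ∈ {x ∈ Ω | δ < Metric.infDist x (frontier Ω)} ×ˢ Ioo (δ ^ 2) T,
          ∀ Y ∈ {x ∈ Ω | δ < Metric.infDist x (frontier Ω)} ×ˢ Ioo (δ ^ 2) T,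
            δ ^ 2 ≤ Y.2 - X.2 → u X ≤ N * u Y := by
  obtain ⟨N, hN, H⟩ := Hk.final hn ν S R₀ T δ hν hT hδ
  exact ⟨N, hN, fun Ω u a b h1 _ h3 h4 h5 h6 h7 h8 h9 h10 => H Ω u a b h1 h3 h4 h5 h6 h7 h8 h9 h10⟩
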